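/- arXiv:2603.27054 — 3 statements merged into one kernel-verified Lean document; each statement's English description precedes it below -/
import Mathlib

section
/- Let S be a closed surface with a fixed metric inducing its topology and let K be a nonempty compact subset of S. Then the decomposition D_K = {[x]_∼ : x ∈ K} into classes of the Schönflies equivalence refines every Peano decomposition of K: for every Peano decomposition D of K and every x ∈ K, the class [x]_∼ is contained in the element D(x) of D that contains x. -/
open Set Metric Filter Topology unitInterval

/-- A space is locally euclidean of dimension 2 if every point has an open neighborhood
homeomorphic to `ℝ²`. A *closed surface* is a nonempty compact connected Hausdorff space
with this property. -/
def IsSurfaceLocallyEuclidean (S : Type*) [TopologicalSpace S] : Prop :=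
  ∀ x : S, ∃ U : Set S, IsOpen U ∧ x ∈ U ∧ Nonempty (U ≃ₜ (ℝ × ℝ))

/-- The Schönflies relation of a compact set `K` on a (metric) surface `S`: pairs `(x, x)`
with `x ∈ K`, together with pairs of distinct points `x, y ∈ K` for which there is a
topological embedding `φ` of the square `[0,1]²` into `S` (a marked quadrilateral with
marked sides `I₁ = φ([0,1]×{0})` and `I₂ = φ([0,1]×{1})`) such that
(a) `x ∈ I₁`, `y ∈ I₂` and `K ∩ ∂Q ⊆ I₁ ∪ I₂`;
(b) `K ∩ Q` has infinitely many pairwise distinct connected components `Qₙ`, each meeting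
both `I₁` and `I₂`;
(c) the sequence `(Qₙ)` converges in the Hausdorff metric to a continuum `Q∞` containing
both `x` and `y`. -/
def schonfliesRel {S : Type*} [MetricSpace S] (K : Set S) : Set (S × S) :=
  {p | p.1 ∈ K ∧ p.2 ∈ K ∧ (p.1 = p.2 ∨
    ∃ φ : unitInterval × unitInterval → S, Topology.IsEmbedding φ ∧
      p.1 ∈ φ '' {q | q.2 = 0} ∧ p.2 ∈ φ '' {q | q.2 = 1} ∧
      K ∩ (φ '' {q | q.1 = 0 ∨ q.1 = 1 ∨ q.2 = 0 ∨ q.2 = 1}) ⊆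
        (φ '' {q | q.2 = 0}) ∪ (φ '' {q | q.2 = 1}) ∧
      ∃ Q : ℕ → Set S,
        (∀ m n, m ≠ n → Q m ≠ Q n) ∧
        (∀ n, ∃ z ∈ K ∩ Set.range φ, Q n = connectedComponentIn (K ∩ Set.range φ) z) ∧
        (∀ n, (Q n ∩ φ '' {q | q.2 = 0}).Nonempty ∧ (Q n ∩ φ '' {q | q.2 = 1}).Nonempty) ∧
        ∃ Qinf : Set S, IsCompact Qinf ∧ IsConnected Qinf ∧
          Filter.Tendsto (fun n => Metric.hausdorffDist (Q n) Qinf) Filter.atTop (nhds 0) ∧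
          p.1 ∈ Qinf ∧ p.2 ∈ Qinf)}

/-- The collection of closed equivalence relations on `K` containing a given relation `R`. -/
def closedEquivsOn {S : Type*} [MetricSpace S] (K : Set S) (R : Set (S × S)) :
    Set (Set (S × S)) :=
  {E | R ⊆ E ∧ E ⊆ K ×ˢ K ∧ IsClosed E ∧ (∀ x ∈ K, (x, x) ∈ E) ∧
    (∀ x y, (x, y) ∈ E → (y, x) ∈ E) ∧
    (∀ x y z, (x, y) ∈ E → (y, z) ∈ E → (x, z) ∈ E)}

/-- The Schönflies equivalence `∼_K`: the smallest closed equivalence relation on `K`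
containing the Schönflies relation `R_K`. -/
def schonfliesEquiv {S : Type*} [MetricSpace S] (K : Set S) : Set (S × S) :=
  ⋂₀ closedEquivsOn K (schonfliesRel K)

/-- The Schönflies class `[x]_∼` of a point `x`. -/
def schonfliesClass {S : Type*} [MetricSpace S] (K : Set S) (x : S) : Set S :=
  {y | (x, y) ∈ schonfliesEquiv K}

/-- The decomposition `D_K = {[x]_∼ : x ∈ K}` of `K` into Schönflies classes. -/
def schonfliesDecomp {S : Type*} [MetricSpace S] (K : Set S) : Set (Set S) :=
  {C | ∃ x ∈ K, C = schonfliesClass K x}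

/-- An upper semicontinuous decomposition of `K`: a partition of `K` into nonempty closed
sets such that each element `δ` and open `U ⊇ δ` admit a relatively open `V` (a union of
elements of the decomposition) with `δ ⊆ V ⊆ U`. -/
def IsUSCDecomp {X : Type*} [TopologicalSpace X] (K : Set X) (D : Set (Set X)) : Prop :=
  (∀ δ ∈ D, δ.Nonempty ∧ IsClosed δ ∧ δ ⊆ K) ∧
  (∀ δ ∈ D, ∀ δ' ∈ D, δ ≠ δ' → Disjoint δ δ') ∧
  ⋃₀ D = K ∧
  ∀ δ ∈ D, ∀ U : Set X, IsOpen U → δ ⊆ U →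
    ∃ D' ⊆ D, (∃ W : Set X, IsOpen W ∧ ⋃₀ D' = W ∩ K) ∧ δ ⊆ ⋃₀ D' ∧ ⋃₀ D' ⊆ U

/-- An upper semicontinuous decomposition into subcontinua. -/
def IsUSCDecompCont {X : Type*} [TopologicalSpace X] (K : Set X) (D : Set (Set X)) : Prop :=
  IsUSCDecomp K D ∧ ∀ δ ∈ D, IsConnected δ

/-- The relation on `↥K` identifying two points lying in a common element of `D`. -/
def decompRel {X : Type*} (K : Set X) (D : Set (Set X)) : K → K → Prop :=
  fun x y => ∃ δ ∈ D, (x : X) ∈ δ ∧ (y : X) ∈ δ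

/-- The quotient space of the decomposition `D` of `K`, with the quotient topology. -/
abbrev DecompQuot {X : Type*} [TopologicalSpace X] (K : Set X) (D : Set (Set X)) : Type _ :=
  Quot (decompRel K D)

/-- A topological space is a *Peano compactum* if it is compact, all of its connected
components are locally connected, and there is a metric inducing its topology for which,
for every `ε > 0`, at most finitely many connected components have diameter `> ε`. -/
def IsPeanoCompactumSp (Y : Type*) [ty : TopologicalSpace Y] : Prop :=
  CompactSpace Y ∧
  (∀ y : Y, LocallyConnectedSpace (connectedComponent y)) ∧
  ∃ m : MetricSpace Y, m.toPseudoMetricSpace.toUniformSpace.toTopologicalSpace = ty ∧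
    ∀ ε : ℝ, 0 < ε →
      {C : Set Y | (∃ y : Y, C = connectedComponent y) ∧
        ε < @Metric.diam Y m.toPseudoMetricSpace C}.Finite

/-- A compact subset `K` of a metric space is a Peano compactum with the restricted
metric iff all of its connected components are locally connected and for each `ε > 0`
only finitely many components have diameter `> ε`. -/
def IsPeanoCompactumSet {X : Type*} [MetricSpace X] (K : Set X) : Prop :=
  IsCompact K ∧
  (∀ x ∈ K, LocallyConnectedSpace (connectedComponentIn K x)) ∧
  ∀ ε : ℝ, 0 < ε →
    {C : Set X | (∃ x ∈ K, C = connectedComponentIn K x) ∧ ε < Metric.diam C}.Finite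

/-- A Peano decomposition: a usc decomposition into subcontinua whose quotient space
(with the quotient topology) is a Peano compactum. -/
def IsPeanoDecomp {X : Type*} [MetricSpace X] (K : Set X) (D : Set (Set X)) : Prop :=
  IsUSCDecompCont K D ∧ IsPeanoCompactumSp (DecompQuot K D)

/-- A decomposition `D` refines `D'` if every element of `D` is contained in an
element of `D'`. -/
def Refines {X : Type*} (D D' : Set (Set X)) : Prop :=
  ∀ δ ∈ D, ∃ δ' ∈ D', δ ⊆ δ'


lemma log_homotopy {A : Type*} [TopologicalSpace A] (H : I × A → ℂ) (hc : Continuous H)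
    (hne : ∀ p, H p ≠ 0) (L0 : A → ℂ) (hL0 : Continuous L0)
    (h0 : ∀ a, Complex.exp (L0 a) = H (0, a)) :
    ∃ L : I × A → ℂ, Continuous L ∧ ∀ p, Complex.exp (L p) = H p := by
  let H' : C(I × A, {z : ℂ // z ≠ 0}) := ⟨fun p => ⟨H p, hne p⟩, hc.subtype_mk _⟩
  let f : C(A, ℂ) := ⟨L0, hL0⟩
  have hH : ∀ a, H' (0, a) = (fun z : ℂ ↦ (⟨_, z.exp_ne_zero⟩ : {z : ℂ // z ≠ 0})) (f a) := by
    intro a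
    apply Subtype.ext
    exact (h0 a).symm
  refine ⟨Complex.isCoveringMap_exp.liftHomotopy H' f hH, ContinuousMap.continuous _, ?_⟩
  intro p
  have := congrFun (Complex.isCoveringMap_exp.liftHomotopy_lifts H' f hH) p
  exact congrArg Subtype.val this

lemma log_step {A : Type*} [TopologicalSpace A] (H : I × A → ℂ) (hc : Continuous H)
    (hne : ∀ p, H p ≠ 0)
    (h0 : ∃ L0 : A → ℂ, Continuous L0 ∧ ∀ a, Complex.exp (L0 a) = H (0, a)) :
    ∃ L1 : A → ℂ, Continuous L1 ∧ ∀ a, Complex.exp (L1 a) = H (1, a) := by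
  obtain ⟨L0, hL0, h0⟩ := h0
  obtain ⟨L, hL, h⟩ := log_homotopy H hc hne L0 hL0 h0
  exact ⟨fun a => L (1, a), by fun_prop, fun a => h _⟩

lemma log_square (H : I × I → ℂ) (hc : Continuous H) (hne : ∀ p, H p ≠ 0) :
    ∃ L : I × I → ℂ, Continuous L ∧ ∀ p, Complex.exp (L p) = H p := by
  obtain ⟨L, hL, h⟩ := log_homotopy (A := Unit) (fun p => H (0, p.1)) (by fun_prop)
    (fun p => hne _) (fun _ => Complex.log (H (0, 0))) (by fun_prop)
    (fun a => Complex.exp_log (hne _))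
  exact log_homotopy H hc hne (fun t => L (t, ())) (by fun_prop) (fun a => h (a, ()))

abbrev Sph := {z : ℂ // ‖z‖ = 1}

lemma odd_no_log (g L : Sph → ℂ) (hL : Continuous L)
    (h : ∀ z, Complex.exp (L z) = g z) (hne : ∀ z, g z ≠ 0)
    (hodd : ∀ z w : Sph, (w : ℂ) = -z → g w = - g z) : False := by
  let e : ℝ → Sph := fun θ => ⟨Complex.exp (θ * Complex.I), Complex.norm_exp_ofReal_mul_I θ⟩
  have he : Continuous e := by
    apply Continuous.subtype_mk
    fun_prop
  let d : ℝ → ℂ := fun θ => L (e (θ + Real.pi)) - L (e θ)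
  have hd : Continuous d := by
    have : Continuous fun θ : ℝ => e (θ + Real.pi) := he.comp (by fun_prop)
    exact (hL.comp this).sub (hL.comp he)
  have hed : ∀ θ, Complex.exp (d θ) = -1 := by
    intro θ
    simp only [d]
    rw [Complex.exp_sub, h, h, hodd (e θ) (e (θ + Real.pi))]
    · rw [neg_div, div_self (hne _)]
    · simp only [e]
      push_cast
      rw [add_mul, Complex.exp_add, Complex.exp_pi_mul_I]; ring
  have hper : e (0 + Real.pi + Real.pi) = e 0 := by
    apply Subtype.ext
    simp only [e]
    push_cast
    rw [show ((0 : ℂ) + Real.pi + Real.pi) * Complex.I = 2 * Real.pi * Complex.I by ring,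
      Complex.exp_two_pi_mul_I]
    simp
  have hneg : d (0 + Real.pi) = - d 0 := by
    simp only [d]
    rw [hper]; ring
  have hre : ∀ θ, (d θ).re = 0 := by
    intro θ
    have := congrArg (fun z : ℂ => ‖z‖) (hed θ)
    simp [Complex.norm_exp] at this
    exact this
  have h0 : ∃ θ, (d θ).im = 0 := by
    have hcim : Continuous fun θ => (d θ).im := Complex.continuous_im.comp hd
    have hn : (d (0 + Real.pi)).im = - (d 0).im := by rw [hneg]; simp
    rcases le_total ((d 0).im) 0 with hh | hh
    · exact mem_range_of_exists_le_of_exists_ge hcim ⟨0, hh⟩ ⟨0 + Real.pi, by rw [hn]; linarith⟩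
    · exact mem_range_of_exists_le_of_exists_ge hcim ⟨0 + Real.pi, by rw [hn]; linarith⟩ ⟨0, hh⟩
  obtain ⟨θ, hθ⟩ := h0
  have : d θ = 0 := Complex.ext (hre θ) hθ
  have h1 := hed θ
  rw [this, Complex.exp_zero] at h1
  norm_num at h1

/-- Invariance of domain in dimension two. -/
lemma inv_domain (f : ℂ → ℂ) (hf : ContinuousOn f (closedBall 0 1))
    (hinj : InjOn f (closedBall 0 1)) : f '' (closedBall 0 1) ∈ 𝓝 (f 0) := by
  have m0 : (0 : ℂ) ∈ closedBall (0 : ℂ) 1 := by simp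
  have mt : ∀ p : I × Sph, ((p.1 : ℝ) : ℂ) * (p.2 : ℂ) ∈ closedBall (0 : ℂ) 1 := by
    intro p
    rw [mem_closedBall_zero_iff, norm_mul, p.2.2, mul_one, Complex.norm_real,
      Real.norm_of_nonneg p.1.2.1]
    exact p.1.2.2
  have m1 : ∀ z : Sph, (z : ℂ) ∈ closedBall (0 : ℂ) 1 := by
    intro z; rw [mem_closedBall_zero_iff, z.2]
  have hz0 : ∀ z : Sph, (z : ℂ) ≠ 0 := by
    intro z hz
    have := z.2
    rw [hz] at this; simp at this
  have hcs : IsCompact (sphere (0 : ℂ) 1) := isCompact_sphere 0 1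
  have hfs : IsCompact (f '' sphere (0 : ℂ) 1) :=
    hcs.image_of_continuousOn (hf.mono sphere_subset_closedBall)
  have hnot : f 0 ∉ f '' sphere (0 : ℂ) 1 := by
    rintro ⟨z, hz, hzf⟩
    have := hinj (sphere_subset_closedBall hz) m0 hzf
    rw [this] at hz; simp at hz
  obtain ⟨r, hr, hball⟩ := Metric.isOpen_iff.1 hfs.isClosed.isOpen_compl (f 0) hnot
  refine mem_of_superset (ball_mem_nhds _ hr) ?_
  intro w hw
  by_contra hwn
  have hcf1 : Continuous fun z : Sph => f z := hf.comp_continuous continuous_subtype_val m1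
  have S1 := log_step (A := Sph) (fun p => f (((p.1 : ℝ) : ℂ) * (p.2 : ℂ)) - w)
    (by
      refine Continuous.sub ?_ continuous_const
      exact hf.comp_continuous (by fun_prop) mt)
    (by
      intro p hp
      exact hwn ⟨_, mt p, sub_eq_zero.1 hp⟩)
    ⟨fun _ => Complex.log (f 0 - w), continuous_const, by
      intro a
      rw [Complex.exp_log]
      · simp
      · intro hp
        exact hwn ⟨_, m0, sub_eq_zero.1 hp⟩⟩
  have S2 := log_step (A := Sph) (fun p => f p.2 - (w + ((p.1 : ℝ) : ℂ) * (f 0 - w)))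
    (by
      refine Continuous.sub (hcf1.comp continuous_snd) (by fun_prop))
    (by
      intro p hp
      have hp := sub_eq_zero.1 hp
      have : (w + ((p.1 : ℝ) : ℂ) * (f 0 - w)) ∈ ball (f 0) r := by
        rw [mem_ball, dist_eq_norm] at hw ⊢
        have : w + ((p.1 : ℝ) : ℂ) * (f 0 - w) - f 0 = ((1 - (p.1 : ℝ) : ℝ) : ℂ) * (w - f 0) := by
          push_cast; ring
        rw [this, norm_mul, Complex.norm_real, Real.norm_of_nonneg (by linarith [p.1.2.2])]
        have h1 := p.1.2.1
        nlinarith [norm_nonneg (w - f 0)]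
      exact hball this ⟨p.2, by simp [p.2.2], hp⟩)
    (by
      obtain ⟨L, hL, h⟩ := S1
      exact ⟨L, hL, fun a => by rw [h]; simp⟩)
  have nn : ∀ p : I × Sph, (1 + ((p.1 : ℝ) : ℂ)) ≠ 0 := by
    intro p hp
    have := congrArg Complex.re hp
    simp at this
    linarith [p.1.2.1]
  have mm1 : ∀ p : I × Sph, (p.2 : ℂ) / (1 + ((p.1 : ℝ) : ℂ)) ∈ closedBall (0 : ℂ) 1 := by
    intro p
    rw [mem_closedBall_zero_iff, norm_div, p.2.2]
    rw [show (1 + ((p.1 : ℝ) : ℂ)) = ((1 + (p.1 : ℝ) : ℝ) : ℂ) by push_cast; rfl,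
      Complex.norm_real, Real.norm_of_nonneg (by linarith [p.1.2.1])]
    rw [div_le_one (by linarith [p.1.2.1])]
    linarith [p.1.2.1]
  have mm2 : ∀ p : I × Sph, -(((p.1 : ℝ) : ℂ) * (p.2 : ℂ)) / (1 + ((p.1 : ℝ) : ℂ)) ∈
      closedBall (0 : ℂ) 1 := by
    intro p
    rw [mem_closedBall_zero_iff, norm_div, norm_neg, norm_mul, p.2.2, mul_one]
    rw [show (1 + ((p.1 : ℝ) : ℂ)) = ((1 + (p.1 : ℝ) : ℝ) : ℂ) by push_cast; rfl,
      Complex.norm_real, Complex.norm_real, Real.norm_of_nonneg (by linarith [p.1.2.1]),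
      Real.norm_of_nonneg (by linarith [p.1.2.1])]
    rw [div_le_one (by linarith [p.1.2.1])]
    linarith [p.1.2.1]
  have S3 := log_step (A := Sph) (fun p => f ((p.2 : ℂ) / (1 + ((p.1 : ℝ) : ℂ)))
      - f (-(((p.1 : ℝ) : ℂ) * (p.2 : ℂ)) / (1 + ((p.1 : ℝ) : ℂ))))
    (by
      refine Continuous.sub (hf.comp_continuous ?_ mm1) (hf.comp_continuous ?_ mm2)
      · exact Continuous.div (by fun_prop) (by fun_prop) nn
      · exact Continuous.div (by fun_prop) (by fun_prop) nn)
    (by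
      intro p hp
      have h2 := hinj (mm1 p) (mm2 p) (sub_eq_zero.1 hp)
      have h3 := nn p
      rw [div_left_inj' h3] at h2
      have : (p.2 : ℂ) * (1 + ((p.1 : ℝ) : ℂ)) = 0 := by linear_combination h2
      rcases mul_eq_zero.1 this with h | h
      · exact hz0 _ h
      · exact h3 h)
    (by
      obtain ⟨L, hL, h⟩ := S2
      exact ⟨L, hL, fun a => by rw [h]; simp⟩)
  obtain ⟨L, hL, h⟩ := S3
  refine odd_no_log _ L hL h (fun z => by rw [← h]; exact Complex.exp_ne_zero _) ?_
  intro z w hzw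
  simp [hzw]

lemma half_plane_log (M γ : I → ℂ) (hM : Continuous M) (hγ : Continuous γ)
    (h : ∀ s, Complex.exp (M s) = γ s) (c : ℂ) (hc : c ≠ 0)
    (hs : ∀ s, c * γ s ∈ Complex.slitPlane) (a b : I) :
    M b - M a = Complex.log (c * γ b) - Complex.log (c * γ a) := by
  have hcont : Continuous fun s => M s - Complex.log (c * γ s) :=
    hM.sub ((continuous_const.mul hγ).clog hs)
  have hcov := Complex.isCoveringMap_exp
  have := hcov.const_of_comp hcont (by
    intro s t
    apply Subtype.ext
    have hne : ∀ s, γ s ≠ 0 := fun s => by rw [← h]; exact Complex.exp_ne_zero _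
    simp only [Complex.exp_sub, h, Complex.exp_log (mul_ne_zero hc (hne _))]
    have := hne s
    have := hne t
    field_simp) a b
  linear_combination -this

lemma slit_aux (z : ℂ) (hz : z ≠ 0) (h : 0 ≤ z.re) : z ∈ Complex.slitPlane := by
  rw [Complex.mem_slitPlane_iff]
  by_contra hcon
  push Not at hcon
  exact hz (Complex.ext (le_antisymm hcon.1 h) hcon.2)

lemma arg_pos_I (x : ℝ) (hx : 0 < x) : (Complex.log (x * Complex.I)).im = Real.pi / 2 := by
  rw [Complex.log_im, Complex.arg_real_mul _ hx, Complex.arg_I]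

lemma arg_neg_I (x : ℝ) (hx : 0 < x) : (Complex.log (x * -Complex.I)).im = -(Real.pi / 2) := by
  rw [Complex.log_im, Complex.arg_real_mul _ hx, Complex.arg_neg_I]

lemma crossing_paths (α β : I → I × I) (hα : Continuous α) (hβ : Continuous β)
    (hne : ∀ s t, α s ≠ β t) (hp : (α 0).2 = 0) (hr : (α 1).2 = 0) (hq : (β 0).2 = 0)
    (hs : (β 1).2 = 1) (hpq : (α 0).1 < (β 0).1) (hqr : (β 0).1 < (α 1).1) : False := by
  let J : I × I → ℂ := fun x => ⟨(x.1 : ℝ), (x.2 : ℝ)⟩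
  have hJ : Continuous J := by
    have : J = fun x => ((x.1 : ℝ) : ℂ) + ((x.2 : ℝ) : ℂ) * Complex.I := by
      ext x
      apply Complex.ext <;> simp [J]
    rw [this]; fun_prop
  have hJi : Function.Injective J := by
    intro x y hxy
    have h1 := congrArg Complex.re hxy
    have h2 := congrArg Complex.im hxy
    exact Prod.ext (Subtype.ext h1) (Subtype.ext h2)
  have hne' : ∀ s t, J (α s) - J (β t) ≠ 0 := fun s t h => hne s t (hJi (sub_eq_zero.1 h))
  obtain ⟨L, hL, h⟩ := log_square (fun p => J (α p.1) - J (β p.2)) (by fun_prop)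
    (fun p => hne' _ _)
  have e1 := half_plane_log (fun s => L (s, 0)) (fun s => J (α s) - J (β 0)) (by fun_prop)
    (by fun_prop) (fun s => h _) (-Complex.I) (by simp)
    (fun s => slit_aux _ (mul_ne_zero (by simp) (hne' _ _)) (by
      simp [J, hq]; exact (α s).2.2.1)) 0 1
  have e2 := half_plane_log (fun t => L (1, t)) (fun t => J (α 1) - J (β t)) (by fun_prop)
    (by fun_prop) (fun s => h _) (Complex.I) (by simp)
    (fun s => slit_aux _ (mul_ne_zero (by simp) (hne' _ _)) (by
      simp [J, hr]; exact (β s).2.2.1)) 0 1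
  have e3 := half_plane_log (fun s => L (s, 1)) (fun s => J (α s) - J (β 1)) (by fun_prop)
    (by fun_prop) (fun s => h _) (Complex.I) (by simp)
    (fun s => slit_aux _ (mul_ne_zero (by simp) (hne' _ _)) (by
      simp [J, hs]; exact (α s).2.2.2)) 0 1
  have e4 := half_plane_log (fun t => L (0, t)) (fun t => J (α 0) - J (β t)) (by fun_prop)
    (by fun_prop) (fun s => h _) (Complex.I) (by simp)
    (fun s => slit_aux _ (mul_ne_zero (by simp) (hne' _ _)) (by
      simp [J, hp]; exact (β s).2.2.1)) 0 1
  have hpq' : 0 < ((β 0).1 : ℝ) - (α 0).1 := sub_pos.2 hpq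
  have hqr' : 0 < ((α 1).1 : ℝ) - (β 0).1 := sub_pos.2 hqr
  have c1 : -Complex.I * (J (α 1) - J (β 0)) = ((((α 1).1 : ℝ) - (β 0).1 : ℝ) : ℂ) * -Complex.I := by
    apply Complex.ext <;> simp [J, hr, hq]
  have c2 : -Complex.I * (J (α 0) - J (β 0)) = ((((β 0).1 : ℝ) - (α 0).1 : ℝ) : ℂ) * Complex.I := by
    apply Complex.ext <;> simp [J, hp, hq]
  have c3 : Complex.I * (J (α 1) - J (β 0)) = ((((α 1).1 : ℝ) - (β 0).1 : ℝ) : ℂ) * Complex.I := by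
    apply Complex.ext <;> simp [J, hr, hq]
  have c4 : Complex.I * (J (α 0) - J (β 0)) = ((((β 0).1 : ℝ) - (α 0).1 : ℝ) : ℂ) * -Complex.I := by
    apply Complex.ext <;> simp [J, hp, hq]
  simp only [c1, c2, c3, c4] at e1 e2 e3 e4
  have f1 := congrArg Complex.im e1
  have f2 := congrArg Complex.im e2
  have f3 := congrArg Complex.im e3
  have f4 := congrArg Complex.im e4
  simp only [Complex.sub_im, arg_pos_I _ hpq', arg_pos_I _ hqr', arg_neg_I _ hpq',
    arg_neg_I _ hqr'] at f1 f2 f3 f4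
  linarith [Real.pi_pos]

instance locPathI : LocallyPathConnectedSpace I :=
  (isQuotientMap_projIcc (h := zero_le_one' ℝ)).locallyPathConnectedSpace

lemma joinedIn_of_preconnected {X : Type*} [TopologicalSpace X] [LocallyPathConnectedSpace X]
    {A U : Set X} (hA : IsPreconnected A) (hU : IsOpen U) (hAU : A ⊆ U) {x y : X} (hx : x ∈ A)
    (hy : y ∈ A) : JoinedIn U x y := by
  have hsub : A ⊆ connectedComponentIn U x := hA.subset_connectedComponentIn hx hAU
  have hop : IsOpen (connectedComponentIn U x) := hU.connectedComponentIn
  have hc : IsConnected (connectedComponentIn U x) :=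
    isConnected_connectedComponentIn_iff.2 (hAU hx)
  have hp := (hop.isConnected_iff_isPathConnected).1 hc
  exact (hp.joinedIn x (hsub hx) y (hsub hy)).mono (connectedComponentIn_subset _ _)

lemma crossing_sets {A B : Set (I × I)} (hAc : IsCompact A) (hBc : IsCompact B)
    (hA : IsPreconnected A) (hB : IsPreconnected B) (hd : Disjoint A B) {p q r s : I}
    (hp : (p, 0) ∈ A) (hr : (r, 0) ∈ A) (hq : (q, 0) ∈ B) (hs : (s, 1) ∈ B) (hpq : p < q)
    (hqr : q < r) : False := by
  obtain ⟨U, V, hU, hV, hAU, hBV, hUV⟩ := SeparatedNhds.of_isCompact_isCompact hAc hBc hd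
  obtain ⟨α, hα⟩ := joinedIn_of_preconnected hA hU hAU hp hr
  obtain ⟨β, hβ⟩ := joinedIn_of_preconnected hB hV hBV hq hs
  refine crossing_paths α β α.continuous β.continuous ?_ (by simp) (by simp) (by simp) (by simp)
    (by simpa using hpq) (by simpa using hqr)
  intro s t h
  exact Set.disjoint_left.1 hUV (hα s) (h ▸ hβ t)

lemma trace_lemma (A : ℕ → Set (I × I)) (hc : ∀ n, IsCompact (A n))
    (hp : ∀ n, IsPreconnected (A n)) (hd : ∀ m n, m ≠ n → Disjoint (A m) (A n))
    (hbot : ∀ n, ∃ t, (t, (0 : I)) ∈ A n) (htop : ∀ n, ∃ t, (t, (1 : I)) ∈ A n) :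
    ∃ a : I, ∃ ψ : ℕ → ℕ, StrictMono ψ ∧
      ∀ N ∈ 𝓝 a, ∀ᶠ n in atTop, ∀ t, (t, (0 : I)) ∈ A (ψ n) → t ∈ N := by
  have hcc : ∀ n, IsCompact {t : I | (t, (0 : I)) ∈ A n} := by
    intro n
    have : IsClosed {t : I | (t, (0 : I)) ∈ A n} :=
      (hc n).isClosed.preimage (by fun_prop : Continuous fun t : I => (t, (0 : I)))
    exact this.isCompact
  choose l hl hlm using fun n => (hcc n).exists_isLeast (hbot n)
  choose r hr hrm using fun n => (hcc n).exists_isGreatest (hbot n)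
  obtain ⟨⟨a, b⟩, ψ, hψ, hlim⟩ := CompactSpace.tendsto_subseq (fun n => (l n, r n))
  have hla : Tendsto (fun n => l (ψ n)) atTop (𝓝 a) := (continuous_fst.tendsto _).comp hlim
  have hrb : Tendsto (fun n => r (ψ n)) atTop (𝓝 b) := (continuous_snd.tendsto _).comp hlim
  have hab : a ≤ b := le_of_tendsto_of_tendsto' hla hrb (fun n => hlm _ (hr _))
  have hba : a = b := by
    by_contra hne
    have hlt : a < b := lt_of_le_of_ne hab hne
    obtain ⟨m, ham, hmb⟩ := exists_between hlt
    have h1 := hla.eventually (gt_mem_nhds ham)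
    have h2 := hrb.eventually (lt_mem_nhds hmb)
    obtain ⟨N, hN⟩ := eventually_atTop.1 (h1.and h2)
    have ha := hN N le_rfl
    have hb := hN (N + 1) (Nat.le_succ _)
    have hne : ψ N ≠ ψ (N + 1) := fun h => by have := hψ.injective h; omega
    obtain ⟨s, hs⟩ := htop (ψ N)
    obtain ⟨s', hs'⟩ := htop (ψ (N + 1))
    rcases lt_trichotomy (l (ψ N)) (l (ψ (N + 1))) with h | h | h
    · exact crossing_sets (hc _) (hc _) (hp _) (hp _) (hd _ _ hne) (hl (ψ N)) (hr (ψ N))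
        (hl (ψ (N + 1))) hs' h (hb.1.trans ha.2)
    · have := hl (ψ N)
      rw [h] at this
      exact Set.disjoint_left.1 (hd _ _ hne) this (hl _)
    · exact crossing_sets (hc _) (hc _) (hp _) (hp _) (hd _ _ hne.symm) (hl (ψ (N + 1)))
        (hr (ψ (N + 1))) (hl (ψ N)) hs h (ha.1.trans hb.2)
  subst hba
  refine ⟨a, ψ, hψ, fun N hN => ?_⟩
  obtain ⟨ε, hε, hsub⟩ := Metric.mem_nhds_iff.1 hN
  filter_upwards [hla.eventually (ball_mem_nhds a hε), hrb.eventually (ball_mem_nhds a hε)]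
    with n h1 h2 t ht
  apply hsub
  have h3 : ((l (ψ n) : I) : ℝ) ≤ t := hlm _ ht
  have h4 : (t : ℝ) ≤ r (ψ n) := hrm _ ht
  rw [mem_ball, Subtype.dist_eq, Real.dist_eq, abs_lt] at *
  constructor <;> linarith [h1.1, h1.2, h2.1, h2.2]

lemma trace_lemma_top (A : ℕ → Set (I × I)) (hc : ∀ n, IsCompact (A n))
    (hp : ∀ n, IsPreconnected (A n)) (hd : ∀ m n, m ≠ n → Disjoint (A m) (A n))
    (hbot : ∀ n, ∃ t, (t, (0 : I)) ∈ A n) (htop : ∀ n, ∃ t, (t, (1 : I)) ∈ A n) :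
    ∃ a : I, ∃ ψ : ℕ → ℕ, StrictMono ψ ∧
      ∀ N ∈ 𝓝 a, ∀ᶠ n in atTop, ∀ t, (t, (1 : I)) ∈ A (ψ n) → t ∈ N := by
  let F : I × I → I × I := fun x => (x.1, σ x.2)
  have hF : Continuous F := by fun_prop
  have hFF : ∀ x, F (F x) = x := fun x => by simp [F]
  obtain ⟨a, ψ, h1, h2⟩ := trace_lemma (fun n => F '' A n) (fun n => (hc n).image hF)
    (fun n => (hp n).image F hF.continuousOn)
    (fun m n hmn => (Set.disjoint_image_iff (Function.LeftInverse.injective hFF)).2 (hd m n hmn))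
    (fun n => by
      obtain ⟨t, ht⟩ := htop n
      exact ⟨t, _, ht, by simp [F]⟩)
    (fun n => by
      obtain ⟨t, ht⟩ := hbot n
      exact ⟨t, _, ht, by simp [F]⟩)
  refine ⟨a, ψ, h1, fun N hN => ?_⟩
  filter_upwards [h2 N hN] with n hn t ht
  exact hn t ⟨_, ht, by simp [F]⟩

/-- The image of the open square under an embedding into a surface is open. -/
lemma isOpen_image_square {S : Type*} [TopologicalSpace S] (hS : IsSurfaceLocallyEuclidean S)
    (φ : I × I → S) (hφ : Topology.IsEmbedding φ) :
    IsOpen (φ '' {q | q.1 ≠ 0 ∧ q.1 ≠ 1 ∧ q.2 ≠ 0 ∧ q.2 ≠ 1}) := by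
  rw [isOpen_iff_mem_nhds]
  rintro _ ⟨q, ⟨h1, h2, h3, h4⟩, rfl⟩
  obtain ⟨U, hU, hqU, ⟨h⟩⟩ := hS (φ q)
  let P : ℂ → I × I := fun z => (projIcc 0 1 zero_le_one (q.1 + z.re), projIcc 0 1 zero_le_one (q.2 + z.im))
  have hP : Continuous P := by
    have : Continuous (projIcc (0 : ℝ) 1 zero_le_one) := continuous_projIcc
    fun_prop
  have hP0 : P 0 = q := by simp [P]
  have hn1 : (fun z => φ (P z)) ⁻¹' U ∈ 𝓝 (0 : ℂ) :=
    (hU.preimage (hφ.continuous.comp hP)).mem_nhds (by simpa [hP0] using hqU)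
  have q1p : (0 : ℝ) < q.1 := lt_of_le_of_ne q.1.2.1 (fun h => h1 (Subtype.ext h.symm))
  have q1l : (q.1 : ℝ) < 1 := lt_of_le_of_ne q.1.2.2 (fun h => h2 (Subtype.ext h))
  have q2p : (0 : ℝ) < q.2 := lt_of_le_of_ne q.2.2.1 (fun h => h3 (Subtype.ext h.symm))
  have q2l : (q.2 : ℝ) < 1 := lt_of_le_of_ne q.2.2.2 (fun h => h4 (Subtype.ext h))
  let O : Set ℂ := {z | 0 < q.1 + z.re ∧ q.1 + z.re < 1 ∧ 0 < q.2 + z.im ∧ q.2 + z.im < 1}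
  have hO : IsOpen O := by
    have a := Complex.continuous_re
    have b := Complex.continuous_im
    simp only [O, setOf_and]
    refine IsOpen.inter ?_ (IsOpen.inter ?_ (IsOpen.inter ?_ ?_)) <;>
      apply isOpen_lt <;> fun_prop
  have hn2 : O ∈ 𝓝 (0 : ℂ) := hO.mem_nhds (by simp [O, *])
  obtain ⟨ρ, hρ, hball⟩ := Metric.nhds_basis_closedBall.mem_iff.1 (inter_mem hn1 hn2)
  have hPv : ∀ z ∈ O, ((P z).1 : ℝ) = q.1 + z.re ∧ ((P z).2 : ℝ) = q.2 + z.im := by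
    intro z hz
    constructor
    · simp only [P]
      rw [projIcc_of_mem zero_le_one ⟨hz.1.le, hz.2.1.le⟩]
    · simp only [P]
      rw [projIcc_of_mem zero_le_one ⟨hz.2.2.1.le, hz.2.2.2.le⟩]
  have hsc : ∀ z ∈ closedBall (0 : ℂ) 1, (ρ : ℂ) * z ∈ closedBall (0 : ℂ) ρ := by
    intro z hz
    rw [mem_closedBall_zero_iff] at hz ⊢
    rw [norm_mul, Complex.norm_real, Real.norm_of_nonneg hρ.le]
    nlinarith
  let g : closedBall (0 : ℂ) 1 → U := fun z => ⟨φ (P (ρ * z)), (hball (hsc z z.2)).1⟩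
  have hg : Continuous g := by
    apply Continuous.subtype_mk
    exact hφ.continuous.comp (hP.comp (by fun_prop))
  have hgi : Function.Injective g := by
    intro z w hzw
    have e1 := hφ.injective (congrArg Subtype.val hzw)
    have o1 := hPv _ (hball (hsc z z.2)).2
    have o2 := hPv _ (hball (hsc w w.2)).2
    rw [e1] at o1
    have e2 : (ρ : ℂ) * z = ρ * w := by
      apply Complex.ext
      · linarith [o1.1, o2.1]
      · linarith [o1.2, o2.2]
    exact Subtype.ext (mul_left_cancel₀ (by exact_mod_cast hρ.ne') e2)
  let T : (ℝ × ℝ) ≃ₜ ℂ := Complex.equivRealProdCLM.symm.toHomeomorph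
  let f' : closedBall (0 : ℂ) 1 → ℂ := fun z => T (h (g z))
  have hf' : Continuous f' := T.continuous.comp (h.continuous.comp hg)
  have hfi : Function.Injective f' := T.injective.comp (h.injective.comp hgi)
  classical
  let f : ℂ → ℂ := fun z => if hz : z ∈ closedBall (0 : ℂ) 1 then f' ⟨z, hz⟩ else 0
  have hff : ∀ z : closedBall (0 : ℂ) 1, f z = f' z := by
    intro z
    simp only [f]
    rw [dif_pos z.2]
  have m0 : (0 : ℂ) ∈ closedBall (0 : ℂ) 1 := by simp
  have key := inv_domain f (by
      rw [continuousOn_iff_continuous_domRestrict]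
      exact hf'.congr (fun z => (hff z).symm)) (by
      intro z hz w hw hzw
      have := hfi ((hff ⟨z, hz⟩).symm.trans (hzw.trans (hff ⟨w, hw⟩)))
      exact congrArg Subtype.val this)
  have hg0 : g ⟨0, m0⟩ = ⟨φ q, hqU⟩ := by
    apply Subtype.ext
    simp [g, hP0]
  have hf0 : f 0 = T (h ⟨φ q, hqU⟩) := by
    rw [hff ⟨0, m0⟩]; simp only [f', hg0]
  rw [hf0] at key
  have hcont : Continuous fun u : U => T (h u) := T.continuous.comp h.continuous
  have hN := hcont.continuousAt.preimage_mem_nhds key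
  have := (hU.isOpenEmbedding_subtypeVal.image_mem_nhds).2 hN
  refine mem_of_superset this ?_
  rintro _ ⟨u, ⟨z, hz, hzu⟩, rfl⟩
  rw [hff ⟨z, hz⟩] at hzu
  have hu := h.injective (T.injective hzu)
  rw [← hu]
  refine ⟨P (ρ * z), ?_, rfl⟩
  have hb := (hball (hsc z hz)).2
  obtain ⟨v1, v2⟩ := hPv _ hb
  obtain ⟨b1, b2, b3, b4⟩ := hb
  refine ⟨fun e => ?_, fun e => ?_, fun e => ?_, fun e => ?_⟩
  · rw [e] at v1; simp at v1 b1; linarith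
  · rw [e] at v1; simp at v1 b2; linarith
  · rw [e] at v2; simp at v2 b3; linarith
  · rw [e] at v2; simp at v2 b4; linarith

lemma preconnected_preimage {S Y : Type*} [TopologicalSpace S] [TopologicalSpace Y] [T2Space S]
    [T2Space Y] {K : Set S} (hK : IsCompact K) (π : S → Y) (hπ : ContinuousOn π K)
    (hsurj : π '' K = univ) (hfib : ∀ y, IsPreconnected (K ∩ π ⁻¹' {y}))
    {Z : Set Y} (hZ : IsPreconnected Z) : IsPreconnected (K ∩ π ⁻¹' Z) := by
  rw [isPreconnected_closed_iff]
  rintro T1 T2 h1 h2 hcov ⟨u, hu, hu1⟩ ⟨v, hv, hv2⟩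
  have c1 : IsClosed (π '' (K ∩ T1)) :=
    ((hK.inter_right h1).image_of_continuousOn (hπ.mono inter_subset_left)).isClosed
  have c2 : IsClosed (π '' (K ∩ T2)) :=
    ((hK.inter_right h2).image_of_continuousOn (hπ.mono inter_subset_left)).isClosed
  obtain ⟨y, hyZ, ⟨p, hp, hpy⟩, ⟨q, hq, hqy⟩⟩ := isPreconnected_closed_iff.1 hZ _ _ c1 c2 (by
      intro y hy
      obtain ⟨k, hk, rfl⟩ : y ∈ π '' K := by rw [hsurj]; trivial
      rcases hcov ⟨hk, hy⟩ with h | h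
      · exact Or.inl ⟨k, ⟨hk, h⟩, rfl⟩
      · exact Or.inr ⟨k, ⟨hk, h⟩, rfl⟩)
    ⟨π u, hu.2, u, ⟨hu.1, hu1⟩, rfl⟩ ⟨π v, hv.2, v, ⟨hv.1, hv2⟩, rfl⟩
  obtain ⟨w, ⟨hwK, hwy⟩, hw⟩ := isPreconnected_closed_iff.1 (hfib y) T1 T2 h1 h2 (by
      rintro k ⟨hk, hky⟩
      refine hcov ⟨hk, ?_⟩
      rw [mem_preimage, mem_singleton_iff] at hky
      rw [mem_preimage, hky]; exact hyZ)
    ⟨p, ⟨hp.1, hpy⟩, hp.2⟩ ⟨q, ⟨hq.1, hqy⟩, hq.2⟩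
  refine ⟨w, ⟨hwK, ?_⟩, hw⟩
  rw [mem_preimage, mem_singleton_iff] at hwy
  rw [mem_preimage, hwy]; exact hyZ

lemma separate_component {S : Type*} [TopologicalSpace S] [T2Space S] {F : Set S}
    (hF : IsCompact F) {z : S} (hz : z ∈ F) {N : Set S} (hN : IsOpen N)
    (hsub : connectedComponentIn F z ⊆ N) :
    ∃ T O : Set S, IsClosed T ∧ IsOpen O ∧ T = F ∩ O ∧ z ∈ T ∧
      connectedComponentIn F z ⊆ T ∧ T ⊆ N := by
  haveI : CompactSpace F := isCompact_iff_compactSpace.1 hF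
  have hcomp : connectedComponentIn F z = Subtype.val '' connectedComponent (⟨z, hz⟩ : F) :=
    connectedComponentIn_eq_image hz
  have hN' : IsOpen ((Subtype.val : F → S) ⁻¹' N) := hN.preimage continuous_subtype_val
  haveI : Nonempty { s : Set F // IsClopen s ∧ (⟨z, hz⟩ : F) ∈ s } :=
    ⟨⟨univ, isClopen_univ, trivial⟩⟩
  have hex := exists_subset_nhds_of_isCompact
    (V := fun s : { s : Set F // IsClopen s ∧ (⟨z, hz⟩ : F) ∈ s } => (s : Set F))
    (U := (Subtype.val : F → S) ⁻¹' N)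
    (by
      rintro ⟨s, hs⟩ ⟨t, ht⟩
      exact ⟨⟨s ∩ t, hs.1.inter ht.1, hs.2, ht.2⟩, inter_subset_left, inter_subset_right⟩)
    (fun s => s.2.1.1.isCompact)
    (by
      intro x hx
      rw [← connectedComponent_eq_iInter_isClopen] at hx
      refine hN'.mem_nhds ?_
      apply hsub
      rw [hcomp]
      exact ⟨x, hx, rfl⟩)
  obtain ⟨⟨s, hs, hzs⟩, hsN⟩ := hex
  obtain ⟨O, hO, hOs⟩ := isOpen_induced_iff.1 hs.2
  refine ⟨Subtype.val '' s, O, (hs.1.isCompact.image continuous_subtype_val).isClosed, hO, ?_,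
    ⟨_, hzs, rfl⟩, ?_, ?_⟩
  · rw [← hOs, Subtype.image_preimage_coe]
  · rw [hcomp]
    exact image_mono (hs.connectedComponent_subset hzs)
  · rintro _ ⟨u, hu, rfl⟩
    exact hsN hu

lemma hausdorff_approx {S : Type*} [MetricSpace S] [CompactSpace S] (Q : ℕ → Set S) (L : Set S)
    (hQ : ∀ n, IsCompact (Q n)) (hne : ∀ n, (Q n).Nonempty) (hL : L.Nonempty)
    (h : Tendsto (fun n => hausdorffDist (Q n) L) atTop (𝓝 0)) {z : S} (hz : z ∈ L) :
    ∃ u : ℕ → S, (∀ n, u n ∈ Q n) ∧ Tendsto u atTop (𝓝 z) := by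
  choose u hu hud using fun n => (hQ n).exists_infDist_eq_dist (hne n) z
  refine ⟨u, hu, ?_⟩
  rw [tendsto_iff_dist_tendsto_zero]
  refine squeeze_zero (fun _ => dist_nonneg) (fun n => ?_) h
  rw [dist_comm, ← hud n, hausdorffDist_comm]
  exact infDist_le_hausdorffDist_of_mem hz
    (hausdorffEDist_ne_top_of_nonempty_of_bounded hL (hne n) (Bornology.IsBounded.all _) (Bornology.IsBounded.all _))

lemma core_z {S : Type*} [MetricSpace S] [CompactSpace S]
    (hS : IsSurfaceLocallyEuclidean S) (K : Set S) (hK : IsCompact K)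
    {Y : Type*} [MetricSpace Y]
    (hloc : ∀ y : Y, LocallyConnectedSpace (connectedComponent y))
    (π : S → Y) (hπ : ContinuousOn π K)
    (hsurj : π '' K = univ) (hfib : ∀ y, IsPreconnected (K ∩ π ⁻¹' {y}))
    (φ : I × I → S) (hφ : Topology.IsEmbedding φ)
    (hbd : K ∩ (φ '' {q | q.1 = 0 ∨ q.1 = 1 ∨ q.2 = 0 ∨ q.2 = 1}) ⊆
        (φ '' {q | q.2 = 0}) ∪ (φ '' {q | q.2 = 1}))
    (Q : ℕ → Set S) (hdis : ∀ m n, m ≠ n → Disjoint (Q m) (Q n))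
    (hQ : ∀ n, ∃ z ∈ K ∩ Set.range φ, Q n = connectedComponentIn (K ∩ Set.range φ) z)
    (a b : I)
    (ha : ∀ N ∈ 𝓝 a, ∀ᶠ n in atTop, ∀ t, φ (t, (0 : I)) ∈ Q n → t ∈ N)
    (hb : ∀ N ∈ 𝓝 b, ∀ᶠ n in atTop, ∀ t, φ (t, (1 : I)) ∈ Q n → t ∈ N)
    (y0 : Y) (hy0 : ∀ n, ∀ u ∈ Q n, π u ∈ connectedComponent y0)
    (u : ℕ → S) (hu : ∀ n, u n ∈ Q n) (z : S) (hz : Tendsto u atTop (𝓝 z)) :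
    π z = π (φ (a, 0)) ∨ π z = π (φ (b, 1)) := by
  by_contra hcon
  push Not at hcon
  have hQK : ∀ n, Q n ⊆ K ∩ range φ := by
    intro n
    obtain ⟨w, hw, h⟩ := hQ n
    rw [h]; exact connectedComponentIn_subset _ _
  have hKr : IsCompact (K ∩ range φ) :=
    hK.inter_right (isCompact_range hφ.continuous).isClosed
  have hzK : z ∈ K := hK.isClosed.mem_of_tendsto hz (Eventually.of_forall fun n => (hQK n (hu n)).1)
  have hπz : Tendsto (fun n => π (u n)) atTop (𝓝 (π z)) :=
    (hπ z hzK).tendsto.comp (tendsto_nhdsWithin_iff.2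
      ⟨hz, Eventually.of_forall fun n => (hQK n (hu n)).1⟩)
  have hCz : π z ∈ connectedComponent y0 :=
    isClosed_connectedComponent.mem_of_tendsto hπz
      (Eventually.of_forall fun n => hy0 n _ (hu n))
  have hO : ({π (φ (a, 0)), π (φ (b, 1))}ᶜ : Set Y) ∈ 𝓝 (π z) := by
    apply IsOpen.mem_nhds
    · exact (Set.toFinite _).isClosed.isOpen_compl
    · simp [hcon.1, hcon.2]
  obtain ⟨N, hN, hNc, hNO⟩ := exists_mem_nhds_isClosed_subset hO
  haveI := hloc y0
  let zc : connectedComponent y0 := ⟨π z, hCz⟩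
  have hNn : (Subtype.val : connectedComponent y0 → Y) ⁻¹' N ∈ 𝓝 zc :=
    continuous_subtype_val.continuousAt.preimage_mem_nhds hN
  obtain ⟨V, ⟨hVo, hzV, hVc⟩, hVN⟩ :=
    (LocallyConnectedSpace.open_connected_basis zc).mem_iff.1 hNn
  let Z : Set Y := closure (Subtype.val '' V)
  have hZN : Z ⊆ N := closure_minimal (by rintro _ ⟨v, hv, rfl⟩; exact hVN hv) hNc
  have hZp : IsPreconnected Z :=
    (hVc.isPreconnected.image _ continuous_subtype_val.continuousOn).closure
  let W : Set S := K ∩ π ⁻¹' Z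
  have hWc : IsClosed W := hπ.preimage_isClosed_of_isClosed hK.isClosed isClosed_closure
  have hWp : IsPreconnected W := preconnected_preimage hK π hπ hsurj hfib hZp
  have haW : φ (a, 0) ∉ W := fun h => hNO (hZN h.2) (by simp)
  have hbW : φ (b, 1) ∉ W := fun h => hNO (hZN h.2) (by simp)
  have e1 : ∀ᶠ n in atTop, u n ∈ W := by
    have : Tendsto (fun n => (⟨π (u n), hy0 n _ (hu n)⟩ : connectedComponent y0)) atTop (𝓝 zc) :=
      tendsto_subtype_rng.2 hπz
    filter_upwards [this.eventually (hVo.mem_nhds hzV)] with n hn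
    exact ⟨(hQK n (hu n)).1, subset_closure ⟨_, hn, rfl⟩⟩
  have hφc := hφ.continuous
  have e2 := ha {t | φ (t, 0) ∉ W}
    ((hWc.isOpen_compl.preimage (by fun_prop : Continuous fun t : I => φ (t, 0))).mem_nhds haW)
  have e3 := hb {t | φ (t, 1) ∉ W}
    ((hWc.isOpen_compl.preimage (by fun_prop : Continuous fun t : I => φ (t, 1))).mem_nhds hbW)
  obtain ⟨M, hM⟩ := eventually_atTop.1 (e1.and (e2.and e3))
  obtain ⟨hnW, hn0, hn1⟩ := hM M le_rfl
  obtain ⟨hmW, -, -⟩ := hM (M + 1) (Nat.le_succ _)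
  let G : Set S := φ '' {q | q.1 ≠ 0 ∧ q.1 ≠ 1 ∧ q.2 ≠ 0 ∧ q.2 ≠ 1}
  have hG : IsOpen G := isOpen_image_square hS φ hφ
  have hWQ : ∀ w ∈ W, w ∈ Q M → w ∈ G := by
    intro w hw hwQ
    obtain ⟨q, rfl⟩ := (hQK M hwQ).2
    by_contra hnG
    have hqb : q.1 = 0 ∨ q.1 = 1 ∨ q.2 = 0 ∨ q.2 = 1 := by
      by_contra hq
      push Not at hq
      exact hnG ⟨q, hq, rfl⟩
    rcases hbd ⟨hw.1, q, hqb, rfl⟩ with ⟨q', hq', he⟩ | ⟨q', hq', he⟩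
    · have hq'' : q' = (q'.1, 0) := Prod.ext rfl hq'
      rw [← he, hq''] at hw hwQ
      exact hn0 _ hwQ hw
    · have hq'' : q' = (q'.1, 1) := Prod.ext rfl hq'
      rw [← he, hq''] at hw hwQ
      exact hn1 _ hwQ hw
  have hmQ : u (M + 1) ∉ Q M := fun h =>
    Set.disjoint_left.1 (hdis M (M + 1) (by omega)) h (hu _)
  obtain ⟨w, hw, hQw⟩ := hQ M
  have hNo : IsOpen ((W ∩ Gᶜ)ᶜ ∩ {u (M + 1)}ᶜ) :=
    (hWc.inter hG.isClosed_compl).isOpen_compl.inter isClosed_singleton.isOpen_compl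
  obtain ⟨T, O, hT, hOo, hTO, -, hQT, hTN⟩ := separate_component hKr hw hNo (by
    rw [← hQw]
    intro v hv
    refine ⟨fun h => h.2 (hWQ v h.1 hv), ?_⟩
    rintro rfl
    exact hmQ hv)
  rw [← hQw] at hQT
  have huT : u M ∈ T := hQT (hu M)
  have huF : u M ∈ K ∩ range φ ∩ O := hTO ▸ huT
  obtain ⟨v, hvW, ⟨hvO, hvG⟩, hvT⟩ := hWp (O ∩ G) Tᶜ (hOo.inter hG) hT.isOpen_compl (by
      intro v hv
      by_cases hvT : v ∈ T
      · left
        have : v ∈ K ∩ range φ ∩ O := hTO ▸ hvT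
        refine ⟨this.2, ?_⟩
        by_contra hvG
        exact (hTN hvT).1 ⟨hv, hvG⟩
      · exact Or.inr hvT)
    ⟨u M, hnW, huF.2, hWQ _ hnW (hu M)⟩
    ⟨u (M + 1), hmW, fun h => (hTN h).2 rfl⟩
  apply hvT
  rw [hTO]
  exact ⟨⟨hvW.1, image_subset_range _ _ hvG⟩, hvO⟩

lemma core {S : Type*} [MetricSpace S] [CompactSpace S]
    (hS : IsSurfaceLocallyEuclidean S) (K : Set S) (hK : IsCompact K)
    {Y : Type*} [MetricSpace Y] [CompactSpace Y]
    (hloc : ∀ y : Y, LocallyConnectedSpace (connectedComponent y))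
    (hfin : ∀ ε : ℝ, 0 < ε →
      {C : Set Y | (∃ y : Y, C = connectedComponent y) ∧ ε < Metric.diam C}.Finite)
    (π : S → Y) (hπ : ContinuousOn π K)
    (hsurj : π '' K = univ) (hfib : ∀ y, IsPreconnected (K ∩ π ⁻¹' {y}))
    (x y : S) (hxy : (x, y) ∈ schonfliesRel K) : π x = π y := by
  obtain ⟨hxK, hyK, heq | ⟨φ, hφ, -, -, hbd, Q, hQne, hQ, hQm, L, hLc, hLconn, hlim, hxL, hyL⟩⟩ := hxy
  · exact congrArg π heq
  by_contra hne
  simp only at hxK hyK hxL hyL hne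
  have hQK : ∀ n, Q n ⊆ K ∩ range φ := by
    intro n
    obtain ⟨w, hw, h⟩ := hQ n
    rw [h]; exact connectedComponentIn_subset _ _
  have hKr : IsCompact (K ∩ range φ) :=
    hK.inter_right (isCompact_range hφ.continuous).isClosed
  have hQp : ∀ n, IsPreconnected (Q n) := by
    intro n
    obtain ⟨w, hw, h⟩ := hQ n
    rw [h]; exact isPreconnected_connectedComponentIn
  have hQc : ∀ n, IsCompact (Q n) := by
    intro n
    obtain ⟨w, hw, h⟩ := hQ n
    rw [h]
    haveI : CompactSpace ↥(K ∩ range φ) := isCompact_iff_compactSpace.1 hKr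
    rw [connectedComponentIn_eq_image hw]
    exact isClosed_connectedComponent.isCompact.image continuous_subtype_val
  have hdis : ∀ m n, m ≠ n → Disjoint (Q m) (Q n) := by
    intro m n hmn
    rw [Set.disjoint_left]
    intro v hv hv'
    apply hQne m n hmn
    obtain ⟨w, hw, h⟩ := hQ m
    obtain ⟨w', hw', h'⟩ := hQ n
    rw [h] at hv ⊢
    rw [h'] at hv' ⊢
    rw [connectedComponentIn_eq hv, connectedComponentIn_eq hv']
  let A : ℕ → Set (I × I) := fun n => φ ⁻¹' Q n
  have hAc : ∀ n, IsCompact (A n) := fun n =>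
    ((hQc n).isClosed.preimage hφ.continuous).isCompact
  have hAp : ∀ n, IsPreconnected (A n) := by
    intro n
    rw [← hφ.isInducing.isPreconnected_image,
      image_preimage_eq_of_subset ((hQK n).trans inter_subset_right)]
    exact hQp n
  have hAd : ∀ m n, m ≠ n → Disjoint (A m) (A n) := fun m n h => (hdis m n h).preimage φ
  have hA0 : ∀ n, ∃ t, (t, (0 : I)) ∈ A n := by
    intro n
    obtain ⟨v, hv, ⟨q1, q2⟩, hq, rfl⟩ := (hQm n).1
    simp only [mem_setOf_eq] at hq
    subst hq
    exact ⟨q1, hv⟩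
  have hA1 : ∀ n, ∃ t, (t, (1 : I)) ∈ A n := by
    intro n
    obtain ⟨v, hv, ⟨q1, q2⟩, hq, rfl⟩ := (hQm n).2
    simp only [mem_setOf_eq] at hq
    subst hq
    exact ⟨q1, hv⟩
  obtain ⟨a, ψ1, hψ1, ha⟩ := trace_lemma A hAc hAp hAd hA0 hA1
  obtain ⟨b, ψ2, hψ2, hb⟩ := trace_lemma_top (fun n => A (ψ1 n)) (fun n => hAc _) (fun n => hAp _)
    (fun m n h => hAd _ _ (fun e => h (hψ1.injective e))) (fun n => hA0 _) (fun n => hA1 _)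
  have hQn : ∀ n, (Q n).Nonempty := fun n => (hQm n).1.mono inter_subset_left
  have hθ : StrictMono (ψ1 ∘ ψ2) := hψ1.comp hψ2
  obtain ⟨xs, hxs, hxt⟩ := hausdorff_approx (fun n => Q (ψ1 (ψ2 n))) L (fun n => hQc _)
    (fun n => hQn _) ⟨x, hxL⟩ (hlim.comp hθ.tendsto_atTop) hxL
  obtain ⟨ys, hys, hyt⟩ := hausdorff_approx (fun n => Q (ψ1 (ψ2 n))) L (fun n => hQc _)
    (fun n => hQn _) ⟨x, hxL⟩ (hlim.comp hθ.tendsto_atTop) hyL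
  have hπt : ∀ (u : ℕ → S) (z : S), (∀ n, u n ∈ K) → Tendsto u atTop (𝓝 z) →
      Tendsto (fun n => π (u n)) atTop (𝓝 (π z)) := by
    intro u z huK hu
    have hzK : z ∈ K := hK.isClosed.mem_of_tendsto hu (Eventually.of_forall huK)
    exact (hπ z hzK).tendsto.comp (tendsto_nhdsWithin_iff.2 ⟨hu, Eventually.of_forall huK⟩)
  have hd := (hπt xs x (fun n => (hQK _ (hxs n)).1) hxt).dist
    (hπt ys y (fun n => (hQK _ (hys n)).1) hyt)
  have hpos : 0 < dist (π x) (π y) := dist_pos.2 hne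
  have hev := hd.eventually (lt_mem_nhds (half_lt_self hpos))
  have hcc : ∀ n, ∀ v ∈ Q (ψ1 (ψ2 n)), π v ∈ connectedComponent (π (xs n)) := by
    intro n v hv
    have : IsPreconnected (π '' Q (ψ1 (ψ2 n))) :=
      (hQp _).image π (hπ.mono ((hQK _).trans inter_subset_left))
    exact this.subset_connectedComponent ⟨_, hxs n, rfl⟩ ⟨v, hv, rfl⟩
  have hfreq : ∃ C : Set Y, ∃ᶠ n in atTop, connectedComponent (π (xs n)) = C := by
    by_contra hcon
    push Not at hcon
    have hall := (eventually_all_finite (hfin _ (half_pos hpos))).2 (fun C _ => hcon C)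
    obtain ⟨n, hn1, hn2⟩ := (hev.and hall).exists
    refine hn2 (connectedComponent (π (xs n))) ⟨⟨_, rfl⟩, ?_⟩ rfl
    exact hn1.trans_le (dist_le_diam_of_mem (Bornology.IsBounded.all _) mem_connectedComponent
      (hcc n _ (hys n)))
  obtain ⟨C, hC⟩ := hfreq
  obtain ⟨ψ3, hψ3, hψC⟩ := extraction_of_frequently_atTop hC
  let Q' : ℕ → Set S := fun n => Q (ψ1 (ψ2 (ψ3 n)))
  have hθ' : StrictMono (ψ1 ∘ ψ2 ∘ ψ3) := hψ1.comp (hψ2.comp hψ3)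
  have key : ∀ z ∈ L, π z = π (φ (a, 0)) ∨ π z = π (φ (b, 1)) := by
    intro z hz
    obtain ⟨u, hu, hut⟩ := hausdorff_approx Q' L (fun n => hQc _)
      (fun n => hQn _) ⟨x, hxL⟩ (hlim.comp hθ'.tendsto_atTop) hz
    refine core_z hS K hK hloc π hπ hsurj hfib φ hφ hbd Q'
      (fun m n h => hdis _ _ (fun e => h (hθ'.injective e))) (fun n => hQ _) a b ?_ ?_
      (π (xs (ψ3 0))) ?_ u hu z hut
    · intro N hN
      exact (hψ2.comp hψ3).tendsto_atTop.eventually (ha N hN)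
    · intro N hN
      exact hψ3.tendsto_atTop.eventually (hb N hN)
    · intro n v hv
      rw [hψC 0, ← hψC n]
      exact hcc _ v hv
  have hLK : L ⊆ K := by
    intro z hz
    obtain ⟨u, hu, hut⟩ := hausdorff_approx Q' L (fun n => hQc _)
      (fun n => hQn _) ⟨x, hxL⟩ (hlim.comp hθ'.tendsto_atTop) hz
    exact hK.isClosed.mem_of_tendsto hut (Eventually.of_forall fun n => (hQK _ (hu n)).1)
  have hpL : IsPreconnected (π '' L) := hLconn.isPreconnected.image π (hπ.mono hLK)
  have hinf := hpL.infinite_of_nontrivial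
    ⟨π x, ⟨x, hxL, rfl⟩, π y, ⟨y, hyL, rfl⟩, hne⟩
  apply hinf
  refine (Set.toFinite {π (φ (a, 0)), π (φ (b, 1))}).subset ?_
  rintro _ ⟨z, hz, rfl⟩
  exact key z hz

lemma core_top {S : Type*} [MetricSpace S] [CompactSpace S]
    (hS : IsSurfaceLocallyEuclidean S) (K : Set S) (hK : IsCompact K)
    {Y : Type*} [ty : TopologicalSpace Y] (hY : IsPeanoCompactumSp Y)
    (π : S → Y) (hπ : ContinuousOn π K)
    (hsurj : π '' K = univ) (hfib : ∀ y, IsPreconnected (K ∩ π ⁻¹' {y})) :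
    T2Space Y ∧ ∀ x y : S, (x, y) ∈ schonfliesRel K → π x = π y := by
  obtain ⟨h1, h2, m, hm, h3⟩ := hY
  subst hm
  exact ⟨inferInstance, core hS K hK h2 h3 π hπ hsurj hfib⟩

/-- For a nonempty compact subset `K` of a closed surface `S`, the
decomposition into Schönflies classes refines every Peano decomposition of `K`: for every
Peano decomposition `D`, every `x ∈ K` and the element `δ` of `D` containing `x`, the
class `[x]_∼` is contained in `δ`. -/
theorem schonfliesDecomp_refines_peanoDecomp
    {S : Type*} [MetricSpace S] [CompactSpace S] [ConnectedSpace S] [Nonempty S]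
    (hS : IsSurfaceLocallyEuclidean S)
    (K : Set S) (hK : IsCompact K) (hKne : K.Nonempty) :
    ∀ D : Set (Set S), IsPeanoDecomp K D →
      ∀ x ∈ K, ∀ δ ∈ D, x ∈ δ → schonfliesClass K x ⊆ δ := by
  classical
  intro D hD x hx δ hδ hxδ
  obtain ⟨⟨⟨hD1, hD2, hD3, -⟩, hDc⟩, hP⟩ := hD
  have huniq : ∀ δ₁ ∈ D, ∀ δ₂ ∈ D, ∀ z, z ∈ δ₁ → z ∈ δ₂ → δ₁ = δ₂ := by
    intro δ₁ h₁ δ₂ h₂ z hz₁ hz₂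
    by_contra hne
    exact Set.disjoint_left.1 (hD2 δ₁ h₁ δ₂ h₂ hne) hz₁ hz₂
  have hmem : ∀ z ∈ K, ∃ δ' ∈ D, z ∈ δ' := by
    intro z hz
    rw [← hD3] at hz
    exact hz
  have heqv : Equivalence (decompRel K D) := by
    refine ⟨fun z => ?_, ?_, ?_⟩
    · obtain ⟨δ', h, hz⟩ := hmem z z.2
      exact ⟨δ', h, hz, hz⟩
    · rintro u v ⟨δ', h, hu, hv⟩
      exact ⟨δ', h, hv, hu⟩
    · rintro u v w ⟨δ₁, h₁, hu, hv⟩ ⟨δ₂, h₂, hv', hw⟩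
      obtain rfl := huniq _ h₁ _ h₂ _ hv hv'
      exact ⟨δ₁, h₁, hu, hw⟩
  have hmk : ∀ u v : K, (Quot.mk (decompRel K D) u = Quot.mk (decompRel K D) v) ↔
      decompRel K D u v := by
    intro u v
    rw [Quot.eq, heqv.eqvGen_iff]
  let π : S → DecompQuot K D := fun s =>
    if h : s ∈ K then Quot.mk _ ⟨s, h⟩ else Quot.mk _ ⟨x, hx⟩
  have hπK : ∀ s (h : s ∈ K), π s = Quot.mk _ ⟨s, h⟩ := fun s h => dif_pos h
  have hπ : ContinuousOn π K := by
    rw [continuousOn_iff_continuous_domRestrict]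
    exact continuous_quot_mk.congr (fun s => (hπK s s.2).symm)
  have hπeq : ∀ u ∈ K, ∀ v ∈ K, π u = π v ↔ ∃ δ' ∈ D, u ∈ δ' ∧ v ∈ δ' := by
    intro u hu v hv
    rw [hπK u hu, hπK v hv, hmk]
    rfl
  have hsurj : π '' K = univ := by
    rw [eq_univ_iff_forall]
    intro y
    obtain ⟨⟨s, hs⟩, rfl⟩ := Quot.exists_rep y
    exact ⟨s, hs, hπK s hs⟩
  have hfib : ∀ y, IsPreconnected (K ∩ π ⁻¹' {y}) := by
    intro y
    obtain ⟨s, hs, rfl⟩ : y ∈ π '' K := by rw [hsurj]; trivial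
    obtain ⟨δ', h', hs'⟩ := hmem s hs
    have : K ∩ π ⁻¹' {π s} = δ' := by
      ext w
      constructor
      · rintro ⟨hw, hws⟩
        obtain ⟨δ₂, h₂, hw₂, hs₂⟩ := (hπeq w hw s hs).1 hws
        rwa [huniq _ h' _ h₂ s hs' hs₂]
      · intro hw
        have hwK := (hD1 δ' h').2.2 hw
        exact ⟨hwK, (hπeq w hwK s hs).2 ⟨δ', h', hw, hs'⟩⟩
    rw [this]
    exact (hDc δ' h').isPreconnected
  obtain ⟨hT2, hR⟩ := core_top hS K hK hP π hπ hsurj hfib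
  let E : Set (S × S) := {p | p ∈ K ×ˢ K ∧ π p.1 = π p.2}
  have hE : E ∈ closedEquivsOn K (schonfliesRel K) := by
    refine ⟨?_, fun p hp => hp.1, ?_, fun z hz => ⟨⟨hz, hz⟩, rfl⟩, ?_, ?_⟩
    · rintro ⟨u, v⟩ huv
      exact ⟨⟨huv.1, huv.2.1⟩, hR u v huv⟩
    · have hc : ContinuousOn (fun p : S × S => (π p.1, π p.2)) (K ×ˢ K) :=
        (hπ.comp continuousOn_fst (fun p hp => hp.1)).prodMk
          (hπ.comp continuousOn_snd (fun p hp => hp.2))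
      exact hc.preimage_isClosed_of_isClosed (hK.isClosed.prod hK.isClosed) isClosed_diagonal
    · rintro u v ⟨⟨hu, hv⟩, h⟩
      exact ⟨⟨hv, hu⟩, h.symm⟩
    · rintro u v w ⟨⟨hu, hv⟩, h⟩ ⟨⟨hv', hw⟩, h'⟩
      exact ⟨⟨hu, hw⟩, h.trans h'⟩
  intro y hy
  have hyE : (x, y) ∈ E := hy E hE
  obtain ⟨δ', h', hx', hy'⟩ := (hπeq x hx y hyE.1.2).1 hyE.2
  rwa [huniq _ hδ _ h' x hxδ hx']
end

section
/- Let S be a closed surface with a fixed metric inducing its topology and let K be a nonempty compact subset of S. Then the following assertions are equivalent: (1) K, with the restricted metric, is a Peano compactum; (2) [x]_∼ = {x} for every x ∈ K, where [x]_∼ is the class of x under the Schönflies equivalence; (3) the Schönflies relation is trivial, i.e., R_K = {(x,x) : x ∈ K}. -/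
open Set Metric Filter Topology unitInterval

/-- A nonvanishing function has a continuous logarithm. -/
def HasCLog {X : Type*} [TopologicalSpace X] (g : X → ℂ) : Prop :=
  ∃ L : X → ℂ, Continuous L ∧ ∀ z, Complex.exp (L z) = g z

lemma HasCLog.of_close {X : Type*} [TopologicalSpace X] {g h : X → ℂ} (hg : Continuous g)
    (hh : Continuous h) (hlt : ∀ z, ‖g z - h z‖ < ‖h z‖) (H : HasCLog h) : HasCLog g := by
  obtain ⟨L, hL, hLe⟩ := H
  have h0 : ∀ z, h z ≠ 0 := fun z hz => by
    have := hlt z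
    rw [hz, norm_zero] at this
    exact absurd this (not_lt.2 (norm_nonneg _))
  have hsl : ∀ z, g z / h z ∈ Complex.slitPlane := fun z => by
    have : g z / h z = 1 + (g z - h z) / h z := by
      field_simp [h0 z]
      ring
    rw [this]
    apply Complex.mem_slitPlane_of_norm_lt_one
    rw [norm_div, div_lt_one (norm_pos_iff.2 (h0 z))]
    exact hlt z
  refine ⟨fun z => L z + Complex.log (g z / h z),
    hL.add (Continuous.clog (hg.div hh h0) hsl), fun z => ?_⟩
  rw [Complex.exp_add, hLe, Complex.exp_log (Complex.slitPlane_ne_zero (hsl z))]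
  field_simp [h0 z]

lemma HasCLog.homotopy {X : Type*} [TopologicalSpace X] [CompactSpace X]
    (F : unitInterval × X → ℂ) (hF : Continuous F) (h0 : ∀ p, F p ≠ 0)
    (H : HasCLog (fun z => F (0, z))) : HasCLog (fun z => F (1, z)) := by
  have hcont : ∀ t, Continuous (fun z => F (t, z)) := fun t =>
    hF.comp (Continuous.prodMk continuous_const continuous_id)
  have key : ∀ t : unitInterval, ∀ᶠ s in 𝓝 t, ∀ z, ‖F (s, z) - F (t, z)‖ < ‖F (t, z)‖ ∧
      ‖F (t, z) - F (s, z)‖ < ‖F (s, z)‖ := by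
    intro t
    have hopen : IsOpen {p : unitInterval × X | ‖F p - F (t, p.2)‖ < ‖F (t, p.2)‖ ∧
        ‖F (t, p.2) - F p‖ < ‖F p‖} := by
      rw [ofPred_and]
      refine IsOpen.inter ?_ ?_
      · exact isOpen_lt (by fun_prop) (by fun_prop)
      · exact isOpen_lt (by fun_prop) (by fun_prop)
    have := generalized_tube_lemma (s := {t}) isCompact_singleton (t := (univ : Set X))
      isCompact_univ hopen (by
        rintro ⟨a, b⟩ ⟨ha, -⟩
        simp only [mem_singleton_iff] at ha
        subst ha
        simp [h0])
    obtain ⟨u, v, hu, -, htu, hv, huv⟩ := this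
    filter_upwards [hu.mem_nhds (htu rfl)] with s hs z
    exact huv (mk_mem_prod hs (hv (mem_univ z)))
  have hcl : IsClopen {t : unitInterval | HasCLog (fun z => F (t, z))} := by
    constructor
    · rw [← isOpen_compl_iff, isOpen_iff_mem_nhds]
      intro t ht
      filter_upwards [key t] with s hs hs'
      exact ht (HasCLog.of_close (hcont t) (hcont s) (fun z => (hs z).2) hs')
    · rw [isOpen_iff_mem_nhds]
      intro t ht
      filter_upwards [key t] with s hs
      exact HasCLog.of_close (hcont s) (hcont t) (fun z => (hs z).1) ht
  have := hcl.eq_univ ⟨0, H⟩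
  exact (this ▸ mem_univ (1 : unitInterval) : (1 : unitInterval) ∈ {t : unitInterval | HasCLog (fun z => F (t, z))})

lemma not_hasCLog_odd (g : sphere (0 : ℂ) 1 → ℂ) (hodd : ∀ z, g (-z) = - g z) : ¬ HasCLog g := by
  rintro ⟨L, hL, hLe⟩
  have : ConnectedSpace (sphere (0 : ℂ) 1) := by
    apply Subtype.connectedSpace
    apply isConnected_sphere
    · rw [Complex.rank_real_complex]; norm_num
    · norm_num
  have hk : ∀ z, ∃ k : ℤ, L (-z) - L z = (2 * k + 1) * (Real.pi * Complex.I) := by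
    intro z
    have : Complex.exp (L (-z)) = Complex.exp (L z + Real.pi * Complex.I) := by
      rw [Complex.exp_add, Complex.exp_pi_mul_I, hLe, hLe, hodd]; ring
    obtain ⟨n, hn⟩ := Complex.exp_eq_exp_iff_exists_int.1 this
    exact ⟨n, by rw [hn]; ring⟩
  choose k hk using hk
  have hkc : Continuous (fun z => (k z : ℝ)) := by
    have : (fun z => (k z : ℝ)) = fun z => (((L (-z) - L z) / (Real.pi * Complex.I) - 1) / 2).re := by
      ext z
      rw [hk z]
      have h1 : (Real.pi : ℂ) * Complex.I ≠ 0 := by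
        simp [Real.pi_ne_zero]
      rw [mul_div_cancel_right₀ _ h1]
      have : ((2 * (k z : ℂ) + 1 - 1) / 2) = ((k z : ℝ) : ℂ) := by push_cast; ring
      rw [this, Complex.ofReal_re]
    rw [this]
    fun_prop
  have hkc' : Continuous k := by
    exact Int.isClosedEmbedding_coe_real.isEmbedding.continuous_iff.2 hkc
  obtain ⟨z⟩ : Nonempty (sphere (0 : ℂ) 1) := inferInstance
  have heq : k (-z) = k z := PreconnectedSpace.constant inferInstance hkc'
  have h1 := hk z
  have h2 := hk (-z)
  rw [neg_neg, heq] at h2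
  have h3 : (2 * (k z : ℂ) + 1) * (Real.pi * Complex.I) = 0 := by
    linear_combination (-1/2 : ℂ) * h1 - (1/2 : ℂ) * h2
  rcases mul_eq_zero.1 h3 with h4 | h4
  · have h5 : 2 * k z + 1 = 0 := by exact_mod_cast h4
    omega
  · simp [Real.pi_ne_zero] at h4

/-- Invariance of domain in the plane. -/
lemma invariance_of_domain_plane (f : ℂ → ℂ) (hf : ContinuousOn f (closedBall 0 1))
    (hinj : InjOn f (closedBall 0 1)) : f '' closedBall 0 1 ∈ 𝓝 (f 0) := by
  have hsm : ∀ z : sphere (0 : ℂ) 1, ∀ t : unitInterval, (t : ℂ) * z ∈ closedBall (0 : ℂ) 1 := by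
    intro z t
    have hz : ‖(z : ℂ)‖ = 1 := by simpa using z.2
    simp [hz, abs_le]
    constructor <;> linarith [t.2.1, t.2.2]
  have hsm1 : ∀ z : sphere (0 : ℂ) 1, (z : ℂ) ∈ closedBall (0 : ℂ) 1 := fun z => by
    simpa using hsm z 1
  have hsmn : ∀ z : sphere (0 : ℂ) 1, ∀ t : unitInterval, -((t : ℂ) * z) ∈ closedBall (0 : ℂ) 1 := by
    intro z t
    simpa using hsm z t
  have h0m : (0 : ℂ) ∈ closedBall (0 : ℂ) 1 := by simp
  have hc1 : Continuous fun z : sphere (0 : ℂ) 1 => f z :=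
    hf.comp_continuous continuous_subtype_val hsm1
  have hcm : Continuous fun p : unitInterval × sphere (0 : ℂ) 1 => f ((p.1 : ℂ) * p.2) :=
    hf.comp_continuous (by fun_prop) (fun p => hsm p.2 p.1)
  have hcn : Continuous fun p : unitInterval × sphere (0 : ℂ) 1 => f (-((p.1 : ℂ) * p.2)) :=
    hf.comp_continuous (by fun_prop) (fun p => hsmn p.2 p.1)
  have hnz : ∀ z : sphere (0 : ℂ) 1, (z : ℂ) ≠ 0 := fun z => ne_zero_of_mem_unit_sphere z
  -- the map has no logarithm
  have hno : ¬ HasCLog (fun z : sphere (0 : ℂ) 1 => f z - f 0) := by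
    intro H
    have h2 := HasCLog.homotopy
      (fun p : unitInterval × sphere (0 : ℂ) 1 => f p.2 - f (-((p.1 : ℂ) * p.2)))
      ((hc1.comp continuous_snd).sub hcn) (by
        rintro ⟨t, z⟩ h
        have h1 := hinj (hsm1 z) (hsmn z t) (sub_eq_zero.1 h)
        have h2 : (1 + (t : ℂ)) * z = 0 := by linear_combination h1
        rcases mul_eq_zero.1 h2 with h3 | h3
        · have h4 : (1 : ℝ) + t = 0 := by exact_mod_cast h3
          linarith [t.2.1]
        · exact hnz z h3) (by simpa using H)
    refine not_hasCLog_odd _ (fun z => ?_) h2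
    simp
  -- a positive distance
  obtain ⟨z0, -, hz0⟩ := (isCompact_univ (X := sphere (0 : ℂ) 1)).exists_isMinOn
    ⟨⟨1, by simp⟩, mem_univ _⟩ ((hc1.sub continuous_const).norm.continuousOn (s := univ)
      (f := fun z : sphere (0 : ℂ) 1 => ‖f z - f 0‖))
  have hpos : 0 < ‖f z0 - f 0‖ := norm_pos_iff.2 (sub_ne_zero.2 fun h =>
    hnz z0 (hinj (hsm1 z0) h0m h))
  refine Filter.mem_of_superset (ball_mem_nhds (f 0) hpos) fun w hw => ?_
  by_contra hwf
  apply hno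
  have h1 := HasCLog.homotopy
    (fun p : unitInterval × sphere (0 : ℂ) 1 => f ((p.1 : ℂ) * p.2) - w)
    (hcm.sub continuous_const) (fun p h => hwf ⟨_, hsm p.2 p.1, sub_eq_zero.1 h⟩) (by
      refine ⟨fun _ => Complex.log (f 0 - w), continuous_const, fun z => ?_⟩
      rw [Complex.exp_log]
      · simp
      · exact fun h => hwf ⟨0, h0m, sub_eq_zero.1 h⟩)
  simp only [Icc.coe_one, Complex.ofReal_one, one_mul] at h1
  have hsymm : ¬ ¬ HasCLog (fun z : sphere (0 : ℂ) 1 => f z - f 0) := by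
    intro _
    -- connect through the segment from w to f 0
    have h2 := HasCLog.homotopy
      (fun p : unitInterval × sphere (0 : ℂ) 1 => (f p.2 - f 0) - (1 - (p.1 : ℂ)) * (w - f 0))
      (((hc1.comp continuous_snd).sub continuous_const).sub (by fun_prop)) (by
        rintro ⟨t, z⟩ h
        have hm : ‖f z0 - f 0‖ ≤ ‖f z - f 0‖ := hz0 (mem_univ z)
        have hw' : ‖w - f 0‖ < ‖f z0 - f 0‖ := by simpa [dist_eq_norm] using hw
        have he : f z - f 0 = (1 - (t : ℂ)) * (w - f 0) := sub_eq_zero.1 h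
        have hle : ‖(1 - (t : ℂ))‖ ≤ 1 := by
          have : (1 - (t : ℂ)) = ((1 - (t : ℝ) : ℝ) : ℂ) := by push_cast; rfl
          rw [this, Complex.norm_real, Real.norm_eq_abs, abs_le]
          constructor <;> linarith [t.2.1, t.2.2]
        have : ‖f z - f 0‖ ≤ ‖w - f 0‖ := by
          rw [he, norm_mul]
          exact mul_le_of_le_one_left (norm_nonneg _) hle
        linarith) (by
        convert h1 using 2 with z
        simp)
    simp at h2
    contradiction
  exact not_not.1 hsymm

lemma clopen_sep {Z : Type*} [TopologicalSpace Z] [CompactSpace Z] [T2Space Z] {X Y : Set Z}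
    (hX : IsClosed X) (hY : IsClosed Y) (h : ∀ x ∈ X, Disjoint (connectedComponent x) Y) :
    ∃ V, IsClopen V ∧ X ⊆ V ∧ Disjoint V Y := by
  have h1 : ∀ x ∈ X, ∃ V, IsClopen V ∧ x ∈ V ∧ Disjoint V Y := by
    intro x hx
    have hd := h x hx
    rw [connectedComponent_eq_iInter_isClopen, disjoint_iff_inter_eq_empty, inter_comm] at hd
    have : Nonempty { s : Set Z // IsClopen s ∧ x ∈ s } := ⟨⟨univ, isClopen_univ, mem_univ _⟩⟩
    obtain ⟨V, hV⟩ := hY.isCompact.elim_directed_family_closed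
      (fun s : { s : Set Z // IsClopen s ∧ x ∈ s } => (s : Set Z))
      (fun s => s.2.1.isClosed) hd (fun s t => ⟨⟨s ∩ t, s.2.1.inter t.2.1, s.2.2, t.2.2⟩,
        inter_subset_left, inter_subset_right⟩)
    refine ⟨V, V.2.1, V.2.2, ?_⟩
    rw [disjoint_iff_inter_eq_empty, inter_comm]
    exact hV
  choose! V hV hxV hVY using h1
  obtain ⟨t, ht, hXt⟩ := hX.isCompact.elim_nhds_subcover V
    (fun x hx => (hV x hx).isOpen.mem_nhds (hxV x hx))
  refine ⟨⋃ x ∈ t, V x, isClopen_biUnion_finset fun x hx => hV x (ht x hx), hXt, ?_⟩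
  simp only [disjoint_iUnion_left]
  exact fun x hx => hVY x (ht x hx)

/-- A connected compact set going from `P` to `Q` has a connected compact piece in `A` meeting
both `P` and `Q`. -/
lemma bump {S : Type*} [TopologicalSpace S] [T2Space S] {C P Q A : Set S} (hC : IsCompact C)
    (hCc : IsPreconnected C) (hP : IsClosed P) (hQ : IsClosed Q) (hA : IsClosed A)
    (hcov : C ⊆ P ∪ A ∪ Q) (hPQ : ∀ x ∈ C, x ∈ P → x ∉ Q) (hCP : (C ∩ P).Nonempty)
    (hCQ : (C ∩ Q).Nonempty) :
    ∃ M ⊆ C ∩ A, IsPreconnected M ∧ (M ∩ P).Nonempty ∧ (M ∩ Q).Nonempty := by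
  by_contra hcon
  have hZ : IsCompact (C ∩ A) := hC.inter_right hA
  have : CompactSpace ↥(C ∩ A) := isCompact_iff_compactSpace.1 hZ
  obtain ⟨V, hV, hXV, hVY⟩ := clopen_sep (Z := ↥(C ∩ A)) (X := Subtype.val ⁻¹' P)
    (Y := Subtype.val ⁻¹' Q) (hP.preimage continuous_subtype_val)
    (hQ.preimage continuous_subtype_val) (by
      intro x hx
      rw [Set.disjoint_left]
      intro y hy hyQ
      apply hcon
      refine ⟨Subtype.val '' connectedComponent x, ?_, ?_, ⟨x, ⟨x, mem_connectedComponent, rfl⟩, hx⟩,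
        ⟨y, ⟨y, hy, rfl⟩, hyQ⟩⟩
      · rintro _ ⟨z, -, rfl⟩; exact z.2
      · exact isPreconnected_connectedComponent.image _ continuous_subtype_val.continuousOn)
  have hc1 : IsClosed (Subtype.val '' V) :=
    (hV.isClosed.isCompact.image continuous_subtype_val).isClosed
  have hc2 : IsClosed (Subtype.val '' Vᶜ) :=
    (hV.compl.isClosed.isCompact.image continuous_subtype_val).isClosed
  have := isPreconnected_closed_iff.1 hCc ((C ∩ P) ∪ Subtype.val '' V)
    ((C ∩ Q) ∪ Subtype.val '' Vᶜ) ((hC.isClosed.inter hP).union hc1)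
    ((hC.isClosed.inter hQ).union hc2) (by
      intro x hx
      rcases hcov hx with (h | h) | h
      · exact Or.inl (Or.inl ⟨hx, h⟩)
      · by_cases hv : (⟨x, hx, h⟩ : ↥(C ∩ A)) ∈ V
        · exact Or.inl (Or.inr ⟨_, hv, rfl⟩)
        · exact Or.inr (Or.inr ⟨_, hv, rfl⟩)
      · exact Or.inr (Or.inl ⟨hx, h⟩)) 
    (by obtain ⟨x, hx⟩ := hCP; exact ⟨x, hx.1, Or.inl hx⟩)
    (by obtain ⟨x, hx⟩ := hCQ; exact ⟨x, hx.1, Or.inl hx⟩)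
  obtain ⟨x, hxC, h1 | ⟨y, hy, rfl⟩, h2 | ⟨y', hy', h2⟩⟩ := this
  · exact hPQ x hxC h1.2 h2.2
  · subst h2
    exact hy' (hXV h1.2)
  · exact Set.disjoint_left.1 hVY hy h2.2
  · have := Subtype.val_injective h2
    subst this
    exact hy' hy

/-- Subsequence converging in the Hausdorff metric to a continuum. -/
lemma exists_subseq_hausdorff {S : Type*} [MetricSpace S] [CompactSpace S] (Q : ℕ → Set S)
    (hQc : ∀ n, IsCompact (Q n)) (hQ : ∀ n, IsConnected (Q n)) :
    ∃ Qinf : Set S, IsCompact Qinf ∧ IsConnected Qinf ∧ ∃ τ : ℕ → ℕ, StrictMono τ ∧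
      Tendsto (fun n => hausdorffDist (Q (τ n)) Qinf) atTop (𝓝 0) := by
  let q : ℕ → TopologicalSpace.NonemptyCompacts S := fun n => ⟨⟨Q n, hQc n⟩, (hQ n).nonempty⟩
  obtain ⟨L, τ, hτ, hL⟩ := CompactSpace.tendsto_subseq q
  have hLt : Tendsto (fun n => hausdorffDist (Q (τ n)) (L : Set S)) atTop (𝓝 0) := by
    have := tendsto_iff_dist_tendsto_zero.1 hL
    exact this
  refine ⟨L, L.isCompact, ⟨L.nonempty, ?_⟩, τ, hτ, hLt⟩
  have hfin : ∀ n, hausdorffEDist (Q (τ n)) (L : Set S) ≠ ⊤ := fun n =>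
    hausdorffEDist_ne_top_of_nonempty_of_bounded (hQ _).nonempty L.nonempty
      (hQc _).isBounded L.isCompact.isBounded
  rw [isPreconnected_closed_iff]
  intro A B hA hB hAB hLA hLB
  by_contra hdis
  have hA' : IsCompact ((L : Set S) ∩ A) := L.isCompact.inter_right hA
  have hB' : IsCompact ((L : Set S) ∩ B) := L.isCompact.inter_right hB
  have hd : Disjoint ((L : Set S) ∩ A) ((L : Set S) ∩ B) := by
    rw [Set.disjoint_left]
    rintro x ⟨h1, h2⟩ ⟨-, h3⟩
    exact hdis ⟨x, h1, h2, h3⟩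
  obtain ⟨δ, hδ, hdt⟩ := hd.exists_thickenings hA' hB'.isClosed
  obtain ⟨n, hn⟩ := (hLt.eventually (gt_mem_nhds hδ)).exists
  have hsub : Q (τ n) ⊆ thickening δ ((L : Set S) ∩ A) ∪ thickening δ ((L : Set S) ∩ B) := by
    intro x hx
    obtain ⟨y, hy, hxy⟩ := exists_dist_lt_of_hausdorffDist_lt hx hn (hfin n)
    rcases hAB hy with h | h
    · exact Or.inl (mem_thickening_iff.2 ⟨y, ⟨hy, h⟩, hxy⟩)
    · exact Or.inr (mem_thickening_iff.2 ⟨y, ⟨hy, h⟩, hxy⟩)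
  have hmeet : ∀ B', ((L : Set S) ∩ B').Nonempty →
      (Q (τ n) ∩ thickening δ ((L : Set S) ∩ B')).Nonempty := by
    rintro B' ⟨y, hy⟩
    obtain ⟨x, hx, hxy⟩ := exists_dist_lt_of_hausdorffDist_lt' hy.1 hn (hfin n)
    exact ⟨x, hx, mem_thickening_iff.2 ⟨y, hy, hxy⟩⟩
  obtain ⟨x, -, h1, h2⟩ := (hQ (τ n)).isPreconnected _ _ isOpen_thickening isOpen_thickening hsub
    (hmeet A hLA) (hmeet B hLB)
  exact Set.disjoint_left.1 hdt h1 h2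

lemma exists_chart {S : Type*} [TopologicalSpace S] (hS : ∀ x : S, ∃ U : Set S, IsOpen U ∧ x ∈ U ∧ Nonempty (U ≃ₜ (ℝ × ℝ)))
    (x : S) (W : Set S) (hW : W ∈ 𝓝 x) :
    ∃ ψ : ℂ → S, IsOpenEmbedding ψ ∧ ψ 0 = x ∧ ψ '' closedBall 0 2 ⊆ W := by
  obtain ⟨U, hU, hxU, ⟨e⟩⟩ := hS x
  let w0 : ℂ := Complex.equivRealProdCLM.symm (e ⟨x, hxU⟩)
  let h1 : ℂ ≃ₜ U := ((Homeomorph.addRight w0).trans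
    Complex.equivRealProdCLM.toHomeomorph).trans e.symm
  let g : ℂ → S := fun w => (h1 w : S)
  have hg : IsOpenEmbedding g := hU.isOpenEmbedding_subtypeVal.comp h1.isOpenEmbedding
  have hg0 : g 0 = x := by
    simp [g, h1, w0]
  have hW' : g ⁻¹' W ∈ 𝓝 (0 : ℂ) := hg.continuous.continuousAt.preimage_mem_nhds (by rwa [hg0])
  obtain ⟨r, hr, hrW⟩ := Metric.mem_nhds_iff.1 hW'
  have hr' : ((r / 3 : ℝ) : ℂ) ≠ 0 := by
    rw [Complex.ofReal_ne_zero]; positivity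
  refine ⟨fun w => g ((r / 3 : ℝ) * w), hg.comp (Homeomorph.mulLeft₀ _ hr').isOpenEmbedding,
    by simp [hg0], ?_⟩
  rintro _ ⟨w, hw, rfl⟩
  apply hrW
  simp only [mem_closedBall, dist_zero_right] at hw
  rw [mem_ball, dist_zero_right, norm_mul, Complex.norm_real, Real.norm_eq_abs,
    abs_of_pos (by positivity)]
  nlinarith

lemma isCompact_connectedComponentIn' {S : Type*} [TopologicalSpace S] [T2Space S] {F : Set S}
    (hF : IsCompact F) (x : S) : IsCompact (connectedComponentIn F x) := by
  by_cases hx : x ∈ F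
  · refine hF.of_isClosed_subset ?_ (connectedComponentIn_subset F x)
    rw [← closure_subset_iff_isClosed]
    exact isPreconnected_connectedComponentIn.closure.subset_connectedComponentIn
      (subset_closure (mem_connectedComponentIn hx))
      (closure_minimal (connectedComponentIn_subset F x) hF.isClosed)
  · rw [connectedComponentIn_eq_empty hx]
    exact isCompact_empty

section HausdorffLimits
variable {S : Type*} [MetricSpace S] [CompactSpace S] {Q : ℕ → Set S} {L : Set S}

lemma hausdorff_limit_meets (hQ : ∀ n, (Q n).Nonempty) (hL : L.Nonempty) (hLc : IsCompact L)
    (h : Tendsto (fun n => hausdorffDist (Q n) L) atTop (𝓝 0)) {J : Set S} (hJ : IsClosed J)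
    (hm : ∀ n, (Q n ∩ J).Nonempty) : (L ∩ J).Nonempty := by
  by_contra hcon
  have hd : Disjoint L J := by
    rw [disjoint_iff_inter_eq_empty]
    exact not_nonempty_iff_eq_empty.1 hcon
  obtain ⟨δ, hδ, hdt⟩ := hd.exists_thickenings hLc hJ
  obtain ⟨n, hn⟩ := (h.eventually (gt_mem_nhds hδ)).exists
  obtain ⟨a, haQ, haJ⟩ := hm n
  obtain ⟨y, hy, hay⟩ := exists_dist_lt_of_hausdorffDist_lt haQ hn
    (hausdorffEDist_ne_top_of_nonempty_of_bounded (hQ _) hL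
      (isCompact_univ.isBounded.subset (subset_univ _)) hLc.isBounded)
  exact Set.disjoint_left.1 hdt (mem_thickening_iff.2 ⟨y, hy, hay⟩)
    (self_subset_thickening hδ _ haJ)

lemma hausdorff_limit_near (hQ : ∀ n, (Q n).Nonempty) 
    (h : Tendsto (fun n => hausdorffDist (Q n) L) atTop (𝓝 0)) {x : S} (hx : x ∈ L)
    {U : Set S} (hU : U ∈ 𝓝 x) : ∀ᶠ n in atTop, (Q n ∩ U).Nonempty := by
  obtain ⟨δ, hδ, hdU⟩ := Metric.mem_nhds_iff.1 hU
  filter_upwards [h.eventually (gt_mem_nhds hδ)] with n hn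
  obtain ⟨y, hy, hay⟩ := exists_dist_lt_of_hausdorffDist_lt' hx hn
    (hausdorffEDist_ne_top_of_nonempty_of_bounded (hQ _) ⟨x, hx⟩
      (isCompact_univ.isBounded.subset (subset_univ _))
      (isCompact_univ.isBounded.subset (subset_univ _)))
  exact ⟨y, hy, hdU (by simpa using hay)⟩

lemma hausdorff_limit_subset (hQ : ∀ n, (Q n).Nonempty)
    (h : Tendsto (fun n => hausdorffDist (Q n) L) atTop (𝓝 0)) {F : Set S} (hF : IsClosed F)
    (hm : ∀ n, Q n ⊆ F) : L ⊆ F := by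
  intro x hx
  rw [← hF.closure_eq, mem_closure_iff_nhds]
  intro U hU
  obtain ⟨n, y, hy, hyU⟩ := (hausdorff_limit_near hQ h hx hU).exists
  exact ⟨y, hyU, hm n hy⟩

end HausdorffLimits

/-- The angular sector. -/
noncomputable def sector (q : ℂ) (δ : ℝ) (a : unitInterval × unitInterval) : ℂ :=
  q * (((1 + δ * a.2 : ℝ) : ℂ) * Complex.exp (((2 * a.1 - 1) * (Real.pi - δ) : ℝ) * Complex.I))

lemma sector_norm {q : ℂ} (hq : ‖q‖ = 1) {δ : ℝ} (hδ : 0 < δ) (a : unitInterval × unitInterval) :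
    ‖sector q δ a‖ = 1 + δ * a.2 := by
  have : 0 ≤ δ * (a.2 : ℝ) := mul_nonneg hδ.le a.2.2.1
  rw [sector, norm_mul, norm_mul, hq, Complex.norm_exp_ofReal_mul_I, Complex.norm_real,
    Real.norm_eq_abs, abs_of_nonneg (by linarith)]
  ring

lemma sector_continuous (q : ℂ) (δ : ℝ) : Continuous (sector q δ) := by
  unfold sector
  fun_prop

lemma sector_injective {q : ℂ} (hq : ‖q‖ = 1) {δ : ℝ} (hδ : 0 < δ) (hδ1 : δ ≤ 1) :
    Function.Injective (sector q δ) := by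
  intro a b hab
  have hpi := Real.pi_gt_three
  have h2 : (a.2 : ℝ) = b.2 := by
    have := congrArg norm hab
    rw [sector_norm hq hδ, sector_norm hq hδ] at this
    have h3 : δ * ((a.2 : ℝ) - b.2) = 0 := by linarith
    rcases mul_eq_zero.1 h3 with h | h <;> linarith
  have hq0 : q ≠ 0 := fun h => by simp [h] at hq
  have hab' := mul_left_cancel₀ hq0 hab
  rw [h2] at hab'
  have hpos : (0 : ℝ) < 1 + δ * b.2 := by
    have : 0 ≤ δ * (b.2 : ℝ) := mul_nonneg hδ.le b.2.2.1
    linarith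
  have hab2 := mul_left_cancel₀ (Complex.ofReal_ne_zero.2 hpos.ne') hab'
  have harg : ∀ u : unitInterval,
      (Complex.exp (((2 * u - 1) * (Real.pi - δ) : ℝ) * Complex.I)).arg =
        (2 * u - 1) * (Real.pi - δ) := by
    intro u
    rw [Complex.arg_exp_mul_I, toIocMod_eq_self]
    constructor <;> nlinarith [u.2.1, u.2.2]
  have h1 : (2 * (a.1 : ℝ) - 1) * (Real.pi - δ) = (2 * b.1 - 1) * (Real.pi - δ) := by
    exact (harg a.1).symm.trans ((congrArg Complex.arg hab2).trans (harg b.1))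
  have h1' : (a.1 : ℝ) = b.1 := by
    have := mul_right_cancel₀ (by linarith) h1
    linarith
  exact Prod.ext (Subtype.ext h1') (Subtype.ext h2)

/-- Points of the annulus are in the sector or close to `-q`. -/
lemma sector_cover {q : ℂ} (hq : ‖q‖ = 1) {δ : ℝ} (hδ : 0 < δ) (hδ1 : δ ≤ 1) {w : ℂ}
    (hw1 : 1 ≤ ‖w‖) (hw2 : ‖w‖ ≤ 1 + δ) :
    w ∈ range (sector q δ) ∨ ∃ θ : ℝ, |θ| ≤ δ ∧
      w = -q * ((‖w‖ : ℝ) * Complex.exp (θ * Complex.I)) := by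
  have hpi := Real.pi_gt_three
  have hq0 : q ≠ 0 := fun h => by simp [h] at hq
  set α := (w / q).arg with hα
  have hwα : w = q * ((‖w‖ : ℝ) * Complex.exp (α * Complex.I)) := by
    have := Complex.norm_mul_exp_arg_mul_I (w / q)
    rw [norm_div, hq, div_one] at this
    rw [hα, this]
    field_simp
  have hα1 := Complex.neg_pi_lt_arg (w / q)
  have hα2 := Complex.arg_le_pi (w / q)
  rw [← hα] at hα1 hα2
  by_cases h1 : α ≤ Real.pi - δ
  · by_cases h2 : -(Real.pi - δ) ≤ α
    · left
      have hpd : 0 < Real.pi - δ := by linarith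
      refine ⟨(⟨(α / (Real.pi - δ) + 1) / 2, ?_, ?_⟩, ⟨(‖w‖ - 1) / δ, ?_, ?_⟩), ?_⟩
      · have : -1 ≤ α / (Real.pi - δ) := by rw [le_div_iff₀ hpd]; linarith
        linarith
      · have : α / (Real.pi - δ) ≤ 1 := by rw [div_le_iff₀ hpd]; linarith
        linarith
      · exact div_nonneg (by linarith) hδ.le
      · rw [div_le_iff₀ hδ]; linarith
      · rw [sector]
        conv_rhs => rw [hwα]
        have e1 : 1 + δ * ((‖w‖ - 1) / δ) = ‖w‖ := by field_simp; ring
        have e2 : (2 * ((α / (Real.pi - δ) + 1) / 2) - 1) * (Real.pi - δ) = α := by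
          field_simp; ring
        simp only [e1, e2]
    · right
      refine ⟨α + Real.pi, by rw [abs_le]; constructor <;> linarith, ?_⟩
      conv_lhs => rw [hwα]
      push_cast
      rw [add_mul, Complex.exp_add, Complex.exp_pi_mul_I]
      ring
  · right
    refine ⟨α - Real.pi, by rw [abs_le]; constructor <;> linarith, ?_⟩
    conv_lhs => rw [hwα]
    push_cast
    rw [sub_mul, Complex.exp_sub, Complex.exp_pi_mul_I]
    ring

/-- The two radial sides of the sector are close to `-q`. -/
lemma sector_sides {q : ℂ} {δ : ℝ} (hδ : 0 < δ) (a : unitInterval × unitInterval)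
    (ha : a.1 = 0 ∨ a.1 = 1) : ∃ θ : ℝ, |θ| ≤ δ ∧
      sector q δ a = -q * (((1 + δ * a.2 : ℝ) : ℂ) * Complex.exp (θ * Complex.I)) := by
  rcases ha with h | h
  · refine ⟨δ, by rw [abs_of_pos hδ], ?_⟩
    rw [sector, h]
    have : (((2 * ((0 : unitInterval) : ℝ) - 1) * (Real.pi - δ) : ℝ) : ℂ) * Complex.I =
      δ * Complex.I - Real.pi * Complex.I := by push_cast; simp; ring
    rw [this, Complex.exp_sub, Complex.exp_pi_mul_I]
    ring
  · refine ⟨-δ, by rw [abs_neg, abs_of_pos hδ], ?_⟩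
    rw [sector, h]
    have : (((2 * ((1 : unitInterval) : ℝ) - 1) * (Real.pi - δ) : ℝ) : ℂ) * Complex.I =
      ((-δ : ℝ) : ℂ) * Complex.I + Real.pi * Complex.I := by push_cast; ring
    rw [this, Complex.exp_add, Complex.exp_pi_mul_I]
    ring

lemma rel_of_crossing {S : Type*} [MetricSpace S] [CompactSpace S] {K : Set S} (hK : IsCompact K)
    (ψ : ℂ → S) (hψ : IsOpenEmbedding ψ) (E : ℕ → Set S)
    (hE : ∀ n, ∃ z ∈ K ∩ ψ '' closedBall 0 2,
      E n = connectedComponentIn (K ∩ ψ '' closedBall 0 2) z)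
    (hEinj : ∀ m n, m ≠ n → E m ≠ E n)
    (hE1 : ∀ n, (E n ∩ ψ '' closedBall 0 1).Nonempty)
    (hE2 : ∀ n, (E n ∩ (ψ '' ball 0 2)ᶜ).Nonempty) :
    ∃ p ∈ schonfliesRel K, p.1 ≠ p.2 := by
  have hcl : ∀ r, IsClosed (ψ '' closedBall 0 r) := fun r =>
    ((isCompact_closedBall 0 r).image hψ.continuous).isClosed
  have hop : ∀ r, IsClosed (ψ '' ball 0 r)ᶜ := fun r =>
    (hψ.isOpenMap _ isOpen_ball).isClosed_compl
  set D := ψ '' closedBall 0 2 with hD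
  have hKD : IsCompact (K ∩ D) := hK.inter_right (hcl 2)
  have hEc : ∀ n, IsCompact (E n) := fun n => by
    obtain ⟨z, -, h⟩ := hE n
    rw [h]; exact isCompact_connectedComponentIn' hKD z
  have hEp : ∀ n, IsPreconnected (E n) := fun n => by
    obtain ⟨z, -, h⟩ := hE n
    rw [h]; exact isPreconnected_connectedComponentIn
  have hEs : ∀ n, E n ⊆ K ∩ D := fun n => by
    obtain ⟨z, -, h⟩ := hE n
    rw [h]; exact connectedComponentIn_subset _ _
  have hEeq : ∀ n, ∀ x ∈ E n, E n = connectedComponentIn (K ∩ D) x := fun n x hx => by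
    obtain ⟨z, -, h⟩ := hE n
    rw [h] at hx ⊢
    exact connectedComponentIn_eq hx
  -- a point of the circle outside `K`
  obtain ⟨p, hp, hpK⟩ : ∃ p : ℂ, ‖p‖ = 1 ∧ ψ p ∉ K := by
    by_contra! hcon
    have hmeet : ∀ n, ∃ w : ℂ, ‖w‖ = 1 ∧ ψ w ∈ E n := by
      intro n
      obtain ⟨x, hx, ⟨w, hw, rfl⟩, h2⟩ := isPreconnected_closed_iff.1 (hEp n) (ψ '' closedBall 0 1)
        (ψ '' ball 0 1)ᶜ (hcl 1) (hop 1) (by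
          intro x _
          by_cases h : x ∈ ψ '' ball 0 1
          · exact Or.inl (image_mono ball_subset_closedBall h)
          · exact Or.inr h) (hE1 n)
          ((hE2 n).mono (inter_subset_inter_right _ (compl_subset_compl.2
            (image_mono (ball_subset_ball (by norm_num))))))
      refine ⟨w, le_antisymm (by simpa using hw) ?_, hx⟩
      by_contra! hlt
      exact h2 ⟨w, by simpa using hlt, rfl⟩
    have hsp : IsPreconnected (ψ '' sphere 0 1) := by
      refine IsPreconnected.image ?_ _ hψ.continuous.continuousOn
      exact isPreconnected_sphere (by rw [Complex.rank_real_complex]; norm_num) _ _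
    have hsK : ψ '' sphere 0 1 ⊆ K ∩ D := by
      rintro _ ⟨w, hw, rfl⟩
      have hw' : ‖w‖ = 1 := by simpa using hw
      exact ⟨hcon w hw', w, by simp [hw'], rfl⟩
    obtain ⟨w0, hw0, h0⟩ := hmeet 0
    obtain ⟨w1, hw1, h1⟩ := hmeet 1
    apply hEinj 0 1 (by norm_num)
    have hm : ψ w1 ∈ E 0 := by
      rw [hEeq 0 _ h0]
      exact hsp.subset_connectedComponentIn ⟨w0, by simpa using hw0, rfl⟩ hsK
        ⟨w1, by simpa using hw1, rfl⟩
    rw [hEeq 0 _ hm, hEeq 1 _ h1]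
  -- the free neighbourhood
  obtain ⟨δ, hδ, hδ1, hfree⟩ : ∃ δ : ℝ, 0 < δ ∧ δ ≤ 1 ∧ ∀ r θ : ℝ, 1 ≤ r → r ≤ 1 + δ → |θ| ≤ δ →
      ψ (p * ((r : ℝ) * Complex.exp (θ * Complex.I))) ∉ K := by
    let h : ℝ × ℝ → S := fun a => ψ (p * ((a.1 : ℝ) * Complex.exp (a.2 * Complex.I)))
    have hh : Continuous h := hψ.continuous.comp (by fun_prop)
    have : h ⁻¹' Kᶜ ∈ 𝓝 ((1 : ℝ), (0 : ℝ)) :=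
      (hK.isClosed.isOpen_compl.preimage hh).mem_nhds (by simpa [h] using hpK)
    obtain ⟨ε, hε, hεK⟩ := Metric.mem_nhds_iff.1 this
    refine ⟨min (ε / 2) 1, by positivity, min_le_right _ _, fun r θ h1 h2 h3 => ?_⟩
    have hm := min_le_left (ε / 2) 1
    refine hεK (?_ : (r, θ) ∈ ball ((1 : ℝ), (0 : ℝ)) ε)
    rw [mem_ball, Prod.dist_eq, max_lt_iff]
    simp only [Real.dist_eq, sub_zero]
    refine ⟨?_, by linarith⟩
    rw [abs_of_nonneg (by linarith)]
    linarith
  have hq : ‖-p‖ = 1 := by rwa [norm_neg]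
  let φ : unitInterval × unitInterval → S := fun a => ψ (sector (-p) δ a)
  have hφc : Continuous φ := hψ.continuous.comp (sector_continuous _ _)
  have hφi : Function.Injective φ := hψ.injective.comp (sector_injective hq hδ hδ1)
  have hφ : IsEmbedding φ := (hφc.isClosedEmbedding hφi).isEmbedding
  have hsidesK : ∀ a : unitInterval × unitInterval, a.1 = 0 ∨ a.1 = 1 → φ a ∉ K := by
    intro a ha
    obtain ⟨θ, hθ, h⟩ := sector_sides (q := -p) hδ a ha
    simp only [φ, h, neg_neg]
    exact hfree _ _ (by nlinarith [a.2.2.1]) (by nlinarith [a.2.2.2]) hθ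
  have hrange : ∀ w : ℂ, 1 ≤ ‖w‖ → ‖w‖ ≤ 1 + δ → ψ w ∈ K → ∃ a, sector (-p) δ a = w := by
    intro w h1 h2 hwK
    rcases sector_cover hq hδ hδ1 h1 h2 with h | ⟨θ, hθ, h⟩
    · exact h
    · rw [neg_neg] at h
      exact absurd (h ▸ hwK) (hfree _ _ h1 h2 hθ)
  have hrD : range φ ⊆ D := by
    rintro _ ⟨a, rfl⟩
    refine ⟨_, ?_, rfl⟩
    rw [mem_closedBall, dist_zero_right, sector_norm hq hδ]
    nlinarith [a.2.2.2]
  -- the pieces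
  have hM : ∀ n, ∃ M ⊆ E n ∩ ψ '' (closedBall 0 (1 + δ) \ ball 0 1), IsPreconnected M ∧
      (M ∩ ψ '' closedBall 0 1).Nonempty ∧ (M ∩ (ψ '' ball 0 (1 + δ))ᶜ).Nonempty := by
    intro n
    refine bump (hEc n) (hEp n) (hcl 1) (hop _)
      (((isCompact_closedBall 0 _).diff isOpen_ball).image hψ.continuous).isClosed ?_ ?_ (hE1 n)
      ((hE2 n).mono (inter_subset_inter_right _ (compl_subset_compl.2
            (image_mono (ball_subset_ball (by linarith))))))
    · intro x _
      by_cases h : x ∈ ψ '' ball 0 (1 + δ)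
      · left
        obtain ⟨w, hw, rfl⟩ := h
        by_cases h1 : w ∈ closedBall (0 : ℂ) 1
        · exact Or.inl ⟨w, h1, rfl⟩
        · exact Or.inr ⟨w, ⟨ball_subset_closedBall hw, fun h2 => h1 (ball_subset_closedBall h2)⟩, rfl⟩
      · exact Or.inr h
    · rintro _ _ ⟨w, hw, rfl⟩ h
      exact h ⟨w, closedBall_subset_ball (by linarith) hw, rfl⟩
  choose M hMs hMp hM1 hM2 using hM
  have hMG : ∀ n, M n ⊆ K ∩ range φ := by
    intro n x hx
    obtain ⟨hxE, w, ⟨hw1, hw2⟩, rfl⟩ := hMs n hx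
    have hxK := (hEs n hxE).1
    obtain ⟨a, ha⟩ := hrange w (by simpa using hw2) (by simpa using hw1) hxK
    exact ⟨hxK, a, by simp [φ, ha]⟩
  choose z hzM hzP using hM1
  have hMI1 : ∀ n, z n ∈ φ '' {q | q.2 = 0} := by
    intro n
    obtain ⟨hxK, a, ha⟩ := hMG n (hzM n)
    refine ⟨a, ?_, ha⟩
    obtain ⟨w, hw, hwz⟩ := hzP n
    have : sector (-p) δ a = w := hψ.injective (ha.trans hwz.symm)
    have hn := sector_norm hq hδ a
    rw [this] at hn
    have hw' : ‖w‖ ≤ 1 := by simpa using hw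
    apply Subtype.ext
    have h1 : δ * (a.2 : ℝ) ≤ 0 := by linarith
    have h2 : (a.2 : ℝ) ≤ 0 := by
      by_contra! h3
      linarith [mul_pos hδ h3]
    exact le_antisymm h2 a.2.2.1
  have hMI2 : ∀ n, (M n ∩ φ '' {q | q.2 = 1}).Nonempty := by
    intro n
    obtain ⟨x, hxM, hx2⟩ := hM2 n
    refine ⟨x, hxM, ?_⟩
    obtain ⟨hxK, a, ha⟩ := hMG n hxM
    refine ⟨a, ?_, ha⟩
    have hn := sector_norm hq hδ a
    have hge : 1 + δ ≤ ‖sector (-p) δ a‖ := by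
      by_contra! h3
      exact hx2 ⟨_, by simpa using h3, ha⟩
    apply Subtype.ext
    refine le_antisymm a.2.2.2 ?_
    by_contra! h3
    change (a.2 : ℝ) < 1 at h3
    nlinarith
  set G := K ∩ range φ with hG
  have hGc : IsCompact G := hK.inter_right (isCompact_range hφc).isClosed
  have hzG : ∀ n, z n ∈ G := fun n => hMG n (hzM n)
  let Q : ℕ → Set S := fun n => connectedComponentIn G (z n)
  have hMQ : ∀ n, M n ⊆ Q n := fun n => (hMp n).subset_connectedComponentIn (hzM n) (hMG n)
  have hzE : ∀ n, z n ∈ E n := fun n => (hMs n (hzM n)).1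
  have hQE : ∀ n, Q n ⊆ E n := by
    intro n
    rw [hEeq n _ (hzE n)]
    exact connectedComponentIn_mono _ (inter_subset_inter_right _ hrD)
  have hQinj : ∀ m n, m ≠ n → Q m ≠ Q n := by
    intro m n hmn h
    apply hEinj m n hmn
    have : z m ∈ E n := hQE n (h ▸ mem_connectedComponentIn (hzG m))
    rw [hEeq m _ (hzE m), hEeq n _ this]
  have hQcon : ∀ n, IsConnected (Q n) := fun n => isConnected_connectedComponentIn_iff.2 (hzG n)
  obtain ⟨L, hLc, hLcon, τ, hτ, hlim⟩ := exists_subseq_hausdorff Q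
    (fun n => isCompact_connectedComponentIn' hGc _) hQcon
  have hI : ∀ c : unitInterval, IsClosed (φ '' {q | q.2 = c}) := fun c =>
    ((isClosed_eq continuous_snd continuous_const).isCompact.image hφc).isClosed
  have hQI1 : ∀ n, (Q n ∩ φ '' {q | q.2 = 0}).Nonempty := fun n =>
    ⟨z n, hMQ n (hzM n), hMI1 n⟩
  have hQI2 : ∀ n, (Q n ∩ φ '' {q | q.2 = 1}).Nonempty := fun n =>
    (hMI2 n).mono (inter_subset_inter_left _ (hMQ n))
  obtain ⟨x, hxL, hx⟩ := hausdorff_limit_meets (fun n => (hQcon (τ n)).nonempty) hLcon.nonempty hLc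
    hlim (hI 0) (fun n => hQI1 (τ n))
  obtain ⟨y, hyL, hy⟩ := hausdorff_limit_meets (fun n => (hQcon (τ n)).nonempty) hLcon.nonempty hLc
    hlim (hI 1) (fun n => hQI2 (τ n))
  have hLK : L ⊆ K := hausdorff_limit_subset (fun n => (hQcon (τ n)).nonempty) hlim hK.isClosed
    (fun n => (connectedComponentIn_subset _ _).trans inter_subset_left)
  refine ⟨(x, y), ⟨hLK hxL, hLK hyL, Or.inr ⟨φ, hφ, hx, hy, ?_, fun n => Q (τ n),
    fun m n hmn => hQinj _ _ (hτ.injective.ne hmn), fun n => ⟨z (τ n), hzG _, rfl⟩,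
    fun n => ⟨hQI1 _, hQI2 _⟩, L, hLc, hLcon, hlim, hxL, hyL⟩⟩, ?_⟩
  · rintro _ ⟨hK', a, ha, rfl⟩
    rcases ha with h | h | h | h
    · exact absurd hK' (hsidesK a (Or.inl h))
    · exact absurd hK' (hsidesK a (Or.inr h))
    · exact Or.inl ⟨a, h, rfl⟩
    · exact Or.inr ⟨a, h, rfl⟩
  · intro hxy
    obtain rfl : x = y := hxy
    obtain ⟨a, ha, hax⟩ := hx
    obtain ⟨b, hb, hbx⟩ := hy
    have hab := hφi (hax.trans hbx.symm)
    subst hab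
    exact zero_ne_one ((ha : a.2 = 0).symm.trans hb)

lemma rel_of_infinite {S : Type*} [MetricSpace S] [CompactSpace S] {K : Set S} (hK : IsCompact K)
    (ψ : ℂ → S) (hψ : IsOpenEmbedding ψ) (T : Set (Set S)) (hT : T.Infinite)
    (hTE : ∀ E ∈ T, ∃ z ∈ K, z ∈ ψ '' closedBall 0 1 ∧
      E = connectedComponentIn (K ∩ ψ '' closedBall 0 2) z ∧
      ¬ connectedComponentIn K z ⊆ ψ '' ball 0 2) :
    ∃ p ∈ schonfliesRel K, p.1 ≠ p.2 := by
  let e := hT.natEmbedding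
  have h12 : ψ '' closedBall 0 1 ⊆ ψ '' closedBall 0 2 :=
    image_mono (closedBall_subset_closedBall (by norm_num))
  have hcl : ∀ r, IsClosed (ψ '' closedBall 0 r) := fun r =>
    ((isCompact_closedBall 0 r).image hψ.continuous).isClosed
  refine rel_of_crossing hK ψ hψ (fun n => (e n : Set S)) ?_ ?_ ?_ ?_
  · intro n
    obtain ⟨z, hz, hz1, hE, -⟩ := hTE _ (e n).2
    exact ⟨z, ⟨hz, h12 hz1⟩, hE⟩
  · intro m n hmn h
    exact hmn (e.injective (Subtype.ext h))
  · intro n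
    obtain ⟨z, hz, hz1, hE, -⟩ := hTE _ (e n).2
    refine ⟨z, ?_, hz1⟩
    rw [hE]
    exact mem_connectedComponentIn ⟨hz, h12 hz1⟩
  · intro n
    obtain ⟨z, hz, hz1, hE, hnot⟩ := hTE _ (e n).2
    have hzb : z ∈ ψ '' ball 0 2 := image_mono (closedBall_subset_ball (by norm_num)) hz1
    obtain ⟨y, hy, hyb⟩ := not_subset.1 hnot
    obtain ⟨M, hMs, hMp, ⟨a, haM, haz⟩, ⟨b, hbM, hb⟩⟩ := bump (C := connectedComponentIn K z)
      (P := {z}) (Q := (ψ '' ball 0 2)ᶜ) (A := ψ '' closedBall 0 2)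
      (isCompact_connectedComponentIn' hK z) isPreconnected_connectedComponentIn
      isClosed_singleton (hψ.isOpenMap _ isOpen_ball).isClosed_compl (hcl 2)
      (by
        intro x _
        by_cases h : x ∈ ψ '' ball 0 2
        · exact Or.inl (Or.inr (image_mono ball_subset_closedBall h))
        · exact Or.inr h)
      (by
        rintro x _ rfl h
        exact h hzb)
      ⟨z, mem_connectedComponentIn hz, rfl⟩ ⟨y, hy, hyb⟩
    obtain rfl : a = z := haz
    refine ⟨b, ?_, hb⟩
    rw [hE]
    exact hMp.subset_connectedComponentIn haM
      (hMs.trans (inter_subset_inter_left _ (connectedComponentIn_subset _ _))) hbM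

lemma finite_of_trivial {S : Type*} [MetricSpace S] [CompactSpace S]
    (hS : IsSurfaceLocallyEuclidean S) {K : Set S} (hK : IsCompact K)
    (htriv : ∀ p ∈ schonfliesRel K, p.1 = p.2) (ε : ℝ) (hε : 0 < ε) :
    {C : Set S | (∃ x ∈ K, C = connectedComponentIn K x) ∧ ε < Metric.diam C}.Finite := by
  by_contra hinf
  let e := Set.Infinite.natEmbedding _ hinf
  have he : ∀ n, ∃ x ∈ K, (e n : Set S) = connectedComponentIn K x := fun n => (e n).2.1
  choose x hxK hx using he
  obtain ⟨a, haK, τ, hτ, hlim⟩ := hK.tendsto_subseq hxK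
  obtain ⟨ψ, hψ, h0, hsub⟩ := exists_chart hS a (ball a (ε / 2)) (ball_mem_nhds _ (by positivity))
  have hev : ∀ᶠ n in atTop, x (τ n) ∈ ψ '' ball 0 1 :=
    hlim ((hψ.isOpenMap _ isOpen_ball).mem_nhds ⟨0, by simp, h0⟩)
  obtain ⟨N, hN⟩ := eventually_atTop.1 hev
  have h12 : ψ '' ball 0 1 ⊆ ψ '' closedBall 0 2 :=
    image_mono (ball_subset_closedBall.trans (closedBall_subset_closedBall (by norm_num)))
  obtain ⟨p, hp, hne⟩ := rel_of_infinite hK ψ hψ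
    (range fun n => connectedComponentIn (K ∩ ψ '' closedBall 0 2) (x (τ (n + N)))) (by
      apply Set.infinite_range_of_injective
      intro m n hmn
      have hm : x (τ (m + N)) ∈ connectedComponentIn (K ∩ ψ '' closedBall 0 2) (x (τ (n + N))) := by
        have hmn' : connectedComponentIn (K ∩ ψ '' closedBall 0 2) (x (τ (m + N))) =
          connectedComponentIn (K ∩ ψ '' closedBall 0 2) (x (τ (n + N))) := hmn
        rw [← hmn']
        exact mem_connectedComponentIn ⟨hxK _, h12 (hN _ (by omega))⟩
      have hm' := connectedComponentIn_mono _ inter_subset_left hm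
      have h1 := connectedComponentIn_eq hm'
      rw [← hx, ← hx] at h1
      have h2 := hτ.injective (e.injective (Subtype.ext h1))
      omega) (by
      rintro _ ⟨n, rfl⟩
      refine ⟨_, hxK _, image_mono ball_subset_closedBall (hN (n + N) (by omega)), rfl, ?_⟩
      intro hs
      have hd := (e (τ (n + N))).2.2
      rw [hx] at hd
      have h1 : Metric.diam (connectedComponentIn K (x (τ (n + N)))) ≤ Metric.diam (ball a (ε / 2)) :=
        Metric.diam_mono (hs.trans ((image_mono ball_subset_closedBall).trans hsub)) isBounded_ball
      have h2 := Metric.diam_ball (x := a) (r := ε / 2) (by positivity)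
      linarith)
  exact hne (htriv p hp)

lemma locallyConnected_of_trivial {S : Type*} [MetricSpace S] [CompactSpace S]
    (hS : IsSurfaceLocallyEuclidean S) {K : Set S} (hK : IsCompact K)
    (htriv : ∀ p ∈ schonfliesRel K, p.1 = p.2) (c : S) :
    LocallyConnectedSpace (connectedComponentIn K c) := by
  rw [locallyConnectedSpace_iff_connectedComponentIn_open]
  intro F hF y hy
  by_contra hno
  rw [isOpen_iff_mem_nhds] at hno
  push Not at hno
  obtain ⟨a, ha, hna⟩ := hno
  have haF : a ∈ F := connectedComponentIn_subset _ _ ha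
  obtain ⟨W, hW, rfl⟩ := isOpen_induced_iff.1 hF
  obtain ⟨ψ, hψ, h0, hsub⟩ := exists_chart hS (a : S) W (hW.mem_nhds haF)
  set D := ψ '' closedBall 0 2 with hD
  have hDcl : IsClosed D := ((isCompact_closedBall 0 2).image hψ.continuous).isClosed
  have hcK : connectedComponentIn K c ⊆ K := connectedComponentIn_subset _ _
  have hcEq : ∀ b ∈ connectedComponentIn K c,
      connectedComponentIn K c = connectedComponentIn K b := fun b hb => connectedComponentIn_eq hb
  have haD : (a : S) ∈ D := ⟨0, by simp, h0⟩
  -- key claim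
  have key : ∀ b : connectedComponentIn K c, (b : S) ∈ D →
      (a : S) ∈ connectedComponentIn (K ∩ D) b →
      b ∈ connectedComponentIn (Subtype.val ⁻¹' W) y := by
    intro b hbD hab
    set N := connectedComponentIn (K ∩ D) (b : S) with hN
    have hbN : (b : S) ∈ N := mem_connectedComponentIn ⟨hcK b.2, hbD⟩
    have hNc : N ⊆ connectedComponentIn K c := by
      rw [hcEq b b.2]
      exact connectedComponentIn_mono _ inter_subset_left
    have hpre : IsPreconnected (Subtype.val ⁻¹' N : Set (connectedComponentIn K c)) := by
      rw [← IsInducing.subtypeVal.isPreconnected_image, image_preimage_eq_of_subset (by simpa using hNc)]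
      exact isPreconnected_connectedComponentIn
    rw [connectedComponentIn_eq ha]
    exact hpre.subset_connectedComponentIn hab
      (preimage_mono ((connectedComponentIn_subset _ _).trans (inter_subset_right.trans hsub))) hbN
  have hacl : a ∈ closure (connectedComponentIn (Subtype.val ⁻¹' W) y)ᶜ := by
    rw [closure_compl, mem_compl_iff, mem_interior_iff_mem_nhds]
    exact hna
  obtain ⟨b, hb, hlim⟩ := mem_closure_iff_seq_limit.1 hacl
  have hlim' : Tendsto (fun n => (b n : S)) atTop (𝓝 (a : S)) :=
    (continuous_subtype_val.tendsto a).comp hlim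
  have hev : ∀ᶠ n in atTop, (b n : S) ∈ ψ '' ball 0 1 :=
    hlim' ((hψ.isOpenMap _ isOpen_ball).mem_nhds ⟨0, by simp, h0⟩)
  obtain ⟨N, hN⟩ := eventually_atTop.1 hev
  have h12 : ψ '' ball 0 1 ⊆ D :=
    image_mono (ball_subset_closedBall.trans (closedBall_subset_closedBall (by norm_num)))
  have hanE : ∀ n, (a : S) ∉ connectedComponentIn (K ∩ D) (b (n + N)) := fun n h =>
    hb (n + N) (key _ (h12 (hN _ (by omega))) h)
  obtain ⟨p, hp, hne⟩ := rel_of_infinite hK ψ hψ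
    (range fun n => connectedComponentIn (K ∩ D) (b (n + N) : S)) (by
      intro hfin
      have hclosed : IsClosed (⋃₀ (range fun n => connectedComponentIn (K ∩ D) (b (n + N) : S))) := by
        have hfin' : (range fun n => connectedComponentIn (K ∩ D) (b (n + N) : S)).Finite := hfin
        rw [sUnion_eq_biUnion]
        refine Set.Finite.isClosed_biUnion hfin' ?_
        rintro _ ⟨n, rfl⟩
        exact (isCompact_connectedComponentIn' (hK.inter_right hDcl) _).isClosed
      have hmem : (a : S) ∈ ⋃₀ (range fun n => connectedComponentIn (K ∩ D) (b (n + N) : S)) := by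
        refine hclosed.mem_of_tendsto ((tendsto_add_atTop_iff_nat N).2 hlim')
          (Eventually.of_forall fun n => ?_)
        exact ⟨_, ⟨n, rfl⟩, mem_connectedComponentIn ⟨hcK (b (n + N)).2, h12 (hN _ (by omega))⟩⟩
      obtain ⟨_, ⟨n, rfl⟩, h⟩ := hmem
      exact hanE n h) (by
      rintro _ ⟨n, rfl⟩
      refine ⟨_, hcK (b (n + N)).2, image_mono ball_subset_closedBall (hN (n + N) (by omega)),
        rfl, ?_⟩
      intro hs
      apply hanE n
      rw [← hcEq _ (b (n + N)).2] at hs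
      exact isPreconnected_connectedComponentIn.subset_connectedComponentIn (b (n + N)).2
        (subset_inter hcK (hs.trans (image_mono ball_subset_closedBall))) a.2)
  exact hne (htriv p hp)

lemma range_mem_nhds {S : Type*} [TopologicalSpace S]
    (hS : IsSurfaceLocallyEuclidean S) (φ : unitInterval × unitInterval → S)
    (hφ : Continuous φ) (hinj : Function.Injective φ) (q : unitInterval × unitInterval)
    (h10 : (0 : ℝ) < q.1) (h11 : (q.1 : ℝ) < 1) (h20 : (0 : ℝ) < q.2) (h21 : (q.2 : ℝ) < 1) :
    range φ ∈ 𝓝 (φ q) := by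
  obtain ⟨ψ, hψ, h0, -⟩ := exists_chart hS (φ q) univ univ_mem
  have hz01 : (0 : ℝ) ≤ 1 := zero_le_one
  let g : ℝ → ℂ → unitInterval × unitInterval := fun r w =>
    (projIcc 0 1 hz01 (q.1 + r * w.re), projIcc 0 1 hz01 (q.2 + r * w.im))
  have hgc : ∀ r, Continuous (g r) := fun r => by
    have h1 : Continuous (projIcc (0 : ℝ) 1 hz01) := continuous_projIcc
    exact (h1.comp (by fun_prop)).prodMk (h1.comp (by fun_prop))
  have hg0 : ∀ r, g r 0 = q := fun r => by
    simp [g]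
  -- choose the radius
  have hU : φ ⁻¹' (range ψ) ∈ 𝓝 q :=
    hφ.continuousAt.preimage_mem_nhds (hψ.isOpen_range.mem_nhds ⟨0, h0⟩)
  obtain ⟨ε, hε, hεU⟩ := Metric.mem_nhds_iff.1 hU
  obtain ⟨r, hr, hr1, hr2, hr3, hr4, hr5⟩ : ∃ r : ℝ, 0 < r ∧ r < q.1 ∧ r < 1 - q.1 ∧ r < q.2 ∧
      r < 1 - q.2 ∧ r < ε := by
    refine ⟨min (min (min (q.1 : ℝ) (1 - q.1)) (min (q.2 : ℝ) (1 - q.2))) ε / 2, ?_, ?_⟩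
    · have : 0 < min (min (min (q.1 : ℝ) (1 - q.1)) (min (q.2 : ℝ) (1 - q.2))) ε := by
        simp only [lt_min_iff]
        refine ⟨⟨⟨?_, ?_⟩, ?_, ?_⟩, ?_⟩ <;> linarith
      linarith
    · have hpos : 0 < min (min (min (q.1 : ℝ) (1 - q.1)) (min (q.2 : ℝ) (1 - q.2))) ε := by
        simp only [lt_min_iff]
        refine ⟨⟨⟨?_, ?_⟩, ?_, ?_⟩, ?_⟩ <;> linarith
      have hle := le_refl (min (min (min (q.1 : ℝ) (1 - q.1)) (min (q.2 : ℝ) (1 - q.2))) ε)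
      obtain ⟨⟨⟨h1, h2⟩, h3, h4⟩, h5⟩ : ((_ ∧ _) ∧ _ ∧ _) ∧ _ := by
        simpa only [le_min_iff] using hle
      refine ⟨?_, ?_, ?_, ?_, ?_⟩ <;> linarith
  have habs : ∀ w ∈ closedBall (0 : ℂ) 1, |w.re| ≤ 1 ∧ |w.im| ≤ 1 := fun w hw => by
    have : ‖w‖ ≤ 1 := by simpa using hw
    exact ⟨(Complex.abs_re_le_norm w).trans this, (Complex.abs_im_le_norm w).trans this⟩
  have hg1 : ∀ w ∈ closedBall (0 : ℂ) 1, ((g r w).1 : ℝ) = q.1 + r * w.re := fun w hw => by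
    have h := abs_le.1 (habs w hw).1
    simp only [g]
    rw [projIcc_of_mem hz01 ⟨by nlinarith, by nlinarith⟩]
  have hg2 : ∀ w ∈ closedBall (0 : ℂ) 1, ((g r w).2 : ℝ) = q.2 + r * w.im := fun w hw => by
    have h := abs_le.1 (habs w hw).2
    simp only [g]
    rw [projIcc_of_mem hz01 ⟨by nlinarith, by nlinarith⟩]
  have hgU : ∀ w ∈ closedBall (0 : ℂ) 1, φ (g r w) ∈ range ψ := by
    intro w hw
    refine hεU (?_ : g r w ∈ ball q ε)
    have h := habs w hw
    rw [mem_ball, Prod.dist_eq, max_lt_iff, Subtype.dist_eq, Subtype.dist_eq, hg1 w hw, hg2 w hw,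
      Real.dist_eq, Real.dist_eq, add_sub_cancel_left, add_sub_cancel_left, abs_mul, abs_mul,
      abs_of_pos hr]
    constructor <;> nlinarith
  let f : ℂ → ℂ := fun w => Function.invFun ψ (φ (g r w))
  have hψf : ∀ w ∈ closedBall (0 : ℂ) 1, ψ (f w) = φ (g r w) := fun w hw =>
    Function.invFun_eq (hgU w hw)
  have hfc : ContinuousOn f (closedBall 0 1) := by
    rw [hψ.isInducing.continuousOn_iff]
    refine ContinuousOn.congr (f := fun w => φ (g r w)) (hφ.comp (hgc r)).continuousOn ?_
    exact hψf
  have hfi : InjOn f (closedBall 0 1) := by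
    intro w hw w' hw' h
    have h1 : g r w = g r w' := hinj (by rw [← hψf w hw, ← hψf w' hw', h])
    apply Complex.ext
    · have := congrArg (fun a : unitInterval × unitInterval => (a.1 : ℝ)) h1
      simp only [hg1 w hw, hg1 w' hw'] at this
      exact mul_left_cancel₀ hr.ne' (add_left_cancel this)
    · have := congrArg (fun a : unitInterval × unitInterval => (a.2 : ℝ)) h1
      simp only [hg2 w hw, hg2 w' hw'] at this
      exact mul_left_cancel₀ hr.ne' (add_left_cancel this)
  have hinv := invariance_of_domain_plane f hfc hfi
  have h0m : (0 : ℂ) ∈ closedBall (0 : ℂ) 1 := by simp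
  have himg := hψ.isOpenMap.image_mem_nhds hinv
  rw [hψf 0 h0m, hg0] at himg
  refine Filter.mem_of_superset himg ?_
  rintro _ ⟨_, ⟨w, hw, rfl⟩, rfl⟩
  rw [hψf w hw]
  exact mem_range_self _

lemma trivial_of_peano {S : Type*} [MetricSpace S] [CompactSpace S]
    (hS : IsSurfaceLocallyEuclidean S) {K : Set S} (hP : IsPeanoCompactumSet K) :
    ∀ p ∈ schonfliesRel K, p.1 = p.2 := by
  rintro ⟨x, y⟩ ⟨hxK, hyK, h⟩
  by_contra hne
  rcases h with h | ⟨φ, hφ, hx, hy, hbd, Q, hQne, hQ, hQI, L, hLc, hLcon, hlim, hxL, hyL⟩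
  · exact hne h
  simp only at hx hy hxL hyL hne
  obtain ⟨hK, hlc, hfin⟩ := hP
  have hφc := hφ.continuous
  have hφi := hφ.injective
  have hI : ∀ c : unitInterval, IsCompact (φ '' {q | q.2 = c}) := fun c =>
    (isClosed_eq continuous_snd continuous_const).isCompact.image hφc
  set G := K ∩ range φ with hG
  have hGcl : IsClosed G := hK.isClosed.inter (isCompact_range hφc).isClosed
  choose z hzG hQz using hQ
  have hQne' : ∀ n, (Q n).Nonempty := fun n => (hQI n).1.mono inter_subset_left
  have hQG : ∀ n, Q n ⊆ G := fun n => by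
    rw [hQz]; exact connectedComponentIn_subset _ _
  have hLG : L ⊆ G := hausdorff_limit_subset hQne' hlim hGcl hQG
  have hQC : ∀ n, Q n ⊆ connectedComponentIn K (z n) := fun n => by
    rw [hQz]; exact connectedComponentIn_mono _ inter_subset_left
  -- all the components are large
  have hdisj : Disjoint (φ '' {q | q.2 = 0}) (φ '' {q | q.2 = 1}) := by
    rw [Set.disjoint_left]
    rintro _ ⟨a, ha, rfl⟩ ⟨b, hb, hab⟩
    obtain rfl := hφi hab
    exact zero_ne_one ((ha : b.2 = 0).symm.trans hb)
  obtain ⟨δ, hδ, hdt⟩ := hdisj.exists_thickenings (hI 0) (hI 1).isClosed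
  have hbig : ∀ n, δ / 2 < Metric.diam (connectedComponentIn K (z n)) := by
    intro n
    obtain ⟨⟨a, haQ, haI⟩, ⟨b, hbQ, hbI⟩⟩ := hQI n
    have hd : δ ≤ dist a b := by
      by_contra! hlt
      refine Set.disjoint_left.1 hdt (mem_thickening_iff.2 ⟨a, haI, ?_⟩)
        (self_subset_thickening hδ _ hbI)
      rwa [dist_comm]
    have := Metric.dist_le_diam_of_mem (isCompact_univ.isBounded.subset (subset_univ _))
      (hQC n haQ) (hQC n hbQ)
    linarith
  obtain ⟨C, ⟨⟨c, hcK, hCc⟩, -⟩, hfreq⟩ : ∃ C ∈ {C : Set S | (∃ x ∈ K, C = connectedComponentIn K x) ∧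
      δ / 2 < Metric.diam C}, ∃ᶠ n in atTop, connectedComponentIn K (z n) = C := by
    by_contra! hcon
    have h1 : ∀ᶠ n in atTop, ∀ C ∈ {C : Set S | (∃ x ∈ K, C = connectedComponentIn K x) ∧
      δ / 2 < Metric.diam C}, connectedComponentIn K (z n) ≠ C := by
      rw [Filter.eventually_all_finite (hfin (δ / 2) (by positivity))]
      exact fun C hC => hcon C hC
    obtain ⟨n, hn⟩ := h1.exists
    exact hn _ ⟨⟨z n, (hzG n).1, rfl⟩, hbig n⟩ rfl
  subst hCc
  have hCcl : IsClosed (connectedComponentIn K c) := (isCompact_connectedComponentIn' hK c).isClosed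
  have hfreq' : ∃ᶠ n in atTop, Q n ⊆ connectedComponentIn K c :=
    hfreq.mono fun n hn => hn ▸ hQC n
  -- a middle point of the limit
  let half : unitInterval := ⟨1 / 2, by norm_num, by norm_num⟩
  obtain ⟨q, hqL, hq2⟩ : ∃ q, φ q ∈ L ∧ q.2 = half := by
    have hpre : IsPreconnected (φ ⁻¹' L) := by
      rw [← hφ.isInducing.isPreconnected_image,
        image_preimage_eq_of_subset (hLG.trans inter_subset_right)]
      exact hLcon.isPreconnected
    have hpre2 := hpre.image Prod.snd continuous_snd.continuousOn
    obtain ⟨a, ha, rfl⟩ := hx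
    obtain ⟨b, hb, rfl⟩ := hy
    have := hpre2.Icc_subset (a := 0) (b := 1) ⟨a, hxL, ha⟩ ⟨b, hyL, hb⟩
      (show half ∈ Icc 0 1 from ⟨half.2.1, half.2.2⟩)
    obtain ⟨q, hq, hq2⟩ := this
    exact ⟨q, hq, hq2⟩
  have hqside : ¬ (q.1 = 0 ∨ q.1 = 1) := by
    intro h
    have hne0 : half ≠ 0 := fun h => by
      have := congrArg Subtype.val h
      norm_num [half] at this
    have hne1 : half ≠ 1 := fun h => by
      have := congrArg Subtype.val h
      norm_num [half] at this
    rcases hbd ⟨(hLG hqL).1, q, by rcases h with h | h <;> simp [h], rfl⟩ with ⟨a, ha, haq⟩ | ⟨a, ha, haq⟩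
    · obtain rfl := hφi haq
      exact hne0 (hq2.symm.trans ha)
    · obtain rfl := hφi haq
      exact hne1 (hq2.symm.trans ha)
  push Not at hqside
  have hnhds : range φ ∈ 𝓝 (φ q) := by
    apply range_mem_nhds hS φ hφc hφi q
    · exact lt_of_le_of_ne q.1.2.1 fun h => hqside.1 (Subtype.ext h.symm)
    · exact lt_of_le_of_ne q.1.2.2 fun h => hqside.2 (Subtype.ext h)
    · rw [hq2]; norm_num [half]
    · rw [hq2]; norm_num [half]
  have hqC : φ q ∈ connectedComponentIn K c := by
    rw [← hCcl.closure_eq, mem_closure_iff_nhds]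
    intro U hU
    obtain ⟨n, hn, y', hy', hyU⟩ := (hfreq'.and_eventually
      (hausdorff_limit_near hQne' hlim hqL hU)).exists
    exact ⟨y', hyU, hn hy'⟩
  have := hlc c hcK
  have hF : (Subtype.val ⁻¹' range φ : Set (connectedComponentIn K c)) ∈
      𝓝 (⟨φ q, hqC⟩ : connectedComponentIn K c) :=
    continuous_subtype_val.continuousAt.preimage_mem_nhds hnhds
  have hN0 := connectedComponentIn_mem_nhds hF
  set N0 := connectedComponentIn (Subtype.val ⁻¹' range φ : Set (connectedComponentIn K c))
    ⟨φ q, hqC⟩ with hN0def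
  obtain ⟨U, hU, hUN⟩ := mem_nhds_subtype _ _ _ |>.1 hN0
  have hNpre : IsPreconnected (Subtype.val '' N0) :=
    isPreconnected_connectedComponentIn.image _ continuous_subtype_val.continuousOn
  have hNG : Subtype.val '' N0 ⊆ G := by
    rintro _ ⟨w, hw, rfl⟩
    have hw' : w ∈ (Subtype.val ⁻¹' range φ : Set (connectedComponentIn K c)) :=
      connectedComponentIn_subset _ _ hw
    exact ⟨connectedComponentIn_subset _ _ w.2, hw'⟩
  have hqN : φ q ∈ Subtype.val '' N0 :=
    ⟨⟨φ q, hqC⟩, mem_connectedComponentIn (mem_range_self q), rfl⟩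
  have hall : ∃ᶠ n in atTop, Q n = connectedComponentIn G (φ q) := by
    refine (hfreq'.and_eventually (hausdorff_limit_near hQne' hlim hqL hU)).mono ?_
    rintro n ⟨hn, w, hwQ, hwU⟩
    have hwN : w ∈ Subtype.val '' N0 := ⟨⟨w, hn hwQ⟩, hUN hwU, rfl⟩
    have h1 : w ∈ connectedComponentIn G (φ q) := hNpre.subset_connectedComponentIn hqN hNG hwN
    rw [hQz n] at hwQ ⊢
    rw [connectedComponentIn_eq hwQ, connectedComponentIn_eq h1]
  obtain ⟨n, hn⟩ := hall.exists
  obtain ⟨m, hm, hm'⟩ := frequently_atTop'.1 hall n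
  exact hQne m n (ne_of_gt hm) (hm'.trans hn.symm)
/-- For a nonempty compact subset `K` of a closed surface `S`, the
following are equivalent: (1) `K` with the restricted metric is a Peano compactum;
(2) every Schönflies class is a singleton; (3) the Schönflies relation is trivial. -/
theorem peanoCompactum_iff_trivial_schonflies
    {S : Type*} [MetricSpace S] [CompactSpace S] [ConnectedSpace S] [Nonempty S]
    (hS : IsSurfaceLocallyEuclidean S)
    (K : Set S) (hK : IsCompact K) (hKne : K.Nonempty) :
    (IsPeanoCompactumSet K ↔ ∀ x ∈ K, schonfliesClass K x = {x}) ∧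
    ((∀ x ∈ K, schonfliesClass K x = {x}) ↔
      schonfliesRel K = {p : S × S | p.1 ∈ K ∧ p.1 = p.2}) := by
  have h23 : (∀ x ∈ K, schonfliesClass K x = {x}) ↔
      schonfliesRel K = {p : S × S | p.1 ∈ K ∧ p.1 = p.2} := by
    constructor
    · intro h
      apply Subset.antisymm
      · rintro ⟨x, y⟩ hp
        refine ⟨hp.1, ?_⟩
        have hy : y ∈ schonfliesClass K x := fun E hE => hE.1 hp
        rw [h x hp.1] at hy
        exact (show y = x from hy).symm
      · rintro ⟨x, y⟩ ⟨hx, hxy⟩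
        obtain rfl : x = y := hxy
        exact ⟨hx, hx, Or.inl rfl⟩
    · intro h x hx
      apply Subset.antisymm
      · intro y hy
        have hE : {p : S × S | p.1 ∈ K ∧ p.1 = p.2} ∈ closedEquivsOn K (schonfliesRel K) := by
          refine ⟨h.subset, ?_, ?_, fun x hx => ⟨hx, rfl⟩, ?_, ?_⟩
          · rintro ⟨a, b⟩ ⟨ha, hab⟩
            obtain rfl : a = b := hab
            exact ⟨ha, ha⟩
          · exact (hK.isClosed.preimage continuous_fst).inter
              (isClosed_eq continuous_fst continuous_snd)
          · rintro a b ⟨ha, hab⟩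
            obtain rfl : a = b := hab
            exact ⟨ha, rfl⟩
          · rintro a b c ⟨ha, hab⟩ ⟨_, hbc⟩
            exact ⟨ha, (show a = b from hab).trans hbc⟩
        have hy' : (x, y) ∈ {p : S × S | p.1 ∈ K ∧ p.1 = p.2} := hy _ hE
        exact hy'.2.symm
      · rintro y hy
        obtain rfl : y = x := hy
        exact fun E hE => hE.2.2.2.1 _ hx
  refine ⟨?_, h23⟩
  rw [h23]
  constructor
  · intro hP
    apply Subset.antisymm
    · intro p hp
      exact ⟨hp.1, trivial_of_peano hS hP p hp⟩
    · rintro ⟨x, y⟩ ⟨hx, hxy⟩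
      obtain rfl : x = y := hxy
      exact ⟨hx, hx, Or.inl rfl⟩
  · intro h
    have htriv : ∀ p ∈ schonfliesRel K, p.1 = p.2 := fun p hp => (h.subset hp).2
    exact ⟨hK, fun x _ => locallyConnected_of_trivial hS hK htriv x,
      finite_of_trivial hS hK htriv⟩
end

section
/- Let K ⊆ [0,1]² ⊆ ℝ² be a compact set and let P₁, …, Pₙ (n ≥ 2) be pairwise distinct connected components of K, each of which intersects both I₀ = [0,1]×{0} and I₁ = [0,1]×{1}. Then there exist arcs α₁, …, α_{n−1} : [0,1] → [0,1]² \ K (continuous injective maps) with pairwise disjoint images, such that αᵢ(k) ∈ I_k for each k ∈ {0,1}, αᵢ((0,1)) ⊆ (0,1)², and any two distinct components Pᵢ and Pⱼ lie in different connected components of [0,1]² \ (α₁([0,1]) ∪ ⋯ ∪ α_{n−1}([0,1])). -/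
open Set Metric Filter Topology unitInterval


namespace SepArc

def emb (x : ℕ × ℕ) : ℝ × ℝ := ((x.1 : ℝ), (x.2 : ℝ))
def OnV (a b : ℕ) (z : ℝ × ℝ) : Prop := z.1 = a ∧ (b : ℝ) ≤ z.2 ∧ z.2 ≤ b + 1
def OnH (a b : ℕ) (z : ℝ × ℝ) : Prop := z.2 = b ∧ (a : ℝ) ≤ z.1 ∧ z.1 ≤ a + 1
def cell (a b : ℕ) : Set (ℝ × ℝ) := Icc (a : ℝ) (a + 1) ×ˢ Icc (b : ℝ) (b + 1)
noncomputable def idx (N : ℕ) (x : ℝ) : ℕ := min ⌊x⌋₊ (N - 1)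

lemma idx_lt {N : ℕ} (hN : 0 < N) (x : ℝ) : idx N x < N := by
  unfold idx; omega

lemma idx_mono (N : ℕ) {x y : ℝ} (h : x ≤ y) : idx N x ≤ idx N y := by
  unfold idx; exact min_le_min_right _ (Nat.floor_mono h)

lemma idx_mem {N : ℕ} (hN : 0 < N) {x : ℝ} (h0 : 0 ≤ x) (h1 : x ≤ N) :
    x ∈ Icc (idx N x : ℝ) (idx N x + 1) := by
  have h2 := Nat.floor_le h0
  have h3 := Nat.lt_floor_add_one x
  unfold idx
  rcases le_total ⌊x⌋₊ (N - 1) with h | h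
  · rw [min_eq_left h]; exact ⟨h2, h3.le⟩
  · rw [min_eq_right h]
    have h5 : ((N - 1 : ℕ) : ℝ) ≤ ⌊x⌋₊ := by exact_mod_cast h
    refine ⟨h5.trans h2, ?_⟩
    have : ((N - 1 : ℕ) : ℝ) + 1 = N := by exact_mod_cast (by omega : N - 1 + 1 = N)
    linarith

def col (V H : ℕ → ℕ → ZMod 2) (a b : ℕ) : ZMod 2 :=
  ∑ k ∈ Finset.range a, V (k + 1) b + ∑ j ∈ Finset.range b, H 0 (j + 1)

lemma col_left (V H : ℕ → ℕ → ZMod 2) (a b : ℕ) :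
    col V H (a + 1) b = col V H a b + V (a + 1) b := by
  unfold col; rw [Finset.sum_range_succ]; ring

lemma two0 : (2 : ZMod 2) = 0 := rfl

lemma col_right {N : ℕ} {V H : ℕ → ℕ → ZMod 2}
    (hpar : ∀ a b, a + 1 < N → b + 1 < N →
      V (a + 1) (b + 1) + V (a + 1) b + H (a + 1) (b + 1) + H a (b + 1) = 0)
    (a b : ℕ) (ha : a < N) (hb : b + 1 < N) :
    col V H a (b + 1) = col V H a b + H a (b + 1) := by
  induction a with
  | zero => unfold col; rw [Finset.sum_range_succ _ b]; simp
  | succ a ih =>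
    rw [col_left, col_left, ih (by omega)]
    linear_combination hpar a b ha hb - (V (a + 1) b + H (a + 1) (b + 1)) * two0

lemma col_const {N : ℕ} {V H : ℕ → ℕ → ZMod 2}
    (hpar : ∀ a b, a + 1 < N → b + 1 < N →
      V (a + 1) (b + 1) + V (a + 1) b + H (a + 1) (b + 1) + H a (b + 1) = 0)
    {S : Set (ℝ × ℝ)} (hS : IsPreconnected S) (hSQ : S ⊆ Icc 0 (N : ℝ) ×ˢ Icc 0 (N : ℝ))
    (hN : 0 < N)
    (hV : ∀ a b, a + 1 < N → b < N → V (a + 1) b ≠ 0 → ∀ z ∈ S, ¬ OnV (a + 1) b z)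
    (hH : ∀ a b, a < N → b + 1 < N → H a (b + 1) ≠ 0 → ∀ z ∈ S, ¬ OnH a (b + 1) z)
    {z z' : ℝ × ℝ} (hz : z ∈ S) (hz' : z' ∈ S) {a b a' b' : ℕ}
    (ha : a < N) (hb : b < N) (ha' : a' < N) (hb' : b' < N)
    (hc : z ∈ cell a b) (hc' : z' ∈ cell a' b') : col V H a b = col V H a' b' := by
  -- horizontal step
  have stepL : ∀ w ∈ S, ∀ a b, a + 1 < N → b < N → w ∈ cell a b → w ∈ cell (a + 1) b →
      col V H a b = col V H (a + 1) b := by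
    intro w hw a b ha hb h1 h2
    rw [col_left]
    by_contra hne
    refine hV a b ha hb (fun h => hne (by rw [h, add_zero])) w hw ⟨?_, h1.2.1, h1.2.2⟩
    have := h1.1.2; have := h2.1.1
    push_cast at *; linarith
  have stepR : ∀ w ∈ S, ∀ a b, a < N → b + 1 < N → w ∈ cell a b → w ∈ cell a (b + 1) →
      col V H a b = col V H a (b + 1) := by
    intro w hw a b ha hb h1 h2
    rw [col_right hpar a b ha hb]
    by_contra hne
    refine hH a b ha hb (fun h => hne (by rw [h, add_zero])) w hw ⟨?_, h1.1.1, h1.1.2⟩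
    have := h1.2.2; have := h2.2.1
    push_cast at *; linarith
  have near : ∀ (x : ℝ) (a a' : ℕ), x ∈ Icc (a : ℝ) (a + 1) → x ∈ Icc (a' : ℝ) (a' + 1) →
      a = a' ∨ a' = a + 1 ∨ a = a' + 1 := by
    intro x a a' h h'
    have h1 : (a : ℝ) ≤ a' + 1 := h.1.trans h'.2
    have h2 : (a' : ℝ) ≤ a + 1 := h'.1.trans h.2
    have h1 : a ≤ a' + 1 := by exact_mod_cast h1
    have h2 : a' ≤ a + 1 := by exact_mod_cast h2
    omega
  have same : ∀ w ∈ S, ∀ a b a' b', a < N → b < N → a' < N → b' < N → w ∈ cell a b →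
      w ∈ cell a' b' → col V H a b = col V H a' b' := by
    intro w hw a b a' b' ha hb ha' hb' h h'
    have hm : w ∈ cell a' b := ⟨h'.1, h.2⟩
    trans col V H a' b
    · rcases near w.1 a a' h.1 h'.1 with e | e | e
      · rw [e]
      · subst e; exact stepL w hw a b ha' hb h hm
      · subst e; exact (stepL w hw a' b ha hb hm h).symm
    · rcases near w.2 b b' h.2 h'.2 with e | e | e
      · rw [e]
      · subst e; exact stepR w hw a' b ha' hb' hm h'
      · subst e; exact (stepR w hw a' b' ha' hb h' hm).symm
  let F : Set (ZMod 2) → Set (ℝ × ℝ) := fun T =>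
    ⋃ q ∈ {q : Fin N × Fin N | col V H q.1 q.2 ∈ T}, cell q.1 q.2
  have hF : ∀ T, IsClosed (F T) := fun T =>
    (Set.toFinite _).isClosed_biUnion (fun q _ => isClosed_Icc.prod isClosed_Icc)
  by_contra hne
  have hcov : S ⊆ F {col V H a b} ∪ F {col V H a b}ᶜ := by
    intro w hw
    have hq := hSQ hw
    have hwc : w ∈ cell (idx N w.1) (idx N w.2) :=
      ⟨idx_mem hN hq.1.1 hq.1.2, idx_mem hN hq.2.1 hq.2.2⟩
    by_cases h : col V H (idx N w.1) (idx N w.2) = col V H a b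
    · left
      exact mem_biUnion (x := ((⟨idx N w.1, idx_lt hN _⟩, ⟨idx N w.2, idx_lt hN _⟩) : Fin N × Fin N))
        h hwc
    · right
      exact mem_biUnion (x := ((⟨idx N w.1, idx_lt hN _⟩, ⟨idx N w.2, idx_lt hN _⟩) : Fin N × Fin N))
        h hwc
  obtain ⟨w, hwS, hw1, hw2⟩ := (isPreconnected_closed_iff.1 hS) _ _ (hF _) (hF _) hcov
    ⟨z, hz, mem_biUnion (x := ((⟨a, ha⟩, ⟨b, hb⟩) : Fin N × Fin N)) rfl hc⟩
    ⟨z', hz', mem_biUnion (x := ((⟨a', ha'⟩, ⟨b', hb'⟩) : Fin N × Fin N)) (Ne.symm hne) hc'⟩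
  simp only [F, mem_iUnion] at hw1 hw2
  obtain ⟨q, hq, hqw⟩ := hw1
  obtain ⟨r, hr, hrw⟩ := hw2
  exact hr ((same w hwS _ _ _ _ r.1.2 r.2.2 q.1.2 q.2.2 hrw hqw).trans hq)

/-- grid graph -/
def gridG (Vp Hp : ℕ → ℕ → Prop) : SimpleGraph (ℕ × ℕ) where
  Adj x y := (Vp x.1 x.2 ∧ y = (x.1, x.2 + 1)) ∨ (Vp y.1 y.2 ∧ x = (y.1, y.2 + 1)) ∨
    (Hp x.1 x.2 ∧ y = (x.1 + 1, x.2)) ∨ (Hp y.1 y.2 ∧ x = (y.1 + 1, y.2))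
  symm := ⟨by intro x y h; tauto⟩
  loopless := ⟨by
    rintro ⟨a, b⟩ h
    simp at h⟩

lemma seg_V (a b : ℕ) (z : ℝ × ℝ) :
    z ∈ segment ℝ (emb (a, b)) (emb (a, b + 1)) ↔ OnV a b z := by
  rw [segment_eq_image]
  constructor
  · rintro ⟨t, ⟨h0, h1⟩, rfl⟩
    refine ⟨?_, ?_, ?_⟩ <;> simp [emb] <;> nlinarith
  · rintro ⟨h, h0, h1⟩
    refine ⟨z.2 - b, ⟨by linarith, by linarith⟩, ?_⟩
    ext <;> simp [emb]
    · rw [h]; ring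
    · ring

lemma seg_H (a b : ℕ) (z : ℝ × ℝ) :
    z ∈ segment ℝ (emb (a, b)) (emb (a + 1, b)) ↔ OnH a b z := by
  rw [segment_eq_image]
  constructor
  · rintro ⟨t, ⟨h0, h1⟩, rfl⟩
    refine ⟨?_, ?_, ?_⟩ <;> simp [emb] <;> nlinarith
  · rintro ⟨h, h0, h1⟩
    refine ⟨z.1 - a, ⟨by linarith, by linarith⟩, ?_⟩
    ext <;> simp [emb]
    · ring
    · rw [h]; ring

lemma cross_VV {a b a' b' : ℕ} {z : ℝ × ℝ} (h : OnV a b z) (h' : OnV a' b' z) :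
    (a = a' ∧ b = b') ∨ (a = a' ∧ b' = b + 1 ∧ z = emb (a, b + 1)) ∨
      (a = a' ∧ b = b' + 1 ∧ z = emb (a, b)) := by
  obtain ⟨h1, h2, h3⟩ := h
  obtain ⟨h1', h2', h3'⟩ := h'
  have e : a = a' := by exact_mod_cast h1.symm.trans h1'
  have k1 : b ≤ b' + 1 := by exact_mod_cast h2.trans h3'
  have k2 : b' ≤ b + 1 := by exact_mod_cast h2'.trans h3
  rcases (by omega : b = b' ∨ b' = b + 1 ∨ b = b' + 1) with k | k | k
  · exact Or.inl ⟨e, k⟩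
  · refine Or.inr (Or.inl ⟨e, k, ?_⟩)
    subst k; push_cast at *
    ext <;> simp [emb] <;> linarith
  · refine Or.inr (Or.inr ⟨e, k, ?_⟩)
    subst k; push_cast at *
    ext <;> simp [emb] <;> linarith

lemma cross_HH {a b a' b' : ℕ} {z : ℝ × ℝ} (h : OnH a b z) (h' : OnH a' b' z) :
    (a = a' ∧ b = b') ∨ (b = b' ∧ a' = a + 1 ∧ z = emb (a + 1, b)) ∨
      (b = b' ∧ a = a' + 1 ∧ z = emb (a, b)) := by
  obtain ⟨h1, h2, h3⟩ := h
  obtain ⟨h1', h2', h3'⟩ := h'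
  have e : b = b' := by exact_mod_cast h1.symm.trans h1'
  have k1 : a ≤ a' + 1 := by exact_mod_cast h2.trans h3'
  have k2 : a' ≤ a + 1 := by exact_mod_cast h2'.trans h3
  rcases (by omega : a = a' ∨ a' = a + 1 ∨ a = a' + 1) with k | k | k
  · exact Or.inl ⟨k, e⟩
  · refine Or.inr (Or.inl ⟨e, k, ?_⟩)
    subst k; push_cast at *
    ext <;> simp [emb] <;> linarith
  · refine Or.inr (Or.inr ⟨e, k, ?_⟩)
    subst k; push_cast at *
    ext <;> simp [emb] <;> linarith

lemma cross_VH {a b a' b' : ℕ} {z : ℝ × ℝ} (h : OnV a b z) (h' : OnH a' b' z) :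
    (a = a' ∨ a = a' + 1) ∧ (b' = b ∨ b' = b + 1) ∧ z = emb (a, b') := by
  obtain ⟨h1, h2, h3⟩ := h
  obtain ⟨h1', h2', h3'⟩ := h'
  rw [h1'] at h2 h3
  rw [h1] at h2' h3'
  have k1 : b ≤ b' := by exact_mod_cast h2
  have k2 : b' ≤ b + 1 := by exact_mod_cast h3
  have k3 : a' ≤ a := by exact_mod_cast h2'
  have k4 : a ≤ a' + 1 := by exact_mod_cast h3'
  refine ⟨by omega, by omega, ?_⟩
  ext <;> simp [emb, *]

/-- normal form of an edge -/
lemma adj_cases {Vp Hp : ℕ → ℕ → Prop} {x y : ℕ × ℕ} (h : (gridG Vp Hp).Adj x y) :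
    (∃ a b, Vp a b ∧ s(x, y) = s((a, b), (a, b + 1)) ∧
      ∀ z, z ∈ segment ℝ (emb x) (emb y) ↔ OnV a b z) ∨
    (∃ a b, Hp a b ∧ s(x, y) = s((a, b), (a + 1, b)) ∧
      ∀ z, z ∈ segment ℝ (emb x) (emb y) ↔ OnH a b z) := by
  rcases h with ⟨h, e⟩ | ⟨h, e⟩ | ⟨h, e⟩ | ⟨h, e⟩
  · subst e; exact Or.inl ⟨_, _, h, rfl, fun z => seg_V _ _ z⟩
  · subst e; exact Or.inl ⟨_, _, h, Sym2.eq_swap, fun z => by rw [segment_symm]; exact seg_V _ _ z⟩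
  · subst e; exact Or.inr ⟨_, _, h, rfl, fun z => seg_H _ _ z⟩
  · subst e; exact Or.inr ⟨_, _, h, Sym2.eq_swap, fun z => by rw [segment_symm]; exact seg_H _ _ z⟩

lemma cross {Vp Hp : ℕ → ℕ → Prop} {x y u w : ℕ × ℕ} (h : (gridG Vp Hp).Adj x y)
    (h' : (gridG Vp Hp).Adj u w) {z : ℝ × ℝ} (hz : z ∈ segment ℝ (emb x) (emb y))
    (hz' : z ∈ segment ℝ (emb u) (emb w)) :
    s(x, y) = s(u, w) ∨ ∃ k, k ∈ s(x, y) ∧ k ∈ s(u, w) ∧ z = emb k := by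
  rcases adj_cases h with ⟨a, b, -, e, hs⟩ | ⟨a, b, -, e, hs⟩ <;>
  rcases adj_cases h' with ⟨a', b', -, e', hs'⟩ | ⟨a', b', -, e', hs'⟩ <;>
  rw [hs] at hz <;> rw [hs'] at hz' <;> rw [e, e']
  · rcases cross_VV hz hz' with ⟨rfl, rfl⟩ | ⟨rfl, rfl, h⟩ | ⟨rfl, rfl, h⟩
    · exact Or.inl rfl
    · exact Or.inr ⟨_, by simp, by simp, h⟩
    · exact Or.inr ⟨_, by simp, by simp, h⟩
  · obtain ⟨h1, h2, h3⟩ := cross_VH hz hz'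
    refine Or.inr ⟨_, ?_, ?_, h3⟩ <;> simp <;> tauto
  · obtain ⟨h1, h2, h3⟩ := cross_VH hz' hz
    refine Or.inr ⟨_, ?_, ?_, h3⟩ <;> simp <;> tauto
  · rcases cross_HH hz hz' with ⟨rfl, rfl⟩ | ⟨rfl, rfl, h⟩ | ⟨rfl, rfl, h⟩
    · exact Or.inl rfl
    · exact Or.inr ⟨_, by simp, by simp, h⟩
    · exact Or.inr ⟨_, by simp, by simp, h⟩

lemma emb_inj : Function.Injective emb := by
  rintro ⟨a, b⟩ ⟨c, d⟩ h
  simpa [emb] using h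

lemma trans_inj {X : Type*} [TopologicalSpace X] {x y z : X} (p : Path x y) (q : Path y z)
    (hp : Function.Injective p) (hq : Function.Injective q)
    (hpq : ∀ s t, p s = q t → p s = y) : Function.Injective (p.trans q) := by
  have key : ∀ s t : I, (s : ℝ) ≤ 1 / 2 → ¬ (t : ℝ) ≤ 1 / 2 → (p.trans q) s ≠ (p.trans q) t := by
    intro s t hs ht h
    rw [Path.trans_apply, Path.trans_apply, dif_pos hs, dif_neg ht] at h
    have h1 := hpq _ _ h
    rw [h] at h1
    have h2 := hq (h1.trans q.source.symm)
    have h3 := congrArg Subtype.val h2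
    simp at h3
    rw [not_le] at ht
    linarith
  intro s t h
  by_cases hs : (s : ℝ) ≤ 1 / 2 <;> by_cases ht : (t : ℝ) ≤ 1 / 2
  · rw [Path.trans_apply, Path.trans_apply, dif_pos hs, dif_pos ht] at h
    have h3 := congrArg Subtype.val (hp h)
    simp at h3
    exact Subtype.ext h3
  · exact absurd h (key s t hs ht)
  · exact absurd h.symm (key t s ht hs)
  · rw [Path.trans_apply, Path.trans_apply, dif_neg hs, dif_neg ht] at h
    have h3 := congrArg Subtype.val (hq h)
    simp at h3
    exact Subtype.ext h3

lemma seg_path {u w : ℝ × ℝ} (h : u ≠ w) :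
    ∃ p : Path u w, Function.Injective p ∧ range p = segment ℝ u w := by
  refine ⟨⟨⟨fun t => AffineMap.lineMap u w (t : ℝ), by
    simp only [AffineMap.lineMap_apply_module]; fun_prop⟩, by simp, by simp⟩, ?_, ?_⟩
  · intro s t hst
    exact Subtype.ext (AffineMap.lineMap_injective ℝ h hst)
  · rw [segment_eq_image_lineMap]
    ext z
    constructor
    · rintro ⟨t, rfl⟩; exact ⟨t, t.2, rfl⟩
    · rintro ⟨t, ht, rfl⟩; exact ⟨⟨t, ht⟩, rfl⟩

lemma arc_of_path {Vp Hp : ℕ → ℕ → Prop} {u v : ℕ × ℕ} (p : (gridG Vp Hp).Walk u v)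
    (hp : p.IsPath) (huv : u ≠ v) :
    ∃ α : Path (emb u) (emb v), Function.Injective α ∧
      range α = {z | ∃ x y, s(x, y) ∈ p.edges ∧ z ∈ segment ℝ (emb x) (emb y)} := by
  induction p with
  | nil => exact absurd rfl huv
  | @cons u w v h q ih =>
    rw [SimpleGraph.Walk.cons_isPath_iff] at hp
    obtain ⟨β, hβ, hβr⟩ := seg_path (u := emb u) (w := emb w) (fun e => h.ne (emb_inj e))
    have hR : {z | ∃ x y, s(x, y) ∈ (SimpleGraph.Walk.cons h q).edges ∧
        z ∈ segment ℝ (emb x) (emb y)} = segment ℝ (emb u) (emb w) ∪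
        {z | ∃ x y, s(x, y) ∈ q.edges ∧ z ∈ segment ℝ (emb x) (emb y)} := by
      ext z
      simp only [SimpleGraph.Walk.edges_cons, List.mem_cons, mem_ofPred_eq, mem_union]
      constructor
      · rintro ⟨x, y, h1 | h1, h2⟩
        · left
          rcases Sym2.eq_iff.1 h1 with ⟨rfl, rfl⟩ | ⟨rfl, rfl⟩
          · exact h2
          · rwa [segment_symm]
        · exact Or.inr ⟨x, y, h1, h2⟩
      · rintro (h1 | ⟨x, y, h1, h2⟩)
        · exact ⟨u, w, Or.inl rfl, h1⟩
        · exact ⟨x, y, Or.inr h1, h2⟩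
    rw [hR]
    by_cases hwv : w = v
    · subst hwv
      have : q = SimpleGraph.Walk.nil := SimpleGraph.Walk.isPath_iff_eq_nil.1 hp.1 |> fun h => by simpa using h
      subst this
      exact ⟨β, hβ, by simp [hβr]⟩
    · obtain ⟨γ, hγ, hγr⟩ := ih hp.1 hwv
      refine ⟨β.trans γ, trans_inj β γ hβ hγ ?_, ?_⟩
      · intro s t hst
        have h1 : β s ∈ segment ℝ (emb u) (emb w) := hβr ▸ mem_range_self s
        have h2 : β s ∈ range γ := hst ▸ mem_range_self t
        rw [hγr] at h2
        obtain ⟨x, y, hxy, hz⟩ := h2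
        have hx := q.fst_mem_support_of_mem_edges hxy
        have hy := q.snd_mem_support_of_mem_edges hxy
        rcases cross h (q.adj_of_mem_edges hxy) h1 hz with e | ⟨k, hk, hk', e⟩
        · exfalso
          have : u ∈ s(x, y) := e ▸ Sym2.mem_mk_left u w
          rcases Sym2.mem_iff.1 this with rfl | rfl
          · exact hp.2 hx
          · exact hp.2 hy
        · have hks : k ∈ q.support := by
            rcases Sym2.mem_iff.1 hk' with rfl | rfl
            · exact hx
            · exact hy
          rcases Sym2.mem_iff.1 hk with rfl | rfl
          · exact absurd hks hp.2
          · exact e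
      · rw [Path.trans_range, hβr, hγr]

lemma two_nbrs {W : Type*} {G : SimpleGraph W} {u v : W} (p : G.Walk u v) (hp : p.IsPath)
    {x : W} (hx : x ∈ p.support) (hu : x ≠ u) (hv : x ≠ v) :
    ∃ y z, y ≠ z ∧ G.Adj x y ∧ G.Adj x z := by
  induction p with
  | nil => simp at hx; exact absurd hx hu
  | @cons u w v h q ih =>
    rw [SimpleGraph.Walk.cons_isPath_iff] at hp
    rw [SimpleGraph.Walk.support_cons, List.mem_cons] at hx
    have hx := hx.resolve_left hu
    by_cases hxw : x = w
    · subst hxw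
      cases q with
      | nil => exact absurd rfl hv
      | @cons _ y _ h' r =>
        refine ⟨u, y, ?_, h.symm, h'⟩
        rintro rfl
        exact hp.2 (by simp)
    · exact ih hp.1 hx hxw hv

end SepArc


namespace SepArc

lemma edge_par_V (c d a b : ℕ) :
    ((if s((c, d), (c, d + 1)) = s((a + 1, b + 1), (a + 1, b + 1 + 1)) then 1 else 0) +
    (if s((c, d), (c, d + 1)) = s((a + 1, b), (a + 1, b + 1)) then 1 else 0) +
    (if s((c, d), (c, d + 1)) = s((a + 1, b + 1), (a + 1 + 1, b + 1)) then 1 else 0) +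
    (if s((c, d), (c, d + 1)) = s((a, b + 1), (a + 1, b + 1)) then 1 else 0) : ZMod 2) =
    (if (c, d) = (a + 1, b + 1) then 1 else 0) + (if (c, d + 1) = (a + 1, b + 1) then 1 else 0) := by
  simp only [Sym2.eq_iff, Prod.mk.injEq]
  rw [if_congr (Q := c = a + 1 ∧ d = b + 1) (by omega) rfl rfl,
    if_congr (P := _ ∨ _) (Q := c = a + 1 ∧ d + 1 = b + 1) (by omega) rfl rfl,
    if_neg (c := _ ∨ _) (by omega), if_neg (c := _ ∨ _) (by omega), add_zero, add_zero]

lemma edge_par_H (c d a b : ℕ) :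
    ((if s((c, d), (c + 1, d)) = s((a + 1, b + 1), (a + 1, b + 1 + 1)) then 1 else 0) +
    (if s((c, d), (c + 1, d)) = s((a + 1, b), (a + 1, b + 1)) then 1 else 0) +
    (if s((c, d), (c + 1, d)) = s((a + 1, b + 1), (a + 1 + 1, b + 1)) then 1 else 0) +
    (if s((c, d), (c + 1, d)) = s((a, b + 1), (a + 1, b + 1)) then 1 else 0) : ZMod 2) =
    (if (c, d) = (a + 1, b + 1) then 1 else 0) + (if (c + 1, d) = (a + 1, b + 1) then 1 else 0) := by
  simp only [Sym2.eq_iff, Prod.mk.injEq]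
  rw [if_neg (c := _ ∨ _) (by omega), if_neg (c := _ ∨ _) (by omega),
    if_congr (P := _ ∨ _) (Q := c = a + 1 ∧ d = b + 1) (by omega) rfl rfl,
    if_congr (P := _ ∨ _) (Q := c + 1 = a + 1 ∧ d = b + 1) (by omega) rfl rfl, zero_add, zero_add]

def wV {G : SimpleGraph (ℕ × ℕ)} {u v : ℕ × ℕ} (p : G.Walk u v) (a b : ℕ) : ZMod 2 :=
  (p.edges.count s((a, b), (a, b + 1)) : ZMod 2)
def wH {G : SimpleGraph (ℕ × ℕ)} {u v : ℕ × ℕ} (p : G.Walk u v) (a b : ℕ) : ZMod 2 :=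
  (p.edges.count s((a, b), (a + 1, b)) : ZMod 2)

lemma walk_par {Vp Hp : ℕ → ℕ → Prop} {u v : ℕ × ℕ} (p : (gridG Vp Hp).Walk u v) (a b : ℕ) :
    wV p (a + 1) (b + 1) + wV p (a + 1) b + wH p (a + 1) (b + 1) + wH p a (b + 1) =
    (if u = (a + 1, b + 1) then 1 else 0) + (if v = (a + 1, b + 1) then 1 else 0) := by
  induction p with
  | nil => simp only [wV, wH, SimpleGraph.Walk.edges_nil, List.count_nil]; split_ifs <;> rfl
  | @cons u w v h q ih =>
    have key : ((if s(u, w) = s((a + 1, b + 1), (a + 1, b + 1 + 1)) then 1 else 0) +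
      (if s(u, w) = s((a + 1, b), (a + 1, b + 1)) then 1 else 0) +
      (if s(u, w) = s((a + 1, b + 1), (a + 1 + 1, b + 1)) then 1 else 0) +
      (if s(u, w) = s((a, b + 1), (a + 1, b + 1)) then 1 else 0) : ZMod 2) =
      (if u = (a + 1, b + 1) then 1 else 0) + (if w = (a + 1, b + 1) then 1 else 0) := by
      rcases h with ⟨-, e⟩ | ⟨-, e⟩ | ⟨-, e⟩ | ⟨-, e⟩
      · subst e; exact edge_par_V _ _ _ _
      · subst e; rw [Sym2.eq_swap, add_comm (if _ = _ then (1 : ZMod 2) else 0)  (if w = _ then _ else _)]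
        exact edge_par_V _ _ _ _
      · subst e; exact edge_par_H _ _ _ _
      · subst e; rw [Sym2.eq_swap, add_comm (if _ = _ then (1 : ZMod 2) else 0)  (if w = _ then _ else _)]
        exact edge_par_H _ _ _ _
    simp only [wV, wH, SimpleGraph.Walk.edges_cons, List.count_cons, beq_iff_eq] at ih ⊢
    push_cast
    linear_combination ih + key + (if w = (a + 1, b + 1) then (1 : ZMod 2) else 0) * two0

lemma walk_bot {Vp Hp : ℕ → ℕ → Prop} (hH0 : ∀ a, ¬ Hp a 0)
    {u v : ℕ × ℕ} (p : (gridG Vp Hp).Walk u v) (k : ℕ) :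
    wV p k 0 = (if u = (k, 0) then 1 else 0) + (if v = (k, 0) then 1 else 0) := by
  induction p with
  | nil => simp only [wV, SimpleGraph.Walk.edges_nil, List.count_nil]; split_ifs <;> rfl
  | @cons u w v h q ih =>
    have key : (if s(u, w) = s((k, 0), (k, 0 + 1)) then 1 else 0 : ZMod 2) =
      (if u = (k, 0) then 1 else 0) + (if w = (k, 0) then 1 else 0) := by
      obtain ⟨c, d⟩ := u
      obtain ⟨c', d'⟩ := w
      rcases h with ⟨-, e⟩ | ⟨-, e⟩ | ⟨h, e⟩ | ⟨h, e⟩ <;>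
      simp only [Sym2.eq_iff, Prod.mk.injEq] at e ⊢
      · split_ifs <;> first | (exfalso; omega) | rfl
      · split_ifs <;> first | (exfalso; omega) | rfl
      · have : d ≠ 0 := by rintro rfl; exact hH0 _ h
        split_ifs <;> first | (exfalso; omega) | rfl
      · have : d' ≠ 0 := by rintro rfl; exact hH0 _ h
        split_ifs <;> first | (exfalso; omega) | rfl
    simp only [wV, SimpleGraph.Walk.edges_cons, List.count_cons, beq_iff_eq] at ih ⊢
    push_cast
    linear_combination ih + key + (if w = (k, 0) then (1 : ZMod 2) else 0) * two0

lemma core (N : ℕ) (hN : 0 < N) (g : ℝ × ℝ → ℝ) (ε : ℝ)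
    (hg : ∀ z w, dist z w ≤ 1 → |g z - g w| < ε)
    (P P' : Set (ℝ × ℝ)) (hPc : IsPreconnected P) (hPc' : IsPreconnected P')
    (hPQ : P ⊆ Icc 0 (N : ℝ) ×ˢ Icc 0 (N : ℝ)) (hPQ' : P' ⊆ Icc 0 (N : ℝ) ×ˢ Icc 0 (N : ℝ))
    (hP : ∀ z ∈ P, g z ≤ -ε) (hP' : ∀ z ∈ P', ε ≤ g z)
    (x₀ x₁ x₀' x₁' : ℝ) (h0 : (x₀, 0) ∈ P) (h1 : (x₁, (N : ℝ)) ∈ P)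
    (h0' : (x₀', 0) ∈ P') (h1' : (x₁', (N : ℝ)) ∈ P') (hlt : x₀ < x₀') :
    ∃ α : unitInterval → ℝ × ℝ, Continuous α ∧ Function.Injective α ∧
      (∀ t, |g (α t)| < ε) ∧ (∀ t, α t ∈ Icc 0 (N : ℝ) ×ˢ Icc 0 (N : ℝ)) ∧
      (α 0).2 = 0 ∧ (α 1).2 = N ∧
      (∀ t, t ≠ 0 → t ≠ 1 → α t ∈ Ioo 0 (N : ℝ) ×ˢ Ioo 0 (N : ℝ)) ∧
      ∀ S : Set (ℝ × ℝ), IsPreconnected S → S ⊆ Icc 0 (N : ℝ) ×ˢ Icc 0 (N : ℝ) →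
        (∀ t, α t ∉ S) → ∀ y y', (y, (0 : ℝ)) ∈ S → (y', (0 : ℝ)) ∈ S → y ≤ x₀ → x₀' ≤ y' →
        False := by
  classical
  let B : ℕ → ℕ → Prop := fun a b => g (a, b) < 0
  let Vp : ℕ → ℕ → Prop := fun a b => 0 < a ∧ a < N ∧ b < N ∧ ¬ (B (a - 1) b ↔ B a b)
  let Hp : ℕ → ℕ → Prop := fun a b => 0 < b ∧ b < N ∧ a < N ∧ ¬ (B a (b - 1) ↔ B a b)
  have hcell : ∀ a b z, z ∈ cell a b → |g z - g (a, b)| < ε := by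
    intro a b z hz
    obtain ⟨⟨k1, k2⟩, k3, k4⟩ := hz
    apply hg
    rw [Prod.dist_eq, max_le_iff, Real.dist_eq, Real.dist_eq, abs_le, abs_le]
    refine ⟨⟨?_, ?_⟩, ?_, ?_⟩ <;> simp only <;> linarith
  have two : ∀ z a b a' b', z ∈ cell a b → z ∈ cell a' b' → ¬ (B a b ↔ B a' b') → |g z| < ε := by
    intro z a b a' b' h h' hB
    have e1 := abs_lt.1 (hcell _ _ _ h)
    have e2 := abs_lt.1 (hcell _ _ _ h')
    simp only [B] at hB
    rw [abs_lt]
    by_cases c1 : g (a, b) < 0 <;> by_cases c2 : g (a', b') < 0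
    · exact absurd (iff_of_true c1 c2) hB
    · constructor <;> linarith
    · constructor <;> linarith
    · exact absurd (iff_of_false c1 c2) hB
  have gV : ∀ a b z, Vp a b → OnV a b z → |g z| < ε := by
    rintro a b z ⟨ha, -, -, hB⟩ ⟨e, k⟩
    obtain ⟨c, rfl⟩ : ∃ c, a = c + 1 := ⟨a - 1, by omega⟩
    refine two z _ _ _ _ ⟨?_, k⟩ ⟨?_, k⟩ hB
    · simp [e]
    · simp [e]
  have gH : ∀ a b z, Hp a b → OnH a b z → |g z| < ε := by
    rintro a b z ⟨ha, -, -, hB⟩ ⟨e, k⟩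
    obtain ⟨c, rfl⟩ : ∃ c, b = c + 1 := ⟨b - 1, by omega⟩
    refine two z _ _ _ _ ⟨k, ?_⟩ ⟨k, ?_⟩ hB
    · simp [e]
    · simp [e]
  have hcb : ∀ {x y : ℝ}, (x, y) ∈ Icc 0 (N : ℝ) ×ˢ Icc 0 (N : ℝ) →
      x ∈ Icc (idx N x : ℝ) (idx N x + 1) := fun h => idx_mem hN h.1.1 h.1.2
  have hc0 : ∀ {x : ℝ}, (x, (0 : ℝ)) ∈ Icc 0 (N : ℝ) ×ˢ Icc 0 (N : ℝ) →
      (x, (0 : ℝ)) ∈ cell (idx N x) 0 := fun h => ⟨hcb h, by simp⟩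
  have hcN : ∀ {x : ℝ}, (x, (N : ℝ)) ∈ Icc 0 (N : ℝ) ×ˢ Icc 0 (N : ℝ) →
      (x, (N : ℝ)) ∈ cell (idx N x) (N - 1) := fun h => ⟨hcb h, by
        have : ((N - 1 : ℕ) : ℝ) + 1 = N := by exact_mod_cast (by omega : N - 1 + 1 = N)
        constructor <;> simp only <;> linarith⟩
  set A := idx N x₀ with hA
  set A' := idx N x₀' with hA'
  have hAA' : A ≤ A' := idx_mono N hlt.le
  have hBA : B A 0 := by
    have := abs_lt.1 (hcell _ _ _ (hc0 (hPQ h0)))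
    have := hP _ h0
    show g _ < 0
    linarith
  have hBA' : ¬ B A' 0 := by
    have := abs_lt.1 (hcell _ _ _ (hc0 (hPQ' h0')))
    have := hP' _ h0'
    show ¬ g _ < 0
    linarith
  let G := gridG Vp Hp
  -- existence of a path
  obtain ⟨s, t, hs1, hs2, hreach⟩ : ∃ s t, A < s ∧ s ≤ A' ∧ G.Reachable (s, 0) (t, N) := by
    by_contra hno
    let C : Set (ℕ × ℕ) := {x | ∃ s, A < s ∧ s ≤ A' ∧ G.Reachable (s, 0) x}
    have hCadj : ∀ x y, G.Adj x y → (x ∈ C ↔ y ∈ C) := by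
      intro x y h
      constructor
      · rintro ⟨s, k1, k2, k3⟩; exact ⟨s, k1, k2, k3.trans h.reachable⟩
      · rintro ⟨s, k1, k2, k3⟩; exact ⟨s, k1, k2, k3.trans h.symm.reachable⟩
    have hCN : ∀ t, (t, N) ∉ C := by
      rintro t ⟨s, k1, k2, k3⟩
      exact hno ⟨s, t, k1, k2, k3⟩
    have adjV : ∀ a b, Vp a b → G.Adj (a, b) (a, b + 1) := fun a b h => Or.inl ⟨h, rfl⟩
    have adjH : ∀ a b, Hp a b → G.Adj (a, b) (a + 1, b) := fun a b h => Or.inr (Or.inr (Or.inl ⟨h, rfl⟩))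
    let V : ℕ → ℕ → ZMod 2 := fun a b => if (a, b) ∈ C ∧ Vp a b then 1 else 0
    let H : ℕ → ℕ → ZMod 2 := fun a b => if (a, b) ∈ C ∧ Hp a b then 1 else 0
    have hpar : ∀ a b, a + 1 < N → b + 1 < N →
        V (a + 1) (b + 1) + V (a + 1) b + H (a + 1) (b + 1) + H a (b + 1) = 0 := by
      intro a b ha hb
      have e1 : ((a + 1, b) ∈ C ∧ Vp (a + 1) b) ↔ ((a + 1, b + 1) ∈ C ∧ Vp (a + 1) b) :=
        and_congr_left fun h => hCadj _ _ (adjV _ _ h)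
      have e2 : ((a, b + 1) ∈ C ∧ Hp a (b + 1)) ↔ ((a + 1, b + 1) ∈ C ∧ Hp a (b + 1)) :=
        and_congr_left fun h => hCadj _ _ (adjH _ _ h)
      simp only [V, H, e1, e2]
      by_cases hx : (a + 1, b + 1) ∈ C
      · have ha2 : a < N := by omega
        have hb2 : b < N := by omega
        simp only [hx, true_and, Vp, Hp, Nat.succ_pos, ha, hb, ha2, hb2, Nat.add_sub_cancel]
        by_cases c1 : B a b <;> by_cases c2 : B (a + 1) b <;> by_cases c3 : B a (b + 1) <;>
        by_cases c4 : B (a + 1) (b + 1) <;> simp [c1, c2, c3, c4] <;> rfl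
      · simp [hx]
    have avoid : ∀ S : Set (ℝ × ℝ), IsPreconnected S → S ⊆ Icc 0 (N : ℝ) ×ˢ Icc 0 (N : ℝ) →
        (∀ z ∈ S, ε ≤ |g z|) → ∀ y y', (y, (0 : ℝ)) ∈ S → (y', (N : ℝ)) ∈ S →
        col V H (idx N y) 0 = col V H (idx N y') (N - 1) := by
      intro S hS hSQ hSg y y' hy hy'
      refine col_const hpar hS hSQ hN ?_ ?_ hy hy' (idx_lt hN _) hN (idx_lt hN _) (by omega)
        (hc0 (hSQ hy)) (hcN (hSQ hy'))
      · intro a b _ _ hV z hz hon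
        simp only [V, ne_eq, ite_eq_right_iff, not_forall] at hV
        exact absurd (gV _ _ _ hV.1.2 hon) (not_lt.2 (hSg z hz))
      · intro a b _ _ hV z hz hon
        simp only [H, ne_eq, ite_eq_right_iff, not_forall] at hV
        exact absurd (gH _ _ _ hV.1.2 hon) (not_lt.2 (hSg z hz))
    have r1 := avoid P hPc hPQ (fun z hz => by
      have := hP z hz; have := neg_le_abs (g z); linarith) _ _ h0 h1
    have r2 := avoid P' hPc' hPQ' (fun z hz => by
      have := hP' z hz; have := le_abs_self (g z); linarith) _ _ h0' h1'
    have top : ∀ a, col V H a (N - 1) = col V H 0 (N - 1) := by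
      intro a
      induction a with
      | zero => rfl
      | succ a ih =>
        rw [col_left, ih]
        have : V (a + 1) (N - 1) = 0 := by
          simp only [V, ite_eq_right_iff]
          rintro ⟨k1, k2⟩
          have := (hCadj _ _ (adjV _ _ k2)).1 k1
          rw [Nat.sub_add_cancel hN] at this
          exact absurd this (hCN _)
        rw [this, add_zero]
    have bot : ∀ a, A ≤ a → a ≤ A' →
        col V H a 0 = col V H A 0 + (if B a 0 then 0 else 1) := by
      intro a ha
      induction a, ha using Nat.le_induction with
      | base => intro _; simp [hBA]
      | succ a ha ih =>
        intro haA
        have hlt' : a + 1 < N := lt_of_le_of_lt haA (idx_lt hN _)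
        have hmem : (a + 1, 0) ∈ C := ⟨a + 1, by omega, haA, SimpleGraph.Reachable.refl _⟩
        rw [col_left, ih (by omega)]
        simp only [V, hmem, true_and, Vp, Nat.succ_pos, hlt', hN, Nat.add_sub_cancel]
        by_cases c1 : B a 0 <;> by_cases c2 : B (a + 1) 0 <;> simp [c1, c2]
        rw [add_assoc, show (1 + 1 : ZMod 2) = 0 from rfl, add_zero]
    have r3 := bot A' hAA' le_rfl
    rw [if_neg hBA', r2, top, ← top (idx N x₁), ← r1] at r3
    exact absurd (left_eq_add.1 r3) (by decide)
  obtain ⟨p, hp⟩ := hreach.exists_isPath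
  have hne : ((s, 0) : ℕ × ℕ) ≠ (t, N) := by
    intro h; simp at h; omega
  obtain ⟨α, hαi, hαr⟩ := arc_of_path p hp hne
  have hedge : ∀ τ, ∃ x y, s(x, y) ∈ p.edges ∧ α τ ∈ segment ℝ (emb x) (emb y) := by
    intro τ
    have := mem_range_self (f := α) τ
    rwa [hαr] at this
  have hinner : ∀ x, x ∈ p.support → x ≠ (s, 0) → x ≠ (t, N) →
      0 < x.1 ∧ x.1 < N ∧ 0 < x.2 ∧ x.2 < N := by
    rintro ⟨a, b⟩ hx hu hv
    obtain ⟨⟨c, d⟩, ⟨c', d'⟩, hne, k1, k2⟩ := two_nbrs p hp hx hu hv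
    simp only [G, gridG, Vp, Hp, Prod.mk.injEq, ne_eq] at k1 k2 hne
    simp only
    rcases k1 with k1 | k1 | k1 | k1 <;> rcases k2 with k2 | k2 | k2 | k2 <;> omega
  have hvert : ∀ τ, τ ≠ 0 → τ ≠ 1 → ∀ x, x ∈ p.support → α τ = emb x →
      0 < x.1 ∧ x.1 < N ∧ 0 < x.2 ∧ x.2 < N := by
    intro τ h0 h1 x hx e
    refine hinner x hx ?_ ?_
    · rintro rfl; exact h0 (hαi (e.trans α.source.symm))
    · rintro rfl; exact h1 (hαi (e.trans α.target.symm))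
  refine ⟨α, α.continuous, hαi, ?_, ?_, (congrArg Prod.snd α.source).trans (by simp [emb]),
    (congrArg Prod.snd α.target).trans (by simp [emb]), ?_, ?_⟩
  · intro τ
    obtain ⟨x, y, hxy, hz⟩ := hedge τ
    rcases adj_cases (p.adj_of_mem_edges hxy) with ⟨a, b, h, -, hs⟩ | ⟨a, b, h, -, hs⟩
    · exact gV _ _ _ h ((hs _).1 hz)
    · exact gH _ _ _ h ((hs _).1 hz)
  · intro τ
    obtain ⟨x, y, hxy, hz⟩ := hedge τ
    rcases adj_cases (p.adj_of_mem_edges hxy) with ⟨a, b, h, -, hs⟩ | ⟨a, b, h, -, hs⟩ <;>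
    obtain ⟨e1, e2, e3⟩ := (hs _).1 hz <;> obtain ⟨q1, q2, q3, -⟩ := h
    · have : (a : ℝ) ≤ N := by exact_mod_cast q2.le
      have : (b : ℝ) + 1 ≤ N := by exact_mod_cast q3
      exact ⟨⟨by rw [e1]; positivity, by linarith⟩, ⟨le_trans (by positivity) e2, by linarith⟩⟩
    · have : (b : ℝ) ≤ N := by exact_mod_cast q2.le
      have : (a : ℝ) + 1 ≤ N := by exact_mod_cast q3
      exact ⟨⟨le_trans (by positivity) e2, by linarith⟩, ⟨by rw [e1]; positivity, by linarith⟩⟩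
  · intro τ h0 h1
    obtain ⟨x, y, hxy, hz⟩ := hedge τ
    have hx := p.fst_mem_support_of_mem_edges hxy
    have hy := p.snd_mem_support_of_mem_edges hxy
    have hsup : ∀ k, k ∈ s(x, y) → k ∈ p.support := by
      intro k hk
      rcases Sym2.mem_iff.1 hk with rfl | rfl
      · exact hx
      · exact hy
    rcases adj_cases (p.adj_of_mem_edges hxy) with ⟨a, b, h, he, hs⟩ | ⟨a, b, h, he, hs⟩ <;>
    obtain ⟨e1, e2, e3⟩ := (hs _).1 hz <;> obtain ⟨q1, q2, q3, -⟩ := h <;> rw [he] at hsup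
    · have i1 : (0 : ℝ) < a := by exact_mod_cast q1
      have i2 : (a : ℝ) < N := by exact_mod_cast q2
      have i3 : (b : ℝ) + 1 ≤ N := by exact_mod_cast q3
      have i4 : (0 : ℝ) ≤ b := by positivity
      refine ⟨⟨by rw [e1]; exact i1, by rw [e1]; exact i2⟩, lt_of_le_of_ne (i4.trans e2) ?_,
        lt_of_le_of_ne (e3.trans i3) ?_⟩
      · intro e
        have hb : (b : ℝ) = 0 := by linarith
        have := hvert τ h0 h1 (a, b) (hsup _ (by simp)) (Prod.ext e1 (by show (α τ).2 = (b : ℝ); linarith))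
        have hb' : b = 0 := by exact_mod_cast hb
        simp [hb'] at this
      · intro e
        have hb : (b : ℝ) + 1 = N := by linarith
        have := hvert τ h0 h1 (a, b + 1) (hsup _ (by simp)) (Prod.ext e1 (by show (α τ).2 = ((b + 1 : ℕ) : ℝ); push_cast; linarith))
        have hb' : b + 1 = N := by exact_mod_cast hb
        simp [hb'] at this
    · have i1 : (0 : ℝ) < b := by exact_mod_cast q1
      have i2 : (b : ℝ) < N := by exact_mod_cast q2
      have i3 : (a : ℝ) + 1 ≤ N := by exact_mod_cast q3
      have i4 : (0 : ℝ) ≤ a := by positivity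
      refine ⟨⟨lt_of_le_of_ne (i4.trans e2) ?_,
        lt_of_le_of_ne (e3.trans i3) ?_⟩, by rw [e1]; exact i1, by rw [e1]; exact i2⟩
      · intro e
        have hb : (a : ℝ) = 0 := by linarith
        have := hvert τ h0 h1 (a, b) (hsup _ (by simp)) (Prod.ext (by show (α τ).1 = (a : ℝ); linarith) e1)
        have hb' : a = 0 := by exact_mod_cast hb
        simp [hb'] at this
      · intro e
        have hb : (a : ℝ) + 1 = N := by linarith
        have := hvert τ h0 h1 (a + 1, b) (hsup _ (by simp)) (Prod.ext (by show (α τ).1 = ((a + 1 : ℕ) : ℝ); push_cast; linarith) e1)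
        have hb' : a + 1 = N := by exact_mod_cast hb
        simp [hb'] at this
  · intro S hS hSQ hSα y y' hy hy' hyx hyx'
    have hav : ∀ z ∈ S, ∀ x y, s(x, y) ∈ p.edges → z ∉ segment ℝ (emb x) (emb y) := by
      intro z hz x y hxy hzs
      have : z ∈ range α := by rw [hαr]; exact ⟨x, y, hxy, hzs⟩
      obtain ⟨τ, rfl⟩ := this
      exact hSα τ hz
    have hcnt : ∀ e : Sym2 (ℕ × ℕ), ((p.edges.count e : ℕ) : ZMod 2) ≠ 0 → e ∈ p.edges := by
      intro e he
      by_contra h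
      exact he (by rw [List.count_eq_zero_of_not_mem h]; rfl)
    have hcol : col (wV p) (wH p) (idx N y) 0 = col (wV p) (wH p) (idx N y') 0 := by
      refine col_const (N := N) ?_ hS hSQ hN ?_ ?_ hy hy' (idx_lt hN _) hN (idx_lt hN _) hN
        (hc0 (hSQ hy)) (hc0 (hSQ hy'))
      · intro a b ha hb
        rw [walk_par p a b, if_neg, if_neg, add_zero]
        · intro h; simp at h; omega
        · intro h; simp at h
      · intro a b _ _ hV z hz hon
        exact hav z hz _ _ (hcnt _ hV) ((seg_V _ _ _).2 hon)
      · intro a b _ _ hV z hz hon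
        exact hav z hz _ _ (hcnt _ hV) ((seg_H _ _ _).2 hon)
    have bot : ∀ a, col (wV p) (wH p) a 0 = if s ≤ a then 1 else 0 := by
      intro a
      induction a with
      | zero => rw [if_neg (by omega)]; simp [col]
      | succ a ih =>
        rw [col_left, ih, walk_bot (fun a h => absurd h.1 (lt_irrefl 0)) p (a + 1)]
        simp only [Prod.mk.injEq, and_true]
        split_ifs <;> first | (exfalso; omega) | rfl
    have m1 : idx N y ≤ A := idx_mono N hyx
    have m2 : A' ≤ idx N y' := idx_mono N hyx'
    rw [bot, bot, if_neg (by omega), if_pos (by omega)] at hcol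
    exact absurd hcol (by decide)

end SepArc


namespace SepArc

lemma exists_fun (K : Set (ℝ × ℝ)) (hK : IsCompact K) (n : ℕ) (P : Fin n → Set (ℝ × ℝ))
    (hPcomp : ∀ i, ∃ z ∈ K, P i = connectedComponentIn K z) (hPinj : Function.Injective P) :
    ∃ f : ℝ × ℝ → ℝ, Continuous f ∧ (∀ z ∈ K, ∃ m : ℕ, f z = m) ∧
      ∀ i, ∀ z ∈ P i, f z = (i : ℕ) := by
  classical
  haveI : CompactSpace K := isCompact_iff_compactSpace.1 hK
  choose z hzK hz using hPcomp
  let c : Fin n → ConnectedComponents K := fun i => ConnectedComponents.mk ⟨z i, hzK i⟩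
  have hc : Function.Injective c := by
    intro i j h
    apply hPinj
    rw [hz, hz, connectedComponentIn_eq_image (hzK i), connectedComponentIn_eq_image (hzK j)]
    rw [ConnectedComponents.coe_eq_coe.1 h]
  have hsep : ∀ i j, ∃ U : Set (ConnectedComponents K), IsClopen U ∧ c i ∈ U ∧ (i ≠ j → c j ∉ U) := by
    intro i j
    by_cases hij : i = j
    · exact ⟨univ, isClopen_univ, mem_univ _, fun h => absurd hij h⟩
    · haveI : TotallySeparatedSpace (ConnectedComponents K) :=
        loc_compact_t2_tot_disc_iff_tot_sep.1 inferInstance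
      obtain ⟨U, hU, h1, h2⟩ := exists_isClopen_of_totally_separated (hc.ne hij)
      exact ⟨U, hU, h1, fun _ => h2⟩
  choose U hU h1 h2 using hsep
  let W : Fin n → Set (ConnectedComponents K) := fun i => ⋂ j, U i j
  have hW : ∀ i, IsClopen (W i) := fun i => isClopen_iInter_of_finite (fun j => hU i j)
  let F : ConnectedComponents K → ℝ := fun x => ∑ i, (W i).indicator (fun _ => ((i : ℕ) : ℝ)) x
  have hF : Continuous F := continuous_finsetSum _ fun i _ =>
    continuous_const.indicator (by simp [(hW i).frontier_eq])
  obtain ⟨f, hf⟩ := ContinuousMap.exists_restrict_eq hK.isClosed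
    (⟨fun x => F (ConnectedComponents.mk x), hF.comp ConnectedComponents.continuous_coe⟩ : C(K, ℝ))
  have hf' : ∀ x (hx : x ∈ K), f x = F (ConnectedComponents.mk ⟨x, hx⟩) := by
    intro x hx
    exact congrArg (fun h : C(K, ℝ) => h ⟨x, hx⟩) hf
  refine ⟨f, f.continuous, ?_, ?_⟩
  · intro x hx
    refine ⟨∑ i, (W i).indicator (fun _ => (i : ℕ)) (ConnectedComponents.mk ⟨x, hx⟩), ?_⟩
    rw [hf' x hx]
    push_cast
    refine Finset.sum_congr rfl fun i _ => ?_
    simp only [indicator]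
    split_ifs <;> simp
  · intro i x hx
    rw [hz, connectedComponentIn_eq_image (hzK i)] at hx
    obtain ⟨⟨x, hxK⟩, hx, rfl⟩ := hx
    have hcx : ConnectedComponents.mk ⟨x, hxK⟩ = c i :=
      ConnectedComponents.coe_eq_coe'.2 hx
    rw [hf' x hxK, hcx]
    simp only [F]
    rw [Finset.sum_eq_single i]
    · exact indicator_of_mem (mem_iInter.2 fun j => h1 i j) _
    · intro j _ hj
      exact indicator_of_notMem (fun h => h2 j i hj (mem_iInter.1 h i)) _
    · simp

lemma core1 (f : ℝ × ℝ → ℝ) (hf : Continuous f) (ε : ℝ) (hε : 0 < ε)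
    (P P' : Set (ℝ × ℝ)) (hPc : IsPreconnected P) (hPc' : IsPreconnected P')
    (hPQ : P ⊆ Icc (0 : ℝ) 1 ×ˢ Icc (0 : ℝ) 1) (hPQ' : P' ⊆ Icc (0 : ℝ) 1 ×ˢ Icc (0 : ℝ) 1)
    (hP : ∀ z ∈ P, f z ≤ -ε) (hP' : ∀ z ∈ P', ε ≤ f z)
    (x₀ x₁ x₀' x₁' : ℝ) (h0 : (x₀, (0 : ℝ)) ∈ P) (h1 : (x₁, (1 : ℝ)) ∈ P)
    (h0' : (x₀', (0 : ℝ)) ∈ P') (h1' : (x₁', (1 : ℝ)) ∈ P') (hlt : x₀ < x₀') :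
    ∃ α : unitInterval → ℝ × ℝ, Continuous α ∧ Function.Injective α ∧
      (∀ t, |f (α t)| < ε) ∧ (∀ t, α t ∈ Icc (0 : ℝ) 1 ×ˢ Icc (0 : ℝ) 1) ∧
      (α 0).2 = 0 ∧ (α 1).2 = 1 ∧
      (∀ t, t ≠ 0 → t ≠ 1 → α t ∈ Ioo (0 : ℝ) 1 ×ˢ Ioo (0 : ℝ) 1) ∧
      ∀ S : Set (ℝ × ℝ), IsPreconnected S → S ⊆ Icc (0 : ℝ) 1 ×ˢ Icc (0 : ℝ) 1 →
        (∀ t, α t ∉ S) → ∀ y y', (y, (0 : ℝ)) ∈ S → (y', (0 : ℝ)) ∈ S → y ≤ x₀ → x₀' ≤ y' →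
        False := by
  let Q : Set (ℝ × ℝ) := Icc (0 : ℝ) 1 ×ˢ Icc (0 : ℝ) 1
  have hQ : IsCompact Q := isCompact_Icc.prod isCompact_Icc
  obtain ⟨δ, hδ, hfδ⟩ := Metric.uniformContinuousOn_iff.1
    (hQ.uniformContinuousOn_of_continuous hf.continuousOn) ε hε
  obtain ⟨M, hM⟩ := exists_nat_one_div_lt hδ
  set N : ℕ := M + 1 with hNdef
  have hN : 0 < N := Nat.succ_pos M
  have hNR : (0 : ℝ) < N := by exact_mod_cast hN
  have hMN : (1 : ℝ) / N < δ := by rw [hNdef]; push_cast; exact hM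
  let pr : ℝ → ℝ := fun x => (projIcc (0 : ℝ) 1 zero_le_one x : ℝ)
  have pr_mem : ∀ x, pr x ∈ Icc (0 : ℝ) 1 := fun x => (projIcc (0 : ℝ) 1 zero_le_one x).2
  have pr_eq : ∀ x ∈ Icc (0 : ℝ) 1, pr x = x := fun x hx => by
    simp only [pr]; rw [projIcc_of_mem zero_le_one hx]
  have pr_dist : ∀ x y, dist (pr x) (pr y) ≤ dist x y := fun x y => by
    have := (LipschitzWith.projIcc (zero_le_one (α := ℝ))).dist_le_mul x y
    rw [NNReal.coe_one, one_mul] at this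
    exact this
  let cl : ℝ × ℝ → ℝ × ℝ := fun z => (pr (z.1 / N), pr (z.2 / N))
  have cl_mem : ∀ z, cl z ∈ Q := fun z => ⟨pr_mem _, pr_mem _⟩
  let up : ℝ × ℝ → ℝ × ℝ := fun z => (z.1 * N, z.2 * N)
  let dn : ℝ × ℝ → ℝ × ℝ := fun z => (z.1 / N, z.2 / N)
  have hup : Continuous up := by fun_prop
  have hdn : Continuous dn := by fun_prop
  have du : ∀ z, dn (up z) = z := fun z => by
    ext <;> simp only [dn, up] <;> field_simp
  have ud : ∀ z, up (dn z) = z := fun z => by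
    ext <;> simp only [dn, up] <;> field_simp
  have cl_dn : ∀ z, dn z ∈ Q → cl z = dn z := fun z hz =>
    Prod.ext (pr_eq _ hz.1) (pr_eq _ hz.2)
  have upQ : ∀ z ∈ Q, up z ∈ Icc 0 (N : ℝ) ×ˢ Icc 0 (N : ℝ) := by
    rintro z ⟨⟨a1, a2⟩, a3, a4⟩
    refine ⟨⟨?_, ?_⟩, ?_, ?_⟩ <;> simp only [up] <;> nlinarith
  have dnQ : ∀ z ∈ Icc 0 (N : ℝ) ×ˢ Icc 0 (N : ℝ), dn z ∈ Q := by
    rintro z ⟨⟨a1, a2⟩, a3, a4⟩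
    refine ⟨⟨?_, ?_⟩, ?_, ?_⟩ <;> simp only [dn]
    · positivity
    · rw [div_le_one hNR]; exact a2
    · positivity
    · rw [div_le_one hNR]; exact a4
  have hclup : ∀ z ∈ Q, cl (up z) = z := fun z hz => by
    rw [cl_dn _ (by rw [du]; exact hz), du]
  have h10 : up (x₀, 0) = (x₀ * N, 0) := by simp [up]
  have key : ∀ x, up (x, 0) = (x * N, 0) := fun x => by simp [up]
  have key1 : ∀ x, up (x, 1) = (x * N, (N : ℝ)) := fun x => by simp [up]
  obtain ⟨α, c1, c2, c3, c4, c5, c6, c7, c8⟩ := core N hN (fun z => f (cl z)) ε (by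
      intro z w hzw
      rw [← Real.dist_eq]
      refine hfδ _ (cl_mem z) _ (cl_mem w) (lt_of_le_of_lt ?_ hMN)
      rw [Prod.dist_eq, max_le_iff] at hzw ⊢
      have hh : ∀ x y : ℝ, dist x y ≤ 1 → dist (pr (x / N)) (pr (y / N)) ≤ 1 / N := by
        intro x y h
        refine (pr_dist _ _).trans ?_
        rw [Real.dist_eq, ← sub_div, abs_div, abs_of_pos hNR]
        exact div_le_div_of_nonneg_right h hNR.le
      exact ⟨hh _ _ hzw.1, hh _ _ hzw.2⟩)
    (Set.image up P) (Set.image up P') (hPc.image _ hup.continuousOn) (hPc'.image _ hup.continuousOn)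
    (by rintro _ ⟨z, hz, rfl⟩; exact upQ z (hPQ hz))
    (by rintro _ ⟨z, hz, rfl⟩; exact upQ z (hPQ' hz))
    (by rintro _ ⟨z, hz, rfl⟩; simp only [hclup z (hPQ hz)]; exact hP z hz)
    (by rintro _ ⟨z, hz, rfl⟩; simp only [hclup z (hPQ' hz)]; exact hP' z hz)
    (x₀ * N) (x₁ * N) (x₀' * N) (x₁' * N) ⟨_, h0, key _⟩ ⟨_, h1, key1 _⟩ ⟨_, h0', key _⟩
    ⟨_, h1', key1 _⟩ (by nlinarith)
  refine ⟨fun t => dn (α t), hdn.comp c1, ?_, ?_, fun t => dnQ _ (c4 t), ?_, ?_, ?_, ?_⟩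
  · intro s t h
    apply c2
    have := congrArg up h
    simpa only [ud] using this
  · intro t
    have := c3 t
    simp only [cl_dn _ (dnQ _ (c4 t))] at this
    exact this
  · simp [dn, c5]
  · simp only [dn, c6]; field_simp
  · intro t ht0 ht1
    obtain ⟨⟨a1, a2⟩, a3, a4⟩ := c7 t ht0 ht1
    refine ⟨⟨?_, ?_⟩, ?_, ?_⟩ <;> simp only [dn]
    · positivity
    · rw [div_lt_one hNR]; exact a2
    · positivity
    · rw [div_lt_one hNR]; exact a4
  · intro S hS hSQ hα y y' hy hy' hyx hyx'
    refine c8 (Set.image up S) (hS.image _ hup.continuousOn)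
      (by rintro _ ⟨z, hz, rfl⟩; exact upQ z (hSQ hz)) ?_ (y * N) (y' * N) ⟨_, hy, key _⟩
      ⟨_, hy', key _⟩ (by nlinarith) (by nlinarith)
    rintro t ⟨z, hz, e⟩
    refine hα t ?_
    show dn (α t) ∈ S
    rw [← e, du]
    exact hz

lemma main_sorted
    (K : Set (ℝ × ℝ)) (hK : IsCompact K)
    (hKsub : K ⊆ Set.Icc (0 : ℝ) 1 ×ˢ Set.Icc (0 : ℝ) 1)
    (n : ℕ) (P : Fin n → Set (ℝ × ℝ))
    (hPcomp : ∀ i, ∃ z ∈ K, P i = connectedComponentIn K z)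
    (hPinj : Function.Injective P) (x x' : Fin n → ℝ)
    (hx : StrictMono x) (hP0 : ∀ i, (x i, (0 : ℝ)) ∈ P i) (hP1 : ∀ i, (x' i, (1 : ℝ)) ∈ P i) :
    ∃ α : Fin (n - 1) → unitInterval → ℝ × ℝ,
      (∀ i, Continuous (α i)) ∧
      (∀ i, Function.Injective (α i)) ∧
      (∀ i, Set.range (α i) ⊆ (Set.Icc (0 : ℝ) 1 ×ˢ Set.Icc (0 : ℝ) 1) \ K) ∧
      (∀ i j, i ≠ j → Disjoint (Set.range (α i)) (Set.range (α j))) ∧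
      (∀ i, α i 0 ∈ Set.Icc (0 : ℝ) 1 ×ˢ ({0} : Set ℝ) ∧
        α i 1 ∈ Set.Icc (0 : ℝ) 1 ×ˢ ({1} : Set ℝ)) ∧
      (∀ i, ∀ t : unitInterval, t ≠ 0 → t ≠ 1 →
        α i t ∈ Set.Ioo (0 : ℝ) 1 ×ˢ Set.Ioo (0 : ℝ) 1) ∧
      ∀ i j, i < j → ∀ S : Set (ℝ × ℝ), IsPreconnected S →
        S ⊆ (Set.Icc (0 : ℝ) 1 ×ˢ Set.Icc (0 : ℝ) 1) \ ⋃ k, Set.range (α k) →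
        ∀ zi ∈ P i, ∀ zj ∈ P j, zi ∈ S → zj ∈ S → False := by
  obtain ⟨f, hf, hfK, hfP⟩ := exists_fun K hK n P hPcomp hPinj
  have hPK : ∀ i, P i ⊆ K := by
    intro i
    obtain ⟨z, hz, e⟩ := hPcomp i
    rw [e]; exact connectedComponentIn_subset K z
  have hPc : ∀ i, IsPreconnected (P i) := by
    intro i
    obtain ⟨z, hz, e⟩ := hPcomp i
    rw [e]; exact isPreconnected_connectedComponentIn
  have hex : ∀ k : Fin (n - 1), _ := fun k =>
    core1 (fun z => f z - ((k : ℕ) + 1 / 2)) (by fun_prop) (1 / 2) (by norm_num)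
      (P ⟨k, by omega⟩) (P ⟨k + 1, by omega⟩) (hPc _) (hPc _)
      ((hPK _).trans hKsub) ((hPK _).trans hKsub)
      (fun z hz => by rw [hfP _ z hz]; simp)
      (fun z hz => by rw [hfP _ z hz]; push_cast; linarith)
      _ _ _ _ (hP0 _) (hP1 _) (hP0 _) (hP1 _) (hx (by simp [Fin.lt_def]))
  choose α c1 c2 c3 c4 c5 c6 c7 c8 using hex
  have hαK : ∀ k t, α k t ∉ K := by
    intro k t h
    obtain ⟨m, hm⟩ := hfK _ h
    have := abs_lt.1 (c3 k t)
    rw [hm] at this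
    have a1 : (k : ℝ) < m := by linarith
    have a2 : (m : ℝ) < k + 1 := by linarith
    have a1 : (k : ℕ) < m := by exact_mod_cast a1
    have a2 : m < (k : ℕ) + 1 := by exact_mod_cast a2
    omega
  refine ⟨α, c1, c2, ?_, ?_, ?_, c7, ?_⟩
  · rintro i _ ⟨t, rfl⟩
    exact ⟨c4 i t, hαK i t⟩
  · intro i j hij
    rw [Set.disjoint_left]
    rintro _ ⟨t, rfl⟩ ⟨t', e⟩
    have h1 := abs_lt.1 (c3 i t)
    have h2 := abs_lt.1 (c3 j t')
    rw [e] at h2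
    have a1 : ((i : ℕ) : ℝ) < (j : ℕ) + 1 := by linarith
    have a2 : ((j : ℕ) : ℝ) < (i : ℕ) + 1 := by linarith
    have a1 : (i : ℕ) < j + 1 := by exact_mod_cast a1
    have a2 : (j : ℕ) < i + 1 := by exact_mod_cast a2
    exact hij (Fin.ext (by omega))
  · intro i
    exact ⟨⟨(c4 i 0).1, c5 i⟩, ⟨(c4 i 1).1, c6 i⟩⟩
  · intro i j hij S hS hSQ zi hzi zj hzj hSi hSj
    have hij' : (i : ℕ) < j := hij
    let k : Fin (n - 1) := ⟨i, by omega⟩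
    refine c8 k (P i ∪ S ∪ P j) ?_ ?_ ?_ (x i) (x j) (Or.inl (Or.inl (hP0 i))) (Or.inr (hP0 j))
      le_rfl (hx.monotone (by simp [k, Fin.le_def]; omega))
    · exact ((hPc i).union zi hzi hSi hS).union zj (Or.inr hSj) hzj (hPc j)
    · exact union_subset (union_subset ((hPK i).trans hKsub) (fun z hz => (hSQ hz).1))
        ((hPK j).trans hKsub)
    · rintro t ((h | h) | h)
      · exact hαK k t (hPK i h)
      · exact (hSQ h).2 (mem_iUnion.2 ⟨k, mem_range_self t⟩)
      · exact hαK k t (hPK j h)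

end SepArc


/-- Let `K ⊆ [0,1]²` be compact and let `P₁, …, Pₙ` (`n ≥ 2`) be pairwise
distinct connected components of `K`, each meeting both `I₀ = [0,1]×{0}` and
`I₁ = [0,1]×{1}`. Then there are `n - 1` pairwise disjoint arcs in `[0,1]² \ K`, joining
`I₀` to `I₁`, with interiors in `(0,1)²`, that separate any two distinct `Pᵢ`, `Pⱼ` into
different components of the complement of their union in `[0,1]²`. -/
theorem exists_separating_arcs_in_square
    (K : Set (ℝ × ℝ)) (hK : IsCompact K)
    (hKsub : K ⊆ Set.Icc (0 : ℝ) 1 ×ˢ Set.Icc (0 : ℝ) 1)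
    (n : ℕ) (hn : 2 ≤ n) (P : Fin n → Set (ℝ × ℝ))
    (hPcomp : ∀ i, ∃ z ∈ K, P i = connectedComponentIn K z)
    (hPinj : Function.Injective P)
    (hP0 : ∀ i, (P i ∩ (Set.Icc (0 : ℝ) 1 ×ˢ ({0} : Set ℝ))).Nonempty)
    (hP1 : ∀ i, (P i ∩ (Set.Icc (0 : ℝ) 1 ×ˢ ({1} : Set ℝ))).Nonempty) :
    ∃ α : Fin (n - 1) → unitInterval → ℝ × ℝ,
      (∀ i, Continuous (α i)) ∧
      (∀ i, Function.Injective (α i)) ∧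
      (∀ i, Set.range (α i) ⊆ (Set.Icc (0 : ℝ) 1 ×ˢ Set.Icc (0 : ℝ) 1) \ K) ∧
      (∀ i j, i ≠ j → Disjoint (Set.range (α i)) (Set.range (α j))) ∧
      (∀ i, α i 0 ∈ Set.Icc (0 : ℝ) 1 ×ˢ ({0} : Set ℝ) ∧
        α i 1 ∈ Set.Icc (0 : ℝ) 1 ×ˢ ({1} : Set ℝ)) ∧
      (∀ i, ∀ t : unitInterval, t ≠ 0 → t ≠ 1 →
        α i t ∈ Set.Ioo (0 : ℝ) 1 ×ˢ Set.Ioo (0 : ℝ) 1) ∧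
      ∀ i j, i ≠ j → ∀ zi ∈ P i, ∀ zj ∈ P j,
        zj ∉ connectedComponentIn
          ((Set.Icc (0 : ℝ) 1 ×ˢ Set.Icc (0 : ℝ) 1) \ ⋃ k, Set.range (α k)) zi := by
  have e0 : ∀ i, ∃ x : ℝ, (x, (0 : ℝ)) ∈ P i := by
    intro i
    obtain ⟨⟨a, b⟩, h, -, hb⟩ := hP0 i
    have hb : b = 0 := hb
    subst hb
    exact ⟨a, h⟩
  have e1 : ∀ i, ∃ x : ℝ, (x, (1 : ℝ)) ∈ P i := by
    intro i
    obtain ⟨⟨a, b⟩, h, -, hb⟩ := hP1 i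
    have hb : b = 1 := hb
    subst hb
    exact ⟨a, h⟩
  choose x hx using e0
  choose x' hx' using e1
  have hxinj : Function.Injective x := by
    intro i j h
    apply hPinj
    obtain ⟨z, hz, e⟩ := hPcomp i
    obtain ⟨w, hw, e'⟩ := hPcomp j
    have hi := hx i
    have hj := hx j
    rw [← h] at hj
    rw [e] at hi ⊢
    rw [e'] at hj ⊢
    rw [connectedComponentIn_eq hi, connectedComponentIn_eq hj]
  let ρ := Tuple.sort x
  have hmono : StrictMono (x ∘ ρ) :=
    (Tuple.monotone_sort x).strictMono_of_injective (hxinj.comp ρ.injective)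
  obtain ⟨α, c1, c2, c3, c4, c5, c6, c7⟩ := SepArc.main_sorted K hK hKsub n (P ∘ ρ)
    (fun i => hPcomp _) (hPinj.comp ρ.injective) (x ∘ ρ) (x' ∘ ρ) hmono (fun i => hx _)
    (fun i => hx' _)
  refine ⟨α, c1, c2, c3, c4, c5, c6, ?_⟩
  intro i j hij zi hzi zj hzj hmem
  have hziS := mem_connectedComponentIn (connectedComponentIn_nonempty_iff.1 ⟨_, hmem⟩)
  have hne : ρ.symm i ≠ ρ.symm j := ρ.symm.injective.ne hij
  rcases lt_or_gt_of_ne hne with h | h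
  · exact c7 _ _ h _ isPreconnected_connectedComponentIn (connectedComponentIn_subset _ _)
      zi (by simpa using hzi) zj (by simpa using hzj) hziS hmem
  · exact c7 _ _ h _ isPreconnected_connectedComponentIn (connectedComponentIn_subset _ _)
      zj (by simpa using hzj) zi (by simpa using hzi) hmem hziS
end
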